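/- arXiv:math/9810129 — 5 statements merged into one kernel-verified Lean document; each statement's English description precedes it below -/
import Mathlib

section
/- No dendrite is the continuous exactly k-to-1 image of a continuum for any integer k > 1. -/
open Set Filter Topology TopologicalSpace

/-- `c` is a chain from `x` to `y` in `s` with `N` steps, each of length less than `η`. -/
structure IsStepChain {Y : Type*} [MetricSpace Y] (s : Set Y) (η : ℝ) (N : ℕ) (x y : Y)
    (c : ℕ → Y) : Prop where
  start : c 0 = x
  const : ∀ j, N ≤ j → c j = y
  step : ∀ j, dist (c j) (c (j + 1)) < η
  mem : ∀ j, c j ∈ s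

theorem IsPreconnected.exists_isStepChain {Y : Type*} [MetricSpace Y] {s : Set Y}
    (hs : IsPreconnected s) {η : ℝ} (hη : 0 < η) {x y : Y} (hx : x ∈ s) (hy : y ∈ s) :
    ∃ N c, IsStepChain s η N x y c := by
  have key : ∀ {a b : Y}, a ∈ s → b ∈ s →
      Relation.ReflTransGen (fun u v => u ∈ s ∧ v ∈ s ∧ dist u v < η) a b := by
    intro a b ha hb
    refine hs.induction₂ (P := Relation.ReflTransGen (fun u v => u ∈ s ∧ v ∈ s ∧ dist u v < η))
      ?_ ?_ ?_ ha hb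
    · intro u hu
      filter_upwards [self_mem_nhdsWithin, mem_nhdsWithin_of_mem_nhds (Metric.ball_mem_nhds u hη)]
        with v hv huv
      exact .single ⟨hu, hv, by rwa [dist_comm]⟩
    · intro a b c _ _ _ h₁ h₂
      exact h₁.trans h₂
    · intro a b _ _ h
      have : Std.Symm (fun u v => u ∈ s ∧ v ∈ s ∧ dist u v < η) :=
        ⟨fun u v ⟨hu, hv, huv⟩ => ⟨hv, hu, by rwa [dist_comm]⟩⟩
      exact Relation.ReflTransGen.stdSymm.symm _ _ h
  have h := key hx hy
  induction h with
  | refl => exact ⟨0, fun _ => x, ⟨rfl, fun _ _ => rfl, fun _ => by simpa using hη, fun _ => hx⟩⟩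
  | @tail b d _ hbd ih =>
    obtain ⟨N, c, hc⟩ := ih hbd.1
    refine ⟨N + 1, fun j => if j ≤ N then c j else d, ⟨by simp [hc.start], ?_, ?_, ?_⟩⟩
    · intro j hj
      simp [show ¬ j ≤ N by omega]
    · intro j
      rcases lt_trichotomy j N with hj | rfl | hj
      · simpa [hj.le, show j + 1 ≤ N by omega] using hc.step j
      · simpa [hc.const j le_rfl] using hbd.2.2
      · simpa [show ¬ j ≤ N by omega, show ¬ j + 1 ≤ N by omega] using hη
    · intro j
      split_ifs
      · exact hc.mem j
      · exact hy

theorem IsStepChain.mono {Y : Type*} [MetricSpace Y] {s t : Set Y} {η : ℝ} {M N : ℕ} {x y : Y}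
    {c : ℕ → Y} (hc : IsStepChain s η M x y c) (hst : s ⊆ t) (hMN : M ≤ N) :
    IsStepChain t η N x y c :=
  ⟨hc.start, fun j hj => hc.const j (hMN.trans hj), hc.step, fun j => hst (hc.mem j)⟩

theorem IsStepChain.perturb {Y : Type*} [MetricSpace Y] {s : Set Y} {η : ℝ} (hη : 0 < η) {N : ℕ}
    {x y x' y' : Y} {c : ℕ → Y} (hc : IsStepChain s η N x y c) (hx : dist x' x < η)
    (hy : dist y y' < η) (hx' : x' ∈ s) (hy' : y' ∈ s) :
    ∃ c', IsStepChain s η (N + 2) x' y' c' := by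
  refine ⟨fun j => if j = 0 then x' else if j - 1 ≤ N then c (j - 1) else y', ⟨rfl, ?_, ?_, ?_⟩⟩
  · intro j hj
    simp [show j ≠ 0 by omega, show ¬ j ≤ N + 1 by omega]
  · intro j
    rcases j with _ | j
    · simpa [hc.start] using hx
    rcases lt_trichotomy j N with hj | rfl | hj
    · simpa [hj.le, show j + 1 ≤ N by omega] using hc.step j
    · simpa [hc.const j le_rfl] using hy
    · simpa [show ¬ j ≤ N by omega, show ¬ j + 1 ≤ N by omega] using hη
  · intro j
    split_ifs
    · exact hx'
    · exact hc.mem _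
    · exact hy'

theorem exists_uniform_isStepChain (Y : Type*) [MetricSpace Y] [CompactSpace Y]
    [LocallyConnectedSpace Y] {ε : ℝ} (hε : 0 < ε) :
    ∃ δ > 0, δ ≤ ε ∧ ∀ η > 0, ∃ N > 0, ∀ x y : Y, dist x y < δ →
      ∃ c, IsStepChain (Metric.ball x ε) η N x y c := by
  have hloc : ∀ z : Y, ∃ V ⊆ Metric.ball z (ε / 4), IsOpen V ∧ z ∈ V ∧ IsConnected V := fun z =>
    locallyConnectedSpace_iff_subsets_isOpen_isConnected.1 inferInstance z _
      (Metric.ball_mem_nhds z (by positivity))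
  choose V hVsub hVo hVmem hVc using hloc
  obtain ⟨δ, hδ, hδV⟩ := lebesgue_number_lemma_of_metric (c := V) (isCompact_univ (X := Y)) hVo
    (fun z _ => mem_iUnion.2 ⟨z, hVmem z⟩)
  refine ⟨min (δ / 2) ε, by positivity, min_le_right _ _, fun η hη => ?_⟩
  suffices H : ∃ N > 0, ∀ q ∈ {q : Y × Y | dist q.1 q.2 ≤ δ / 2},
      ∃ c, IsStepChain (Metric.ball q.1 ε) η N q.1 q.2 c by
    obtain ⟨N, hN, H⟩ := H
    exact ⟨N, hN, fun x y hxy => H (x, y) (hxy.le.trans (min_le_left _ _))⟩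
  have hcomp : IsCompact {q : Y × Y | dist q.1 q.2 ≤ δ / 2} :=
    (isClosed_le (by fun_prop) (by fun_prop)).isCompact
  refine hcomp.induction_on (p := fun T => ∃ N > 0, ∀ q ∈ T,
      ∃ c, IsStepChain (Metric.ball q.1 ε) η N q.1 q.2 c) ⟨1, one_pos, by simp⟩ ?_ ?_ ?_
  · rintro S T hST ⟨N, hN, h⟩
    exact ⟨N, hN, fun q hq => h q (hST hq)⟩
  · rintro S T ⟨N, hN, h⟩ ⟨M, hM, h'⟩
    refine ⟨max N M, by positivity, fun q hq => ?_⟩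
    rcases hq with hq | hq
    · obtain ⟨c, hc⟩ := h q hq
      exact ⟨c, hc.mono subset_rfl (le_max_left _ _)⟩
    · obtain ⟨c, hc⟩ := h' q hq
      exact ⟨c, hc.mono subset_rfl (le_max_right _ _)⟩
  · rintro ⟨x, y⟩ hxy
    obtain ⟨z, hz⟩ := hδV x (mem_univ x)
    have hxy' : dist x y ≤ δ / 2 := hxy
    have hxV : x ∈ V z := hz (Metric.mem_ball_self hδ)
    have hyV : y ∈ V z := hz (by rw [Metric.mem_ball, dist_comm]; linarith)
    obtain ⟨N, c, hc⟩ := (hVc z).isPreconnected.exists_isStepChain hη hxV hyV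
    refine ⟨_, mem_nhdsWithin_of_mem_nhds (prod_mem_nhds
      (((hVo z).inter Metric.isOpen_ball).mem_nhds ⟨hxV, Metric.mem_ball_self hη⟩)
      (((hVo z).inter Metric.isOpen_ball).mem_nhds ⟨hyV, Metric.mem_ball_self hη⟩)),
      N + 2, by omega, ?_⟩
    rintro ⟨x', y'⟩ ⟨⟨hx'V, hx'⟩, ⟨hy'V, hy'⟩⟩
    obtain ⟨c', hc'⟩ := hc.perturb hη hx' (by rwa [dist_comm]) hx'V hy'V
    refine ⟨c', hc'.mono (fun w hw => ?_) le_rfl⟩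
    have h₁ := hVsub z hw
    have h₂ := hVsub z hx'V
    rw [Metric.mem_ball] at *
    dsimp only at *
    linarith [dist_triangle_right w x' z]

theorem Nat.floor_dist_le_one {a b : ℝ} (h : |a - b| < 1) :
    ⌊a⌋₊ = ⌊b⌋₊ ∨ ⌊b⌋₊ = ⌊a⌋₊ + 1 ∨ ⌊a⌋₊ = ⌊b⌋₊ + 1 := by
  have h' := abs_lt.1 h
  have h₁ : ⌊a⌋₊ ≤ ⌊b⌋₊ + 1 := by
    rw [← Nat.lt_add_one_iff]
    refine Nat.floor_lt' (by omega) |>.2 ?_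
    push_cast
    linarith [Nat.lt_floor_add_one b]
  have h₂ : ⌊b⌋₊ ≤ ⌊a⌋₊ + 1 := by
    rw [← Nat.lt_add_one_iff]
    refine Nat.floor_lt' (by omega) |>.2 ?_
    push_cast
    linarith [Nat.lt_floor_add_one a]
  omega

theorem exists_joinedIn_of_dist_lt (Y : Type*) [MetricSpace Y] [CompactSpace Y]
    [LocallyConnectedSpace Y] {r : ℝ} (hr : 0 < r) :
    ∃ δ > 0, ∀ x y : Y, dist x y < δ → JoinedIn (Metric.closedBall x (2 * r)) x y := by
  have hε : ∀ n : ℕ, 0 < r / 2 / 2 ^ n := fun n => by positivity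
  choose δ hδ hδε hchain using fun n => exists_uniform_isStepChain Y (hε n)
  choose N hN hchain using fun n => hchain n (δ (n + 1)) (hδ (n + 1))
  refine ⟨δ 0, hδ 0, fun p y hpy => ?_⟩
  have hC : ∀ n (a b : Y), ∃ c : ℕ → Y, dist a b < δ n →
      IsStepChain (Metric.ball a (r / 2 / 2 ^ n)) (δ (n + 1)) (N n) a b c := by
    intro n a b
    by_cases h : dist a b < δ n
    · obtain ⟨c, hc⟩ := hchain n a b h
      exact ⟨c, fun _ => hc⟩
    · exact ⟨fun _ => a, fun h' => absurd h' h⟩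
  choose C hC using hC
  let G : ℕ → ℕ → Y := fun m => Nat.rec (fun i => if i = 0 then p else y)
    (fun m g i => C m (g (i / N m)) (g (i / N m + 1)) (i % N m)) m
  have hG0 : ∀ i, G 0 i = if i = 0 then p else y := fun i => rfl
  have hGs : ∀ m i, G (m + 1) i = C m (G m (i / N m)) (G m (i / N m + 1)) (i % N m) :=
    fun m i => rfl
  let P : ℕ → ℕ := fun m => ∏ j ∈ Finset.range m, N j
  have hPs : ∀ m, P (m + 1) = P m * N m := fun m => Finset.prod_range_succ _ _
  have hP : ∀ m, 0 < P m := fun m => Finset.prod_pos fun j _ => hN j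
  have hstep : ∀ m i, dist (G m i) (G m (i + 1)) < δ m := by
    intro m
    induction m with
    | zero =>
      intro i
      rcases i with _ | i
      · simpa [hG0] using hpy
      · simpa [hG0] using hδ 0
    | succ m ih =>
      intro i
      have hc := hC m _ _ (ih (i / N m))
      have hnext : G (m + 1) (i + 1) = C m (G m (i / N m)) (G m (i / N m + 1)) (i % N m + 1) := by
        have hlt := Nat.mod_lt i (hN m)
        have hi := Nat.div_add_mod i (N m)
        rcases (show i % N m + 1 ≤ N m from hlt).lt_or_eq with h | h
        · have hd : (i + 1) / N m = i / N m := by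
            rw [show i + 1 = (i % N m + 1) + N m * (i / N m) by omega,
              Nat.add_mul_div_left _ _ (hN m), Nat.div_eq_of_lt h, zero_add]
          have hm : (i + 1) % N m = i % N m + 1 := by
            have := Nat.div_add_mod (i + 1) (N m)
            rw [hd] at this
            omega
          rw [hGs, hd, hm]
        · have hd : (i + 1) / N m = i / N m + 1 := by
            rw [show i + 1 = N m * (i / N m + 1) by rw [mul_add]; omega]
            exact Nat.mul_div_cancel_left _ (hN m)
          have hm : (i + 1) % N m = 0 := by
            have := Nat.div_add_mod (i + 1) (N m)
            rw [hd, mul_add] at this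
            omega
          rw [hGs, hd, hm, h, (hC m _ _ (ih (i / N m + 1))).start, hc.const _ le_rfl]
      rw [hnext, hGs]
      exact hc.step _
  let g : ℕ → ℝ → Y := fun m t => G m ⌊(P m : ℝ) * t⌋₊
  have hg : ∀ t m, dist (g m t) (g (m + 1) t) ≤ r / 2 / 2 ^ m := by
    intro t m
    have hq : ⌊(P (m + 1) : ℝ) * t⌋₊ / N m = ⌊(P m : ℝ) * t⌋₊ := by
      rw [← Nat.floor_div_natCast, hPs]
      congr 1
      have : (N m : ℝ) ≠ 0 := by exact_mod_cast (hN m).ne'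
      push_cast
      field_simp
    have hc := hC m _ _ (hstep m ⌊(P m : ℝ) * t⌋₊)
    have := hc.mem (⌊(P (m + 1) : ℝ) * t⌋₊ % N m)
    rw [Metric.mem_ball, dist_comm] at this
    simp only [g, hGs, hq]
    exact this.le
  choose γ hγ using fun t => cauchySeq_tendsto_of_complete
    (cauchySeq_of_le_geometric_two (C := r) (f := fun m => g m t) (hg t))
  have hgγ : ∀ t m, dist (g m t) (γ t) ≤ r / 2 ^ m := fun t m =>
    dist_le_of_le_geometric_two_of_tendsto (hg t) (hγ t) m
  have hγ0 : γ 0 = p := by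
    refine tendsto_nhds_unique (hγ 0) ?_
    have : ∀ m, g m 0 = p := by
      intro m
      induction m with
      | zero => simp [g, hG0]
      | succ m ih =>
        have ih' : G m 0 = p := by simpa [g] using ih
        simp only [g, mul_zero, Nat.floor_zero, hGs, Nat.zero_div, Nat.zero_mod]
        rw [(hC m _ _ (hstep m 0)).start, ih']
    simp [this]
  have hγ1 : γ 1 = y := by
    refine tendsto_nhds_unique (hγ 1) ?_
    have : ∀ m, g m 1 = y := by
      intro m
      induction m with
      | zero => simp [g, hG0, P]
      | succ m ih =>
        have ih' : G m (P m) = y := by simpa [g] using ih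
        simp only [g, mul_one, Nat.floor_natCast, hGs, hPs, Nat.mul_div_cancel _ (hN m),
          Nat.mul_mod_left]
        rw [(hC m _ _ (hstep m (P m))).start, ih']
    simp [this]
  have hcont : Continuous γ := by
    rw [Metric.continuous_iff]
    intro t e he
    obtain ⟨m, hm⟩ : ∃ m : ℕ, 3 * r / 2 ^ m < e := by
      obtain ⟨m, hm⟩ := exists_pow_lt_of_lt_one (show 0 < e / (3 * r) by positivity)
        (show (1 / 2 : ℝ) < 1 by norm_num)
      refine ⟨m, ?_⟩
      rw [lt_div_iff₀ (by positivity)] at hm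
      calc 3 * r / 2 ^ m = (1 / 2) ^ m * (3 * r) := by rw [one_div, inv_pow]; ring
        _ < e := hm
    have hPm : (0 : ℝ) < P m := by exact_mod_cast hP m
    refine ⟨1 / P m, by positivity, fun s hs => ?_⟩
    have hfl : |(P m : ℝ) * s - P m * t| < 1 := by
      rw [← mul_sub, abs_mul, abs_of_pos hPm, mul_comm]
      rwa [Real.dist_eq, lt_div_iff₀ hPm] at hs
    have hgg : dist (g m s) (g m t) < δ m := by
      simp only [g]
      rcases Nat.floor_dist_le_one hfl with h | h | h
      · simpa [h] using hδ m
      · rw [h]; exact hstep m _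
      · rw [h, dist_comm]; exact hstep m _
    have h₁ := hgγ s m
    have h₂ := hgγ t m
    have h₃ := hδε m
    have h₄ : r / 2 / 2 ^ m ≤ r / 2 ^ m := by gcongr; linarith
    have h₅ : 3 * r / 2 ^ m = r / 2 ^ m + r / 2 ^ m + r / 2 ^ m := by ring
    have h₆ := dist_triangle4 (γ s) (g m s) (g m t) (γ t)
    rw [dist_comm (γ s) (g m s)] at h₆
    linarith
  refine JoinedIn.ofLine (f := γ) hcont.continuousOn hγ0 hγ1 ?_
  rintro _ ⟨t, ht, rfl⟩
  have h₀ := hgγ t 0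
  have h₁ : dist (g 0 t) p < r := by
    simp only [g, hG0]
    split_ifs
    · simpa using hr
    · rw [dist_comm]
      refine hpy.trans_le ((hδε 0).trans ?_)
      simp only [pow_zero, div_one]
      linarith
  rw [Metric.mem_closedBall]
  simp only [pow_zero, div_one] at h₀
  rw [dist_comm] at h₀
  linarith [dist_triangle (γ t) (g 0 t) p]

theorem locallyPathConnectedSpace_of_compactSpace (Y : Type*) [MetricSpace Y] [CompactSpace Y]
    [LocallyConnectedSpace Y] : LocallyPathConnectedSpace Y := by
  refine ⟨fun x => ?_⟩
  refine Filter.hasBasis_self.2 fun U hU => ?_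
  obtain ⟨ε, hε, hεU⟩ := Metric.nhds_basis_closedBall.mem_iff.1 hU
  obtain ⟨δ, hδ, h⟩ := exists_joinedIn_of_dist_lt Y (show 0 < ε / 2 by positivity)
  have hx : x ∈ Metric.closedBall x ε := Metric.mem_closedBall_self hε.le
  refine ⟨pathComponentIn (Metric.closedBall x ε) x, ?_, isPathConnected_pathComponentIn hx,
    pathComponentIn_subset.trans hεU⟩
  refine mem_of_superset (Metric.ball_mem_nhds x hδ) fun y hy => ?_
  have := h x y (by rwa [dist_comm])
  rwa [mul_div_cancel₀ _ (two_ne_zero)] at this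

/-- A continuous map on a compact linear order which identifies exactly the endpoints of the gaps
of the order factors through an arc. -/
theorem exists_arc_of_covBy {L Y : Type*} [LinearOrder L] [BoundedOrder L] [TopologicalSpace L]
    [CompactSpace L] [OrderClosedTopology L] [SeparableSpace L] [MetricSpace Y] {γ : L → Y}
    (hγ : Continuous γ) (hcov : ∀ s t, s < t → (γ s = γ t ↔ s ⋖ t)) (hne : γ ⊥ ≠ γ ⊤) :
    ∃ η : unitInterval → Y, Continuous η ∧ Function.Injective η ∧ η 0 = γ ⊥ ∧ η 1 = γ ⊤ ∧
      range η ⊆ range γ := by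
  let q := denseSeq L
  let u : ℕ → L → L → ℝ := fun n t r => min 1 (dist (γ (q n)) (γ (max (q n) (min r t))))
  have hu : ∀ n, Continuous ↿(u n) := fun n => by
    simp only [u, Function.HasUncurry.uncurry, id]
    fun_prop
  have hu0 : ∀ n t r, 0 ≤ u n t r := fun n t r => le_min zero_le_one dist_nonneg
  have hu1 : ∀ n t r, u n t r ≤ 1 := fun n t r => min_le_left _ _
  let φ : ℕ → L → ℝ := fun n t => sSup (u n t '' univ)
  have hφc : ∀ n, Continuous (φ n) := fun n => isCompact_univ.continuous_sSup (hu n)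
  have hbdd : ∀ n t, BddAbove (u n t '' univ) := fun n t =>
    ⟨1, by rintro _ ⟨r, -, rfl⟩; exact hu1 n t r⟩
  have hle : ∀ n t r, u n t r ≤ φ n t := fun n t r => le_csSup (hbdd n t) ⟨r, trivial, rfl⟩
  have hφ0 : ∀ n t, 0 ≤ φ n t := fun n t => (hu0 n t t).trans (hle n t t)
  have hφ1 : ∀ n t, φ n t ≤ 1 := fun n t =>
    csSup_le ⟨_, ⟨t, trivial, rfl⟩⟩ (by rintro _ ⟨r, -, rfl⟩; exact hu1 n t r)
  have hφm : ∀ n, Monotone (φ n) := by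
    intro n s t hst
    refine csSup_le ⟨_, ⟨s, trivial, rfl⟩⟩ ?_
    rintro _ ⟨r, -, rfl⟩
    have : u n s r = u n t (min r s) := by
      simp only [u, min_assoc, min_eq_left hst]
    rw [this]
    exact hle _ _ _
  have hsum : Summable fun n : ℕ => (1 / 2 : ℝ) ^ n :=
    summable_geometric_of_lt_one (by norm_num) (by norm_num)
  have hφsum : ∀ t, Summable fun n => (1 / 2 : ℝ) ^ n * φ n t := fun t =>
    hsum.of_nonneg_of_le (fun n => mul_nonneg (by positivity) (hφ0 n t))
      fun n => mul_le_of_le_one_right (by positivity) (hφ1 n t)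
  let h : L → ℝ := fun t => ∑' n, (1 / 2 : ℝ) ^ n * φ n t
  have hc : Continuous h := by
    refine continuous_tsum (fun n => continuous_const.mul (hφc n)) hsum fun n t => ?_
    rw [Real.norm_of_nonneg (mul_nonneg (by positivity) (hφ0 n t))]
    exact mul_le_of_le_one_right (by positivity) (hφ1 n t)
  have hm : Monotone h := fun s t hst =>
    (hφsum s).tsum_le_tsum (fun n => by gcongr; exact hφm n hst) (hφsum t)
  have heq : ∀ s t, s ⋖ t → h s = h t := by
    intro s t hst
    have hγst := (hcov s t hst.lt).2 hst
    have hu : ∀ n r, u n s r = u n t r := by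
      intro n r
      rcases le_or_gt r s with hr | hr
      · simp only [u, min_eq_left hr, min_eq_left (hr.trans hst.le)]
      · have hr' : t ≤ r := hst.ge_of_gt hr
        simp only [u, min_eq_right hr.le, min_eq_right hr']
        rcases le_or_gt (q n) s with hq | hq
        · rw [max_eq_right hq, max_eq_right (hq.trans hst.le), hγst]
        · rw [max_eq_left hq.le, max_eq_left (hst.ge_of_gt hq)]
    have hφ : ∀ n, φ n s = φ n t := fun n => by
      simp only [φ]
      rw [show u n s = u n t from funext (hu n)]
    simp only [h, hφ]
  have hlt : ∀ s t, s < t → ¬ s ⋖ t → h s < h t := by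
    intro s t hst hns
    have hγst : γ s ≠ γ t := fun e => hns ((hcov s t hst).1 e)
    obtain ⟨v, hsv, hvt, hv⟩ : ∃ v, s < v ∧ v < t ∧ γ v ≠ γ t := by
      obtain ⟨v, hsv, hvt⟩ := (not_covBy_iff hst).1 hns
      by_cases hv : γ v = γ t
      · have hns' : ¬ s ⋖ v := fun e => hγst (((hcov s v hsv).2 e).trans hv)
        obtain ⟨w, hsw, hwv⟩ := (not_covBy_iff hsv).1 hns'
        refine ⟨w, hsw, hwv.trans hvt, fun e => ?_⟩
        exact ((hcov w t (hwv.trans hvt)).1 e).2 hwv hvt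
      · exact ⟨v, hsv, hvt, hv⟩
    have hopen : IsOpen (Ioo s t ∩ {w | γ w ≠ γ t}) :=
      isOpen_Ioo.inter (isOpen_ne_fun hγ continuous_const)
    obtain ⟨_, ⟨⟨hsq, hqt⟩, hq⟩, n, rfl⟩ :=
      (denseRange_denseSeq L).inter_open_nonempty _ hopen ⟨v, ⟨hsv, hvt⟩, hv⟩
    have h₁ : φ n s = 0 := by
      refine le_antisymm (csSup_le ⟨_, ⟨s, trivial, rfl⟩⟩ ?_) (hφ0 n s)
      rintro _ ⟨r, -, rfl⟩
      simp only [u, max_eq_left ((min_le_right r s).trans hsq.le), q, dist_self]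
      exact min_le_right _ _
    have h₂ : 0 < φ n t := by
      refine lt_of_lt_of_le ?_ (hle n t t)
      simp only [u, min_self, q, max_eq_right hqt.le]
      exact lt_min one_pos (dist_pos.2 hq)
    refine Summable.tsum_lt_tsum (i := n) (fun n => ?_) ?_ (hφsum s) (hφsum t)
    · exact mul_le_mul_of_nonneg_left (hφm n hst.le) (by positivity)
    · exact mul_lt_mul_of_pos_left (h₁ ▸ h₂) (by positivity)
  have hiff : ∀ s t, h s = h t ↔ γ s = γ t := by
    have : ∀ s t, s < t → (h s = h t ↔ γ s = γ t) := by
      intro s t hst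
      rw [hcov s t hst]
      exact ⟨fun e => by_contra fun hn => (hlt s t hst hn).ne e, heq s t⟩
    intro s t
    rcases lt_trichotomy s t with hst | rfl | hst
    · exact this s t hst
    · simp
    · rw [eq_comm, this t s hst, eq_comm]
  have hpos : h ⊥ < h ⊤ := (hm bot_le).lt_of_ne fun e => hne ((hiff _ _).1 e)
  have hsurj : ∀ c, h ⊥ ≤ c → c ≤ h ⊤ → ∃ t, h t = c := by
    intro c hc₀ hc₁
    by_contra! hno
    obtain ⟨a, ha, hamax⟩ :=
      (isClosed_le hc (continuous_const (y := c))).isCompact.exists_isGreatest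
      ⟨⊥, hc₀⟩
    obtain ⟨b, hb, hbmin⟩ := (isClosed_le (continuous_const (y := c)) hc).isCompact.exists_isLeast
      ⟨⊤, hc₁⟩
    have hac : h a < c := lt_of_le_of_ne ha (hno a)
    have hcb : c < h b := lt_of_le_of_ne hb (hno b).symm
    have hab : a < b := lt_of_not_ge fun hba => (hac.trans hcb).not_ge (hm hba)
    refine (hac.trans hcb).ne (heq a b ⟨hab, fun d had hdb => ?_⟩)
    rcases le_total (h d) c with hd | hd
    · exact had.not_ge (hamax hd)
    · exact hdb.not_ge (hbmin hd)
  have hden : 0 < h ⊤ - h ⊥ := sub_pos.2 hpos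
  let k : L → unitInterval := fun t => ⟨(h t - h ⊥) / (h ⊤ - h ⊥),
    div_nonneg (sub_nonneg.2 (hm bot_le)) hden.le,
    div_le_one_of_le₀ (sub_le_sub_right (hm le_top) _) hden.le⟩
  have hkc : Continuous k := by
    refine Continuous.subtype_mk ?_ _
    fun_prop
  have hkh : ∀ s t, k s = k t ↔ γ s = γ t := by
    intro s t
    rw [← hiff, Subtype.ext_iff, div_left_inj' hden.ne', sub_left_inj]
  have hksurj : Function.Surjective k := by
    rintro ⟨c, hc₀, hc₁⟩
    obtain ⟨t, ht⟩ := hsurj (h ⊥ + c * (h ⊤ - h ⊥)) (by nlinarith) (by nlinarith)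
    refine ⟨t, Subtype.ext ?_⟩
    simp only [k, ht, add_sub_cancel_left]
    exact mul_div_cancel_right₀ _ hden.ne'
  choose σ hσ using hksurj
  have hηk : ∀ t, γ (σ (k t)) = γ t := fun t => (hkh _ _).1 (hσ _)
  have hk0 : k ⊥ = 0 := Subtype.ext (by simp [k])
  have hk1 : k ⊤ = 1 := Subtype.ext (by simp [k, hden.ne'])
  refine ⟨γ ∘ σ, ?_, ?_, ?_, ?_, range_comp_subset_range _ _⟩
  · rw [(IsQuotientMap.of_surjective_continuous (fun c => ⟨σ c, hσ c⟩) hkc).continuous_iff]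
    convert hγ using 1
    exact funext hηk
  · intro a b hab
    rw [← hσ a, ← hσ b]
    exact (hkh _ _).2 hab
  · rw [← hk0]; exact hηk _
  · rw [← hk1]; exact hηk _

/-- A path with distinct endpoints contains an arc with the same endpoints. -/
theorem exists_arc_of_path {Y : Type*} [MetricSpace Y] {γ : unitInterval → Y} (hγ : Continuous γ)
    (hne : γ 0 ≠ γ 1) :
    ∃ η : unitInterval → Y, Continuous η ∧ Function.Injective η ∧ η 0 = γ 0 ∧ η 1 = γ 1 ∧
      range η ⊆ range γ := by
  let S : Set (Set unitInterval) := {K | IsClosed K ∧ 0 ∈ K ∧ 1 ∈ K ∧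
    ∀ a ∈ K, ∀ b ∈ K, a < b → (∀ c ∈ K, ¬ (a < c ∧ c < b)) → γ a = γ b}
  obtain ⟨K, hK⟩ : ∃ K, Minimal (· ∈ S) K := by
    refine zorn_superset S fun c hcS hc => ?_
    rcases c.eq_empty_or_nonempty with rfl | hcne
    · refine ⟨univ, ⟨isClosed_univ, trivial, trivial, fun a _ b _ hab h => ?_⟩, by simp⟩
      obtain ⟨m, ham, hmb⟩ := exists_between hab
      exact absurd ⟨ham, hmb⟩ (h m trivial)
    refine ⟨⋂₀ c, ⟨isClosed_sInter fun K hK => (hcS hK).1, fun K hK => (hcS hK).2.1,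
      fun K hK => (hcS hK).2.2.1, ?_⟩, fun K hK => sInter_subset_of_mem hK⟩
    intro a ha b hb hab hgap
    have : Nonempty c := hcne.to_subtype
    have hdir : Directed (· ⊇ ·) fun K : c => (K : Set unitInterval) := by
      rintro ⟨K, hK⟩ ⟨K', hK'⟩
      rcases hc.total hK hK' with h | h
      · exact ⟨⟨K, hK⟩, subset_rfl, h⟩
      · exact ⟨⟨K', hK'⟩, h, subset_rfl⟩
    obtain ⟨m, ham, hmb⟩ := exists_between hab
    refine eq_of_forall_dist_le fun ε hε => ?_
    have ha' : ∀ᶠ x in 𝓝 a, dist (γ x) (γ a) < ε / 2 :=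
      hγ.continuousAt (Metric.ball_mem_nhds _ (half_pos hε))
    have hb' : ∀ᶠ x in 𝓝 b, dist (γ x) (γ b) < ε / 2 :=
      hγ.continuousAt (Metric.ball_mem_nhds _ (half_pos hε))
    obtain ⟨U, hUsub, hUo, haU⟩ := mem_nhds_iff.1 (inter_mem ha' (Iio_mem_nhds ham))
    obtain ⟨V, hVsub, hVo, hbV⟩ := mem_nhds_iff.1 (inter_mem hb' (Ioi_mem_nhds hmb))
    obtain ⟨⟨K, hKc⟩, hKU⟩ := exists_subset_nhds_of_compactSpace hdir (fun K => (hcS K.2).1)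
      (U := Iio a ∪ U ∪ V ∪ Ioi b) (by
        intro x hx
        refine (((isOpen_Iio.union hUo).union hVo).union isOpen_Ioi).mem_nhds ?_
        have hx' : x ∈ ⋂₀ c := by rwa [sInter_eq_iInter]
        rcases lt_trichotomy x a with h | rfl | h
        · exact .inl (.inl (.inl h))
        · exact .inl (.inl (.inr haU))
        rcases lt_trichotomy x b with h' | rfl | h'
        · exact absurd ⟨h, h'⟩ (hgap x hx')
        · exact .inl (.inr hbV)
        · exact .inr h')
    obtain ⟨hKcl, -, -, hKgap⟩ := hcS hKc
    have hmK : m ∉ K := by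
      intro hm
      rcases hKU hm with ((h | h) | h) | h
      · exact lt_asymm h ham
      · exact lt_irrefl m (hUsub h).2
      · exact lt_irrefl m (hVsub h).2
      · exact lt_asymm h hmb
    obtain ⟨a', ⟨ha'K, ha'm⟩, ha'max⟩ := (hKcl.inter isClosed_Iic).isCompact.exists_isGreatest
      (s := K ∩ Iic m) ⟨a, ha K hKc, ham.le⟩
    obtain ⟨b', ⟨hb'K, hb'm⟩, hb'min⟩ := (hKcl.inter isClosed_Ici).isCompact.exists_isLeast
      (s := K ∩ Ici m) ⟨b, hb K hKc, hmb.le⟩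
    have ha'm' : a' < m := lt_of_le_of_ne ha'm fun e => hmK (e ▸ ha'K)
    have hb'm' : m < b' := lt_of_le_of_ne hb'm fun e => hmK (e ▸ hb'K)
    have haa' : a ≤ a' := ha'max ⟨ha K hKc, ham.le⟩
    have hb'b : b' ≤ b := hb'min ⟨hb K hKc, hmb.le⟩
    have hγ' : γ a' = γ b' := by
      refine hKgap a' ha'K b' hb'K (ha'm'.trans hb'm') fun x hx ⟨h₁, h₂⟩ => ?_
      rcases le_total x m with h | h
      · exact h₁.not_ge (ha'max ⟨hx, h⟩)
      · exact h₂.not_ge (hb'min ⟨hx, h⟩)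
    have h₁ : dist (γ a') (γ a) < ε / 2 := by
      rcases hKU ha'K with ((h | h) | h) | h
      · exact absurd haa' (not_le.2 h)
      · exact (hUsub h).1
      · exact absurd ha'm' (lt_asymm (hVsub h).2)
      · exact absurd (ha'm'.trans hmb) (lt_asymm h)
    have h₂ : dist (γ b') (γ b) < ε / 2 := by
      rcases hKU hb'K with ((h | h) | h) | h
      · exact absurd (ham.trans hb'm') (lt_asymm h)
      · exact absurd hb'm' (lt_asymm (hUsub h).2)
      · exact (hVsub h).1
      · exact absurd hb'b (not_le.2 h)
    rw [hγ'] at h₁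
    linarith [dist_triangle_left (γ a) (γ b) (γ b')]
  obtain ⟨hKcl, hK0, hK1, hKgap⟩ := hK.prop
  have : CompactSpace K := isCompact_iff_compactSpace.1 hKcl.isCompact
  let : BoundedOrder K :=
    { bot := ⟨0, hK0⟩
      bot_le := fun x => Subtype.mk_le_mk.2 x.1.2.1
      top := ⟨1, hK1⟩
      le_top := fun x => Subtype.mk_le_mk.2 x.1.2.2 }
  obtain ⟨η, h₁, h₂, h₃, h₄, h₅⟩ := exists_arc_of_covBy (L := K) (γ := fun x => γ x)
    (hγ.comp continuous_subtype_val) (by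
      rintro ⟨s, hs⟩ ⟨t, ht⟩ (hst : s < t)
      constructor
      · intro (e : γ s = γ t)
        refine ⟨hst, ?_⟩
        rintro ⟨c, hc⟩ (hsc : s < c) (hct : c < t)
        have hmem : K \ Ioo s t ∈ S := by
          refine ⟨hKcl.sdiff isOpen_Ioo, ⟨hK0, fun h => not_lt_bot h.1⟩,
            ⟨hK1, fun h => not_top_lt h.2⟩, ?_⟩
          rintro a ⟨haK, ha⟩ b ⟨hbK, hb⟩ hab hgap
          by_cases h : ∃ d ∈ K, a < d ∧ d < b
          · obtain ⟨d, hdK, had, hdb⟩ := h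
            have hd : d ∈ Ioo s t := by
              by_contra hd
              exact hgap d ⟨hdK, hd⟩ ⟨had, hdb⟩
            have has : a ≤ s := not_lt.1 fun h => ha ⟨h, had.trans hd.2⟩
            have htb : t ≤ b := not_lt.1 fun h => hb ⟨hd.1.trans hdb, h⟩
            have has' : a = s := has.eq_of_not_lt fun h =>
              hgap s ⟨hs, fun h => lt_irrefl _ h.1⟩ ⟨h, hst.trans_le htb⟩
            have htb' : t = b := htb.eq_of_not_lt fun h =>
              hgap t ⟨ht, fun h => lt_irrefl _ h.2⟩ ⟨has.trans_lt hst, h⟩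
            rw [has', ← htb', e]
          · push Not at h
            exact hKgap a haK b hbK hab fun d hd hd' => (h d hd hd'.1).not_gt hd'.2
        exact (hK.le_of_le hmem sdiff_subset hc).2 ⟨hsc, hct⟩
      · intro h
        exact hKgap s hs t ht hst fun c hc hc' => h.2 (c := ⟨c, hc⟩) hc'.1 hc'.2)
    hne
  exact ⟨η, h₁, h₂, h₃, h₄, h₅.trans (range_subset_iff.2 fun x => ⟨x, rfl⟩)⟩

/-- Two arcs meeting exactly at their endpoints form a simple closed curve. -/
theorem exists_homeomorph_circle_of_arcs {Y : Type*} [TopologicalSpace Y] [T2Space Y] {A B : ℝ → Y}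
    (hA : Continuous A) (hB : Continuous B) {a b c d : ℝ} (hab : a < b) (hcd : c < d)
    (hAi : InjOn A (Icc a b)) (hBi : InjOn B (Icc c d)) (hac : A a = B c) (hbd : A b = B d)
    (hAB : ∀ u ∈ Icc a b, ∀ v ∈ Icc c d, A u = B v → u = a ∧ v = c ∨ u = b ∧ v = d) :
    ∃ S : Set Y, Nonempty (S ≃ₜ Circle) := by
  let F : ℝ → Y := fun x => if x ≤ b then A x else B (d - (x - b))
  have hF : Continuous F := by
    refine Continuous.if_le hA (by fun_prop) continuous_id continuous_const ?_
    rintro x rfl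
    simpa using hbd
  let T := (b - a) + (d - c)
  have hT : 0 < T := by simp only [T]; linarith
  have : Fact (0 < T) := ⟨hT⟩
  have haT : a + T = b + (d - c) := by simp only [T]; ring
  have hend : F a = F (a + T) := by
    have : ¬ (b + (d - c) ≤ b) := by linarith
    simp only [F, haT, hab.le, if_true, this, if_false]
    rw [hac]; congr 1; ring
  have hinj : InjOn F (Ico a (a + T)) := by
    have hAB' : ∀ x ∈ Ico a (a + T), ∀ y ∈ Ico a (a + T), x ≤ b → ¬ y ≤ b →
        A x ≠ B (d - (y - b)) := by
      intro x hx y hy hxb hyb e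
      rw [haT] at hx hy
      rcases hAB x ⟨hx.1, hxb⟩ _ ⟨by linarith [hy.2], by linarith⟩ e with h | h
      · linarith [hy.2, h.2]
      · linarith [h.2]
    intro x hx y hy hxy
    by_cases hxb : x ≤ b <;> by_cases hyb : y ≤ b <;>
      simp only [F, hxb, hyb, if_true, if_false] at hxy
    · exact hAi ⟨hx.1, hxb⟩ ⟨hy.1, hyb⟩ hxy
    · exact absurd hxy (hAB' x hx y hy hxb hyb)
    · exact absurd hxy.symm (hAB' y hy x hx hyb hxb)
    · rw [haT] at hx hy
      have := hBi ⟨by linarith [hx.2], by linarith⟩ ⟨by linarith [hy.2], by linarith⟩ hxy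
      linarith
  let G : AddCircle T → Y := AddCircle.liftIco T a F
  have hGc : Continuous G := AddCircle.liftIco_continuous hend hF.continuousOn
  have hGi : Function.Injective G := by
    have : G = F ∘ Subtype.val ∘ AddCircle.equivIco T a := rfl
    intro x y hxy
    rw [this] at hxy
    exact (AddCircle.equivIco T a).injective
      (Subtype.ext (hinj (AddCircle.equivIco T a x).2 (AddCircle.equivIco T a y).2 hxy))
  exact ⟨range G, ⟨(hGc.isClosedEmbedding hGi).isEmbedding.toHomeomorph.symm.trans
    (AddCircle.homeomorphCircle (ne_of_gt hT))⟩⟩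

/-- Two arcs with common endpoints, one of which misses a point of the other, contain a simple
closed curve. -/
theorem exists_homeomorph_circle_of_notMem_range {Y : Type*} [MetricSpace Y]
    {α β : unitInterval → Y}
    (hα : Continuous α) (hαi : Function.Injective α) (hβ : Continuous β)
    (hβi : Function.Injective β) (h0 : α 0 = β 0) (h1 : α 1 = β 1) {t : unitInterval}
    (ht : α t ∉ range β) :
    ∃ S : Set Y, Nonempty (S ≃ₜ Circle) := by
  obtain ⟨s₁, ⟨t₁, ht₁, hst₁⟩, hs₁max⟩ : ∃ s, IsGreatest {s | ∃ u ≤ t, α u = β s} s := by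
    refine IsCompact.exists_isGreatest (IsClosed.isCompact ?_) ⟨0, 0, t.2.1, h0⟩
    exact (((isClosed_Iic (a := t)).isCompact.image hα).isClosed).preimage hβ
  obtain ⟨s₂, ⟨hs₁₂, t₂, ht₂, hst₂⟩, hs₂min⟩ :
      ∃ s, IsLeast {s | s₁ ≤ s ∧ ∃ u, t ≤ u ∧ α u = β s} s := by
    refine IsCompact.exists_isLeast (IsClosed.isCompact ?_) ⟨1, s₁.2.2, 1, t.2.2, h1⟩
    exact isClosed_Ici.inter ((((isClosed_Ici (a := t)).isCompact.image hα).isClosed).preimage hβ)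
  have ht₁' : t₁ < t := lt_of_le_of_ne ht₁ fun e => ht ⟨s₁, by rw [← hst₁, e]⟩
  have ht₂' : t < t₂ := lt_of_le_of_ne ht₂ fun e => ht ⟨s₂, by rw [← hst₂, e]⟩
  have hs : s₁ < s₂ := by
    refine lt_of_le_of_ne hs₁₂ fun e => ?_
    have := hαi (hst₁.trans (e ▸ hst₂.symm))
    exact (ht₁'.trans ht₂').ne this
  have hproj : ∀ {x y : unitInterval} {z : ℝ}, z ∈ Icc (x : ℝ) y →
      ∃ w ∈ Icc x y, (w : ℝ) = z := fun {x y z} h =>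
    ⟨⟨z, x.2.1.trans h.1, h.2.trans y.2.2⟩, h, rfl⟩
  let A : ℝ → Y := fun x => α (projIcc 0 1 zero_le_one x)
  let B : ℝ → Y := fun x => β (projIcc 0 1 zero_le_one x)
  have hAα : ∀ w : unitInterval, A w = α w := fun w => by simp [A]
  have hBβ : ∀ w : unitInterval, B w = β w := fun w => by simp [B]
  refine exists_homeomorph_circle_of_arcs (A := A) (B := B) (hα.comp continuous_projIcc)
    (hβ.comp continuous_projIcc) (a := t₁) (b := t₂) (c := s₁) (d := s₂) (ht₁'.trans ht₂') hs
    ?_ ?_ (by rw [hAα, hBβ, hst₁]) (by rw [hAα, hBβ, hst₂]) ?_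
  · intro x hx y hy hxy
    obtain ⟨x, -, rfl⟩ := hproj hx
    obtain ⟨y, -, rfl⟩ := hproj hy
    rw [hAα, hAα] at hxy
    rw [hαi hxy]
  · intro x hx y hy hxy
    obtain ⟨x, -, rfl⟩ := hproj hx
    obtain ⟨y, -, rfl⟩ := hproj hy
    rw [hBβ, hBβ] at hxy
    rw [hβi hxy]
  · intro u hu v hv huv
    obtain ⟨u, hu', rfl⟩ := hproj hu
    obtain ⟨v, hv', rfl⟩ := hproj hv
    rw [hAα, hBβ] at huv
    rcases le_total u t with h | h
    · have hv₁ : v = s₁ := le_antisymm (hs₁max ⟨u, h, huv⟩) hv'.1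
      subst hv₁
      exact .inl ⟨congrArg _ (hαi (huv.trans hst₁.symm)), rfl⟩
    · have hv₂ : v = s₂ := le_antisymm hv'.2 (hs₂min ⟨hv'.1, u, h, huv⟩)
      subst hv₂
      exact .inr ⟨congrArg _ (hαi (huv.trans hst₂.symm)), rfl⟩

/-- In a connected, locally path connected metric space without simple closed curves, any point
can be separated from a point outside a given neighbourhood by a point of that neighbourhood. -/
theorem exists_separating_point {Y : Type*} [MetricSpace Y] [LocallyPathConnectedSpace Y]
    [ConnectedSpace Y] (hY : ¬ ∃ S : Set Y, Nonempty (S ≃ₜ Circle)) {V : Set Y} (hV : IsOpen V)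
    {p y : Y} (hp : p ∈ V) (hy : y ∉ V) :
    ∃ q ∈ V, q ≠ p ∧ p ∉ connectedComponentIn {q}ᶜ y := by
  have hpy : p ≠ y := fun e => hy (e ▸ hp)
  have : PathConnectedSpace Y := pathConnectedSpace_iff_connectedSpace.2 inferInstance
  obtain ⟨α, hα, hαi, hα0, hα1, -⟩ :=
    exists_arc_of_path (PathConnectedSpace.somePath p y).continuous
    (by simpa using hpy)
  simp only [Path.source, Path.target] at hα0 hα1
  obtain ⟨t, htV, ht0⟩ : ∃ t, α t ∈ V ∧ t ≠ 0 := by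
    have hV' : ∀ᶠ t in 𝓝[≠] (0 : unitInterval), α t ∈ V :=
      mem_nhdsWithin_of_mem_nhds ((hV.preimage hα).mem_nhds (by simpa [hα0] using hp))
    exact (hV'.and self_mem_nhdsWithin).exists
  have hqp : α t ≠ p := fun e => ht0 (hαi (e.trans hα0.symm))
  have hqy : y ≠ α t := fun e => hy (e ▸ htV)
  refine ⟨α t, htV, hqp, fun hmem => hY ?_⟩
  have hconn : IsConnected (connectedComponentIn {α t}ᶜ y) :=
    isConnected_connectedComponentIn_iff.2 hqy
  have hpath :=
    (isOpen_compl_singleton.connectedComponentIn.isConnected_iff_isPathConnected).1 hconn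
  obtain ⟨δ, hδ⟩ := hpath.joinedIn p hmem y (mem_connectedComponentIn hqy)
  obtain ⟨β, hβ, hβi, hβ0, hβ1, hβr⟩ := exists_arc_of_path δ.continuous (by simpa using hpy)
  simp only [Path.source, Path.target] at hβ0 hβ1
  refine exists_homeomorph_circle_of_notMem_range hα hαi hβ hβi (hα0.trans hβ0.symm)
    (hα1.trans hβ1.symm) (t := t) fun hr => ?_
  obtain ⟨s, hs⟩ := hβr hr
  exact connectedComponentIn_subset _ _ (hδ s) hs

/-- A continuous map to a finite discrete space on a closed set extends to a neighbourhood. -/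
theorem ContinuousOn.exists_extend_fin {X : Type*} [TopologicalSpace X] [NormalSpace X] {k : ℕ}
    [NeZero k] {A : Set X} (hA : IsClosed A) {w : X → Fin k} (hw : ContinuousOn w A) :
    ∃ O, IsOpen O ∧ A ⊆ O ∧ ∃ w' : X → Fin k, ContinuousOn w' O ∧ EqOn w' w A := by
  obtain ⟨G, hG⟩ := ContinuousMap.exists_restrict_eq hA
    (⟨fun x : A => ((w x : ℕ) : ℝ), (continuous_of_discreteTopology (f := fun i : Fin k =>
      ((i : ℕ) : ℝ))).comp (continuousOn_iff_continuous_domRestrict.1 hw)⟩ : C(A, ℝ))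
  have hG' : ∀ x ∈ A, G x = (w x : ℕ) := fun x hx => DFunLike.congr_fun hG ⟨x, hx⟩
  let U : Fin k → Set X := fun i => {x | |G x - (i : ℕ)| < 1 / 2}
  have hUo : ∀ i, IsOpen (U i) := fun i =>
    isOpen_lt (by fun_prop) continuous_const
  have hUd : ∀ i j x, x ∈ U i → x ∈ U j → i = j := by
    intro i j x hi hj
    have hi' := abs_lt.1 (show |G x - (i : ℕ)| < 1 / 2 from hi)
    have hj' := abs_lt.1 (show |G x - (j : ℕ)| < 1 / 2 from hj)
    have h₁ : ((i : ℕ) : ℝ) < (j : ℕ) + 1 := by linarith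
    have h₂ : ((j : ℕ) : ℝ) < (i : ℕ) + 1 := by linarith
    have h₁' : (i : ℕ) < j + 1 := by exact_mod_cast h₁
    have h₂' : (j : ℕ) < i + 1 := by exact_mod_cast h₂
    exact Fin.ext (by omega)
  have hAU : ∀ x ∈ A, x ∈ U (w x) := fun x hx => by simp [U, hG' x hx]
  have hex : ∀ x, ∃ i, (∃ j, x ∈ U j) → x ∈ U i := fun x => by
    by_cases h : ∃ j, x ∈ U j
    · exact ⟨h.choose, fun _ => h.choose_spec⟩
    · exact ⟨0, fun h' => absurd h' h⟩
  choose w' hw' using hex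
  have hw'eq : ∀ x i, x ∈ U i → w' x = i := fun x i hx => hUd _ _ x (hw' x ⟨i, hx⟩) hx
  refine ⟨⋃ i, U i, isOpen_iUnion hUo, fun x hx => mem_iUnion.2 ⟨_, hAU x hx⟩, w', ?_,
    fun x hx => hw'eq x _ (hAU x hx)⟩
  intro x hx
  obtain ⟨i, hi⟩ := mem_iUnion.1 hx
  refine (continuousAt_const (y := i)).congr ?_ |>.continuousWithinAt
  filter_upwards [(hUo i).mem_nhds hi] with z hz
  exact (hw'eq z i hz).symm

theorem IsPreconnected.subset_of_sdiff_isOpen {Y : Type*} [TopologicalSpace Y] {V C : Set Y} {p : Y}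
    (hV : IsPreconnected V) (hp : p ∉ V) (hC : IsClosed C) (hCp : IsOpen (C \ {p}))
    (hVC : (V ∩ C).Nonempty) : V ⊆ C := by
  have hne : ∀ y ∈ V, y ≠ p := fun y hy e => hp (e ▸ hy)
  refine (hV.subset_left_of_subset_union hCp hC.isOpen_compl
    (disjoint_compl_right.mono_left sdiff_subset) (fun y hy => ?_) ?_).trans sdiff_subset
  · by_cases h : y ∈ C
    · exact .inl ⟨h, hne y hy⟩
    · exact .inr h
  · obtain ⟨y, hyV, hyC⟩ := hVC
    exact ⟨y, hyV, hyC, hne y hyV⟩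

section Fibers

variable {X Y : Type*} {f : X → Y} {k : ℕ}

/-- The points of the fiber of `f` over `p` can be separated from each other within the preimage
of `C` by a continuous labelling with `k` labels. -/
def FiberSeparated [TopologicalSpace X] (f : X → Y) (k : ℕ) (p : Y) (C : Set Y) : Prop :=
  ∃ w : X → Fin k, ContinuousOn w (f ⁻¹' C) ∧ InjOn w (f ⁻¹' {p})

theorem bijective_domRestrict_of_injOn {F : Set X} (hF : Nat.card F = k) {w : X → Fin k}
    (hw : InjOn w F) : Function.Bijective (F.domRestrict w) := by
  rcases Nat.eq_zero_or_pos k with rfl | hk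
  · have : IsEmpty F := ⟨fun x => (w x).elim0⟩
    exact ⟨injOn_iff_injective.1 hw, fun i => i.elim0⟩
  have : Finite F := Nat.finite_of_card_ne_zero (by omega)
  have := Fintype.ofFinite F
  refine (Fintype.bijective_iff_injective_and_card _).2 ⟨injOn_iff_injective.1 hw, ?_⟩
  rw [← Nat.card_eq_fintype_card, hF, Fintype.card_fin]

theorem injOn_of_surjOn {F : Set X} (hF : Nat.card F = k) (hk : 0 < k) {w : X → Fin k}
    (hw : ∀ i, ∃ x ∈ F, w x = i) : InjOn w F := by
  have : Finite F := Nat.finite_of_card_ne_zero (by omega)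
  have := Fintype.ofFinite F
  refine injOn_iff_injective.2 ((Fintype.bijective_iff_surjective_and_card _).2 ⟨fun i => ?_, ?_⟩).1
  · obtain ⟨x, hx, rfl⟩ := hw i
    exact ⟨⟨x, hx⟩, rfl⟩
  · rw [← Nat.card_eq_fintype_card, hF, Fintype.card_fin]

theorem exists_of_injOn_fiber (hf : ∀ y, Nat.card (f ⁻¹' {y}) = k) {p : Y} {w : X → Fin k}
    (hw : InjOn w (f ⁻¹' {p})) (i : Fin k) : ∃ x, f x = p ∧ w x = i := by
  obtain ⟨⟨x, hx⟩, h⟩ := (bijective_domRestrict_of_injOn (hf p) hw).2 i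
  exact ⟨x, hx, h⟩

/-- A separated fiber is a retract of the preimage. -/
theorem FiberSeparated.exists_retraction [TopologicalSpace X]
    (hf : ∀ y, Nat.card (f ⁻¹' {y}) = k) {p : Y} {C : Set Y}
    (h : FiberSeparated f k p C) :
    ∃ g : X → X, ContinuousOn g (f ⁻¹' C) ∧ (∀ x, f (g x) = p) ∧ ∀ x, f x = p → g x = x := by
  obtain ⟨w, hwc, hwi⟩ := h
  choose s hsf hsw using exists_of_injOn_fiber hf hwi
  refine ⟨s ∘ w, (continuous_of_discreteTopology (f := s)).comp_continuousOn hwc,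
    fun x => hsf _, fun x hx => hwi (hsf _) hx (hsw _)⟩

theorem not_fiberSeparated_univ [TopologicalSpace X] [PreconnectedSpace X]
    (hf : ∀ y, Nat.card (f ⁻¹' {y}) = k) (hk : 1 < k) (p : Y) :
    ¬ FiberSeparated f k p univ := by
  rintro ⟨w, hwc, hwi⟩
  rw [preimage_univ, continuousOn_univ] at hwc
  obtain ⟨x, -, hx⟩ := exists_of_injOn_fiber hf hwi ⟨0, by omega⟩
  obtain ⟨y, -, hy⟩ := exists_of_injOn_fiber hf hwi ⟨1, hk⟩
  have := (PreconnectedSpace.constant inferInstance hwc : w x = w y)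
  rw [hx, hy] at this
  simp at this

/-- Separation of a fiber passes from the intersection of a chain of closed sets, each with at most
one boundary point, to some member of the chain. -/
theorem FiberSeparated.exists_of_directed [MetricSpace X] [CompactSpace X] [PreconnectedSpace X]
    [TopologicalSpace Y] (hfc : Continuous f) (hf : ∀ y, Nat.card (f ⁻¹' {y}) = k)
    (hk : 1 < k) {ι : Type*} [Nonempty ι] {C : ι → Set Y} {q : ι → Y}
    (hdir : Directed (· ⊇ ·) C) (hC : ∀ i, IsClosed (C i)) (hCq : ∀ i, IsOpen (C i \ {q i}))
    {p : Y} (hp : ∀ i, p ∈ C i) (h : FiberSeparated f k p (⋂ i, C i)) :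
    ∃ i, FiberSeparated f k (q i) (C i) := by
  have : NeZero k := ⟨by omega⟩
  obtain ⟨w, hwc, hwi⟩ := h
  obtain ⟨O, hO, hDO, w', hw'c, hw'⟩ := hwc.exists_extend_fin
    ((isClosed_iInter hC).preimage hfc)
  obtain ⟨i, hi⟩ := exists_subset_nhds_of_compactSpace (V := fun i => f ⁻¹' C i) (U := O)
    (fun i j => (hdir i j).imp fun l hl => ⟨preimage_mono hl.1, preimage_mono hl.2⟩)
    (fun i => (hC i).preimage hfc) (fun x hx => hO.mem_nhds (hDO (by simpa using hx)))
  refine ⟨i, w', hw'c.mono hi, injOn_of_surjOn (hf _) (by omega) fun a => ?_⟩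
  by_contra! hno
  have hlab : ∀ b, ∃ x, f x = p ∧ w' x = b := fun b => by
    obtain ⟨x, hx, hxb⟩ := exists_of_injOn_fiber hf hwi b
    refine ⟨x, hx, ?_⟩
    rw [hw' (by simpa [hx] using hp), hxb]
  have hcl : IsClopen (f ⁻¹' C i ∩ w' ⁻¹' {a}) := by
    refine ⟨(hw'c.mono hi).preimage_isClosed_of_isClosed ((hC i).preimage hfc)
      (isClosed_discrete _), ?_⟩
    have : f ⁻¹' C i ∩ w' ⁻¹' {a} = f ⁻¹' (C i \ {q i}) ∩ (O ∩ w' ⁻¹' {a}) := by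
      ext x
      constructor
      · rintro ⟨hx, hxa⟩
        exact ⟨⟨hx, fun e => hno x e hxa⟩, hi hx, hxa⟩
      · rintro ⟨hx, -, hxa⟩
        exact ⟨hx.1, hxa⟩
    rw [this]
    exact ((hCq i).preimage hfc).inter (hw'c.isOpen_inter_preimage hO (isOpen_discrete _))
  obtain ⟨x, hx, hxa⟩ := hlab a
  have huniv := hcl.eq_univ ⟨x, by simpa [hx] using hp i, hxa⟩
  have : Nontrivial (Fin k) := Fin.nontrivial_iff_two_le.2 hk
  obtain ⟨b, hb⟩ := exists_ne a
  obtain ⟨z, -, hz⟩ := hlab b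
  have hzmem : z ∈ f ⁻¹' C i ∩ w' ⁻¹' {a} := huniv ▸ mem_univ z
  exact hb (hz.symm.trans hzmem.2)

/-- Extending a labelling over a branch whose fiber is separated. -/
theorem FiberSeparated.union [TopologicalSpace X] [TopologicalSpace Y]
    (hfc : Continuous f)
    (hf : ∀ y, Nat.card (f ⁻¹' {y}) = k)
    {p q : Y} {U K : Set Y} (hU : IsOpen U) (hK : IsOpen K)
    (hKq : IsClosed (insert q K)) (hq : q ∈ U) (hpK : p ∉ insert q K)
    (hgood : FiberSeparated f k q (insert q K)) (h : FiberSeparated f k p U) :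
    FiberSeparated f k p (U ∪ K) := by
  classical
  obtain ⟨w, hwc, hwi⟩ := h
  obtain ⟨g, hgc, hgq, hgid⟩ := hgood.exists_retraction hf
  let W : X → Fin k := fun x => if f x ∈ K then w (g x) else w x
  have hW₁ : EqOn W (w ∘ g) (f ⁻¹' insert q K) := by
    intro x hx
    rcases hx with hx | hx
    · simp only [W, Function.comp, hgid x hx, ite_self]
    · simp only [W, Function.comp]
      rw [if_pos (show f x ∈ K from hx)]
  have hW₂ : EqOn W w (f ⁻¹' Kᶜ) := fun x hx => if_neg hx
  have hwg : ContinuousOn (w ∘ g) (f ⁻¹' insert q K) :=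
    hwc.comp hgc fun x _ => by simpa [hgq x] using hq
  have h₁ : ContinuousOn W (f ⁻¹' insert q K) := hwg.congr hW₁
  have h₂ : ContinuousOn W (f ⁻¹' (U \ K)) := (hwc.mono (preimage_mono sdiff_subset)).congr
    (hW₂.mono (preimage_mono fun _ hx => hx.2))
  refine ⟨W, ?_, ?_⟩
  · intro x hx
    by_cases hxK : f x ∈ K
    · exact (h₁.continuousAt (mem_of_superset ((hK.preimage hfc).mem_nhds hxK)
        (preimage_mono (subset_insert _ _)))).continuousWithinAt
    have hxU : f x ∈ U := hx.resolve_right hxK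
    by_cases hxq : f x = q
    · have hcont : ContinuousWithinAt W (f ⁻¹' insert q K ∪ f ⁻¹' (U \ K)) x :=
        (h₁ x (.inl hxq)).union (h₂ x ⟨hxU, hxK⟩)
      refine hcont.mono ?_
      rintro z (hz | hz)
      · by_cases hzK : f z ∈ K
        · exact .inl (.inr hzK)
        · exact .inr ⟨hz, hzK⟩
      · exact .inl (.inr hz)
    · have hxn : f x ∉ insert q K := by simp [hxq, hxK]
      have hnhds : f ⁻¹' (U \ insert q K) ∈ 𝓝 x :=
        ((hU.sdiff hKq).preimage hfc).mem_nhds ⟨hxU, hxn⟩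
      exact (h₂.continuousAt (mem_of_superset hnhds (preimage_mono
        (sdiff_subset_sdiff_right (subset_insert _ _))))).continuousWithinAt
  · refine hwi.congr fun x hx => (hW₂ ?_).symm
    intro hxK
    exact hpK (.inr (by have hx' : f x = p := hx; rwa [hx'] at hxK))

theorem exists_fiberSeparated_nhds [MetricSpace X] [CompactSpace X] [TopologicalSpace Y]
    [T2Space Y] (hfc : Continuous f) (hf : ∀ y, Nat.card (f ⁻¹' {y}) = k)
    (hk : 1 < k) (p : Y) : ∃ V, IsOpen V ∧ p ∈ V ∧ FiberSeparated f k p V := by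
  have : NeZero k := ⟨by omega⟩
  have hfin : Finite (f ⁻¹' {p}) := Nat.finite_of_card_ne_zero (by rw [hf]; omega)
  let e : f ⁻¹' {p} ≃ Fin k := Nat.equivFinOfCardPos (by rw [hf]; omega) |>.trans
    (finCongr (hf p))
  classical
  let w : X → Fin k := fun x => if hx : x ∈ f ⁻¹' {p} then e ⟨x, hx⟩ else 0
  have hwe : ∀ x (hx : x ∈ f ⁻¹' {p}), w x = e ⟨x, hx⟩ := fun x hx => dif_pos hx
  have hwc : ContinuousOn w (f ⁻¹' {p}) := (toFinite (f ⁻¹' {p})).continuousOn _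
  have hwi : InjOn w (f ⁻¹' {p}) := by
    intro x hx y hy hxy
    rw [hwe x hx, hwe y hy] at hxy
    exact congrArg Subtype.val (e.injective hxy)
  obtain ⟨O, hO, hpO, w', hw'c, hw'⟩ := hwc.exists_extend_fin (isClosed_singleton.preimage hfc)
  refine ⟨(f '' Oᶜ)ᶜ, (hO.isClosed_compl.isCompact.image hfc).isClosed.isOpen_compl, ?_, w',
    hw'c.mono fun x hx => ?_, hwi.congr hw'.symm⟩
  · rintro ⟨x, hx, hxp⟩
    exact hx (hpO hxp)
  · by_contra hxO
    exact hx ⟨x, hxO, rfl⟩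

end Fibers

theorem closure_connectedComponentIn_compl_subset {Y : Type*} [TopologicalSpace Y] {q y : Y}
    (hy : y ≠ q) :
    closure (connectedComponentIn {q}ᶜ y) ⊆ insert q (connectedComponentIn {q}ᶜ y) := by
  intro z hz
  by_cases hzq : z = q
  · exact .inl hzq
  have hpre : IsPreconnected (connectedComponentIn {q}ᶜ y) := isPreconnected_connectedComponentIn
  refine .inr ((hpre.subset_closure (subset_insert z _) (insert_subset hz subset_closure)
    ).subset_connectedComponentIn (.inr (mem_connectedComponentIn hy))
    (insert_subset hzq (connectedComponentIn_subset _ _)) (mem_insert _ _))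

/-- No dendrite (a locally connected continuum containing no simple closed
curve) is the continuous exactly `k`-to-1 image of a continuum, for any
integer `k > 1`. -/
theorem no_dendrite_is_k_to_one_image (Y : Type) [MetricSpace Y] [CompactSpace Y]
    [ConnectedSpace Y] [LocallyConnectedSpace Y]
    (hnoscc : ¬ ∃ S : Set Y, Nonempty (S ≃ₜ Circle))
    (k : ℕ) (hk : 1 < k) :
    ¬ ∃ (X : Type) (_ : MetricSpace X), CompactSpace X ∧ ConnectedSpace X ∧
      ∃ f : X → Y, Continuous f ∧ Function.Surjective f ∧
        ∀ y : Y, Nat.card (f ⁻¹' {y}) = k := by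
  rintro ⟨X, _, _, _, f, hfc, -, hf⟩
  have : LocallyPathConnectedSpace Y :=
    locallyPathConnectedSpace_of_compactSpace Y
  let S : Set (Set Y) := {C | ∃ p ∈ C, IsClosed C ∧ IsOpen (C \ {p}) ∧ ¬ FiberSeparated f k p C}
  have hmin : ∃ C, Minimal (· ∈ S) C := by
    refine zorn_superset S fun c hcS hc => ?_
    rcases c.eq_empty_or_nonempty with rfl | hcne
    · obtain ⟨p⟩ := (inferInstance : Nonempty Y)
      exact ⟨univ, ⟨p, trivial, isClosed_univ, isOpen_univ.sdiff isClosed_singleton,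
        not_fiberSeparated_univ hf hk p⟩, by simp⟩
    have : Nonempty c := hcne.to_subtype
    choose q hqC hCcl hCo hCbad using fun C : c => hcS C.2
    have hdir : Directed (· ⊇ ·) fun C : c => (C : Set Y) := by
      rintro ⟨K, hK⟩ ⟨K', hK'⟩
      rcases hc.total hK hK' with h | h
      · exact ⟨⟨K, hK⟩, subset_rfl, h⟩
      · exact ⟨⟨K', hK'⟩, h, subset_rfl⟩
    have : IsCodirectedOrder c := ⟨hdir⟩
    obtain ⟨p, hp⟩ := exists_clusterPt_of_compactSpace (map q atBot)
    have hfreq : ∀ U ∈ 𝓝 p, ∀ C : c, ∃ C' ≤ C, q C' ∈ U := fun U hU C =>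
      frequently_atBot.1 (mapClusterPt_iff_frequently.1 hp U hU) C
    have hpC : ∀ C : c, p ∈ (C : Set Y) := by
      intro C
      by_contra hpC
      obtain ⟨C', hC', hq⟩ := hfreq _ ((hCcl C).isOpen_compl.mem_nhds hpC) C
      exact hq (hC' (hqC C'))
    refine ⟨⋂ C : c, (C : Set Y), ⟨p, mem_iInter.2 hpC, isClosed_iInter hCcl, ?_, fun h => ?_⟩,
      fun C hC => iInter_subset (fun C : c => (C : Set Y)) ⟨C, hC⟩⟩
    · rw [isOpen_iff_mem_nhds]
      rintro y ⟨hyD, hyp⟩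
      obtain ⟨U, U', hU, hU', hyU, hpU', hUU'⟩ := t2_separation (show y ≠ p from hyp)
      obtain ⟨V, hVU, hV, hyV, hVc⟩ := locallyConnectedSpace_iff_subsets_isOpen_isConnected.1
        inferInstance y U (hU.mem_nhds hyU)
      refine mem_of_superset (hV.mem_nhds hyV) fun z hz => ⟨mem_iInter.2 fun C => ?_, ?_⟩
      · obtain ⟨C', hC', hq⟩ := hfreq _ (hU'.mem_nhds hpU') C
        exact hC' (hVc.isPreconnected.subset_of_sdiff_isOpen
          (fun h => disjoint_left.1 hUU' (hVU h) hq) (hCcl C') (hCo C')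
          ⟨y, hyV, mem_iInter.1 hyD C'⟩ hz)
      · rintro rfl
        exact disjoint_left.1 hUU' (hVU hz) hpU'
    · obtain ⟨C, hC⟩ := h.exists_of_directed hfc hf hk hdir hCcl hCo hpC
      exact hCbad C hC
  obtain ⟨C, hCmin⟩ := hmin
  obtain ⟨p, hpC, hCcl, hCo, hbad⟩ := hCmin.prop
  obtain ⟨V, hV, hpV, hVsep⟩ := exists_fiberSeparated_nhds hfc hf hk p
  have hbranch : ∀ y : (C \ V : Set Y), ∃ q ∈ V, ∃ K : Set Y, IsOpen K ∧ (y : Y) ∈ K ∧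
      IsClosed (insert q K) ∧ p ∉ insert q K ∧ FiberSeparated f k q (insert q K) := by
    rintro ⟨y, hyC, hyV⟩
    obtain ⟨q, hqV, hqp, hpK⟩ := exists_separating_point hnoscc hV hpV hyV
    have hyq : y ≠ q := fun e => hyV (e ▸ hqV)
    have hKo : IsOpen (connectedComponentIn {q}ᶜ y) := isOpen_compl_singleton.connectedComponentIn
    have hqK : q ∉ connectedComponentIn {q}ᶜ y := fun h => connectedComponentIn_subset _ _ h rfl
    have hyK : y ∈ connectedComponentIn {q}ᶜ y := mem_connectedComponentIn hyq
    have hclos := closure_connectedComponentIn_compl_subset hyq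
    have hKC : connectedComponentIn {q}ᶜ y ⊆ C :=
      isPreconnected_connectedComponentIn.subset_of_sdiff_isOpen hpK hCcl hCo ⟨y, hyK, hyC⟩
    have hqclos : q ∈ closure (connectedComponentIn {q}ᶜ y) := by
      by_contra hq
      have hcl : IsClosed (connectedComponentIn {q}ᶜ y) := isClosed_of_closure_subset fun z hz =>
        (hclos hz).resolve_left fun e => hq (e ▸ hz)
      exact hpK ((IsClopen.eq_univ ⟨hcl, hKo⟩ ⟨y, hyK⟩).symm ▸ mem_univ p)
    have hins : insert q (connectedComponentIn {q}ᶜ y) = closure (connectedComponentIn {q}ᶜ y) :=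
      (insert_subset hqclos subset_closure).antisymm hclos
    have hcl : IsClosed (insert q (connectedComponentIn {q}ᶜ y)) := hins ▸ isClosed_closure
    have hpK' : p ∉ insert q (connectedComponentIn {q}ᶜ y) := by
      rintro (h | h)
      exacts [hqp h.symm, hpK h]
    refine ⟨q, hqV, _, hKo, hyK, hcl, hpK', ?_⟩
    by_contra hbad'
    have hmem : insert q (connectedComponentIn {q}ᶜ y) ∈ S :=
      ⟨q, mem_insert _ _, hcl, by rwa [insert_sdiff_self_of_notMem hqK], hbad'⟩
    refine hpK' (hCmin.le_of_le hmem ?_ hpC)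
    exact hins ▸ closure_minimal hKC hCcl
  choose q hqV K hKo hyK hKcl hpK hKsep using hbranch
  obtain ⟨t, ht⟩ := (hCcl.sdiff hV).isCompact.elim_finite_subcover K hKo
    fun y hy => mem_iUnion.2 ⟨⟨y, hy⟩, hyK ⟨y, hy⟩⟩
  have hind : ∀ t : Finset (C \ V : Set Y), FiberSeparated f k p (V ∪ ⋃ y ∈ t, K y) := by
    classical
    intro t
    induction t using Finset.induction_on with
    | empty => simpa using hVsep
    | insert a t _ ih =>
      have h := FiberSeparated.union hfc hf
        (hV.union (isOpen_biUnion fun y _ => hKo y)) (hKo a) (hKcl a)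
        (.inl (hqV a)) (hpK a) (hKsep a) ih
      rwa [Finset.set_biUnion_insert, union_comm (K a), ← union_assoc]
  obtain ⟨w, hwc, hwi⟩ := hind t
  refine hbad ⟨w, hwc.mono (preimage_mono fun y hy => ?_), hwi⟩
  by_cases hyV : y ∈ V
  · exact .inl hyV
  · exact .inr (ht ⟨hy, hyV⟩)
end

section
/- If a continuum Y contains a non-unicoherent subcontinuum, then for every integer k > 1 there exists a continuum X and a continuous exactly k-to-1 map from X onto Y. -/
open Metric Set

/-- The preimage of a point under the first projection of `X ⊆ Y × ℝ` has `k` elements if the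
fibre of `X` is the arithmetic progression `0, s, …, (k - 1) s` with `s ≠ 0`. -/
lemma card_fst_preimage_of_fiber_eq_progression {Y : Type*} {X : Set (Y × ℝ)} {k : ℕ} {y : Y}
    {s : ℝ} (hs : s ≠ 0) (h : ∀ t, (y, t) ∈ X ↔ ∃ j : Fin k, t = (j : ℕ) * s) :
    Nat.card ((fun x : X => x.1.1) ⁻¹' {y}) = k := by
  let g : Fin k → (fun x : X => x.1.1) ⁻¹' {y} :=
    fun j => ⟨⟨(y, (j : ℕ) * s), (h _).2 ⟨j, rfl⟩⟩, rfl⟩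
  have hg : Function.Bijective g := by
    constructor
    · intro i j hij
      have h' : ((i : ℕ) : ℝ) * s = (j : ℕ) * s := congrArg (fun x => x.1.1.2) hij
      exact Fin.ext (Nat.cast_injective (mul_right_cancel₀ hs h'))
    · rintro ⟨⟨⟨z, t⟩, hx⟩, hz⟩
      obtain rfl : z = y := hz
      obtain ⟨j, rfl⟩ := (h t).1 hx
      exact ⟨j, rfl⟩
  rw [← Nat.card_eq_of_bijective g hg, Nat.card_fin]

section Layers

variable {Y : Type*} [MetricSpace Y]

/-- The graph over `Y` of `j` times the distance to `A ∪ B`, together with the graphs over `A` and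
over `B` of `j` times the distance to `Q` and `j` times the sum of the distances to `Q` and `P`. -/
def layer (A B P Q : Set Y) (j : ℝ) : Set (Y × ℝ) :=
  (fun y => (y, j * infDist y (A ∪ B))) '' univ ∪ (fun y => (y, j * infDist y Q)) '' A ∪
    (fun y => (y, j * (infDist y Q + infDist y P))) '' B

lemma mem_layer {A B P Q : Set Y} {j : ℝ} {y : Y} {t : ℝ} :
    (y, t) ∈ layer A B P Q j ↔ t = j * infDist y (A ∪ B) ∨ (y ∈ A ∧ t = j * infDist y Q) ∨
      (y ∈ B ∧ t = j * (infDist y Q + infDist y P)) := by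
  simp only [layer, mem_union, mem_image, mem_univ, true_and, Prod.mk.injEq]
  constructor
  · rintro ((⟨x, rfl, rfl⟩ | ⟨x, hx, rfl, rfl⟩) | ⟨x, hx, rfl, rfl⟩) <;> simp [*]
  · rintro (rfl | ⟨hy, rfl⟩ | ⟨hy, rfl⟩)
    exacts [.inl (.inl ⟨y, rfl, rfl⟩), .inl (.inr ⟨y, hy, rfl, rfl⟩), .inr ⟨y, hy, rfl, rfl⟩]

lemma isCompact_layer [CompactSpace Y] {A B : Set Y} (P Q : Set Y) (hA : IsCompact A)
    (hB : IsCompact B) (j : ℝ) : IsCompact (layer A B P Q j) := by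
  refine ((isCompact_univ.image ?_).union (hA.image ?_)).union (hB.image ?_)
  all_goals
    have := fun S : Set Y => continuous_infDist_pt S
    fun_prop

lemma mk_zero_mem_layer {A B P Q : Set Y} {q : Y} (hq : q ∈ A) (j : ℝ) :
    (q, (0 : ℝ)) ∈ layer A B P Q j :=
  mem_layer.2 (.inl (by rw [infDist_zero_of_mem (mem_union_left B hq), mul_zero]))

lemma isPreconnected_layer [PreconnectedSpace Y] {A B P Q : Set Y} (hA : IsPreconnected A)
    (hB : IsPreconnected B) (hP : (A ∩ B ∩ P).Nonempty) (hQ : (A ∩ Q).Nonempty) (j : ℝ) :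
    IsPreconnected (layer A B P Q j) := by
  have hc := fun S : Set Y => continuous_infDist_pt S
  obtain ⟨p, ⟨hpA, hpB⟩, hpP⟩ := hP
  obtain ⟨q, hqA, hqQ⟩ := hQ
  refine IsPreconnected.union (p, j * infDist p Q) (.inr ⟨p, hpA, rfl⟩)
    ⟨p, hpB, by simp [infDist_zero_of_mem hpP]⟩ ?_ (hB.image _ (by fun_prop))
  refine IsPreconnected.union (q, 0) ⟨q, mem_univ q, ?_⟩ ⟨q, hqA, ?_⟩
    (isPreconnected_univ.image _ (by fun_prop)) (hA.image _ (by fun_prop))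
  · simp [infDist_zero_of_mem (mem_union_left B hqA)]
  · simp [infDist_zero_of_mem hqQ]

lemma exists_fiber_iUnion_layer_eq_progression {A B P Q : Set Y} (hA : IsClosed A)
    (hB : IsClosed B) (hP : IsClosed P) (hQ : IsClosed Q) (hP₀ : P.Nonempty) (hQ₀ : Q.Nonempty)
    (hPQ : Disjoint P Q) (hAB : A ∩ B = P ∪ Q) {k : ℕ} (hk : 0 < k) (y : Y) :
    ∃ s : ℝ, s ≠ 0 ∧ ∀ t, (y, t) ∈ ⋃ j : Fin k, layer A B P Q (j : ℕ) ↔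
      ∃ j : Fin k, t = (j : ℕ) * s := by
  have key : ∀ s : ℝ, (∀ j t, (y, t) ∈ layer A B P Q j ↔ t = 0 ∨ t = j * s) → ∀ t,
      ((y, t) ∈ ⋃ j : Fin k, layer A B P Q (j : ℕ)) ↔ ∃ j : Fin k, t = (j : ℕ) * s := by
    intro s h t
    simp only [mem_iUnion, h]
    constructor
    · rintro ⟨j, rfl | ht⟩
      exacts [⟨⟨0, hk⟩, by simp⟩, ⟨j, ht⟩]
    · rintro ⟨j, ht⟩
      exact ⟨j, .inr ht⟩
  have pos : ∀ {S : Set Y}, IsClosed S → S.Nonempty → y ∉ S → 0 < infDist y S :=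
    fun h h' => (h.notMem_iff_infDist_pos h').1
  have hy : y ∈ A ∧ y ∈ B ↔ y ∈ P ∨ y ∈ Q := Set.ext_iff.1 hAB y
  by_cases hyB : y ∈ B
  · refine ⟨infDist y Q + infDist y P, ?_, key _ fun j t => ?_⟩
    · by_cases hyQ : y ∈ Q
      · exact (add_pos_of_nonneg_of_pos infDist_nonneg
          (pos hP hP₀ fun h => disjoint_left.1 hPQ h hyQ)).ne'
      · exact (add_pos_of_pos_of_nonneg (pos hQ hQ₀ hyQ) infDist_nonneg).ne'
    · rw [mem_layer, infDist_zero_of_mem (mem_union_right A hyB), mul_zero]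
      by_cases hyA : y ∈ A
      · rcases hy.1 ⟨hyA, hyB⟩ with h | h
        · simp [hyA, hyB, infDist_zero_of_mem h]
        · simp [hyA, hyB, infDist_zero_of_mem h]
      · simp [hyA, hyB]
  by_cases hyA : y ∈ A
  · refine ⟨infDist y Q, (pos hQ hQ₀ fun h => hyB (hy.2 (.inr h)).2).ne', key _ fun j t => ?_⟩
    rw [mem_layer, infDist_zero_of_mem (mem_union_left B hyA), mul_zero]
    simp [hyA, hyB]
  · obtain ⟨p, hp⟩ := hP₀
    have hpA : p ∈ A := (hAB.symm.subset (.inl hp)).1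
    refine ⟨infDist y (A ∪ B), (pos (hA.union hB) ⟨p, .inl hpA⟩ (by simp [hyA, hyB])).ne', ?_⟩
    intro t
    simp [mem_layer, hyA, hyB]

end Layers

/-- If a continuum `Y` contains a non-unicoherent subcontinuum (a subcontinuum
which is the union of two subcontinua whose intersection fails to be
connected), then for every integer `k > 1` there is a continuum `X` and a
continuous exactly `k`-to-1 map from `X` onto `Y`.  Note that since
`¬ IsPreconnected (A ∩ B)` forces `A ∩ B ≠ ∅`, the union `A ∪ B` is
automatically a subcontinuum of `Y`. -/
theorem k_to_one_map_onto_nonunicoherent (Y : Type) [MetricSpace Y] [CompactSpace Y]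
    [ConnectedSpace Y]
    (hnu : ∃ A B : Set Y, IsCompact A ∧ IsConnected A ∧ IsCompact B ∧ IsConnected B ∧
      ¬ IsPreconnected (A ∩ B))
    (k : ℕ) (hk : 1 < k) :
    ∃ (X : Type) (_ : MetricSpace X), CompactSpace X ∧ ConnectedSpace X ∧
      ∃ f : X → Y, Continuous f ∧ Function.Surjective f ∧
        ∀ y : Y, Nat.card (f ⁻¹' {y}) = k := by
  obtain ⟨A, B, hAc, hA, hBc, hB, hAB⟩ := hnu
  simp only [isPreconnected_closed_iff, not_forall, not_nonempty_iff_eq_empty] at hAB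
  obtain ⟨T, T', hT, hT', hsub, hTne, hTne', hdisj⟩ := hAB
  have hABcl : IsClosed (A ∩ B) := hAc.isClosed.inter hBc.isClosed
  have hPQ : Disjoint (A ∩ B ∩ T) (A ∩ B ∩ T') := by
    rw [disjoint_iff_inter_eq_empty, ← inter_inter_distrib_left, hdisj]
  have hfib := exists_fiber_iUnion_layer_eq_progression hAc.isClosed hBc.isClosed
    (hABcl.inter hT) (hABcl.inter hT') hTne hTne' hPQ
    (by rw [← inter_union_distrib_left, inter_eq_left.2 hsub]) (zero_lt_one.trans hk)
  set P := A ∩ B ∩ T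
  set Q := A ∩ B ∩ T'
  set X := ⋃ j : Fin k, layer A B P Q (j : ℕ)
  have hXc : IsCompact X := isCompact_iUnion fun j => isCompact_layer P Q hAc hBc _
  obtain ⟨a, ha⟩ := hA.nonempty
  have hX : IsConnected X := by
    refine ⟨⟨(a, 0), mem_iUnion.2 ⟨⟨0, zero_lt_one.trans hk⟩, mk_zero_mem_layer ha _⟩⟩, ?_⟩
    refine isPreconnected_iUnion ⟨(a, 0), mem_iInter.2 fun j => mk_zero_mem_layer ha _⟩ fun j =>
      isPreconnected_layer hA.isPreconnected hB.isPreconnected ?_ ?_ _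
    · exact hTne.mono (subset_inter inter_subset_left subset_rfl)
    · exact hTne'.mono (subset_inter (inter_subset_left.trans inter_subset_left) subset_rfl)
  have hcard : ∀ y : Y, Nat.card ((fun x : X => x.1.1) ⁻¹' {y}) = k := fun y =>
    let ⟨_, hs, h⟩ := hfib y
    card_fst_preimage_of_fiber_eq_progression hs h
  refine ⟨X, inferInstance, isCompact_iff_compactSpace.1 hXc, isConnected_iff_connectedSpace.1 hX,
    fun x => x.1.1, by fun_prop, fun y => ?_, hcard⟩
  have : Nonempty ((fun x : X => x.1.1) ⁻¹' {y}) :=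
    (Nat.card_pos_iff.1 (by rw [hcard]; exact zero_lt_one.trans hk)).1
  exact this.elim fun x => ⟨x.1, x.2⟩
end

section
/- If k is an odd positive integer and f is a continuous exactly k-to-1 map between finite graphs G and H, then each vertex of H of odd order has an odd number of odd-order vertices of G in its preimage (with respect to suitable vertex sets). -/
/-- A (combinatorial-topological) finite graph structure on a space `G`: a
finite vertex set, finitely many edges, each edge an embedded arc with
endpoints among the vertices, with pairwise disjoint interiors avoiding the
vertices, covering all of `G`. -/
structure GraphStructure (G : Type) [TopologicalSpace G] where
  V : Set G
  Vfin : V.Finite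
  E : Type
  Efin : Fintype E
  edge : E → unitInterval → G
  edge_cont : ∀ e, Continuous (edge e)
  edge_inj : ∀ e, Function.Injective (edge e)
  endpoint0 : ∀ e, edge e 0 ∈ V
  endpoint1 : ∀ e, edge e 1 ∈ V
  interior_disjoint : ∀ e₁ e₂, e₁ ≠ e₂ → ∀ t₁ t₂ : unitInterval,
    t₁ ≠ 0 → t₁ ≠ 1 → t₂ ≠ 0 → t₂ ≠ 1 → edge e₁ t₁ ≠ edge e₂ t₂
  interior_not_vertex : ∀ e, ∀ t : unitInterval, t ≠ 0 → t ≠ 1 → edge e t ∉ V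
  covers : ∀ x : G, x ∈ V ∨ ∃ e, ∃ t : unitInterval, edge e t = x

/-- The Euler number of a graph: number of edges minus number of vertices. -/
noncomputable def GraphStructure.eulerNumber {G : Type} [TopologicalSpace G]
    (S : GraphStructure G) : ℤ :=
  (@Fintype.card S.E S.Efin : ℤ) - (S.V.ncard : ℤ)

/-- The order of a vertex: the number of edge-ends incident to it. -/
noncomputable def GraphStructure.order {G : Type} [TopologicalSpace G]
    (S : GraphStructure G) (v : G) : ℕ :=
  Nat.card {p : S.E × Bool // S.edge p.1 (if p.2 then 1 else 0) = v}

section GraphMaps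

open Set Topology

theorem countable_image_isLocalMax {X Y : Type*} [TopologicalSpace X] [SecondCountableTopology X]
    [PartialOrder Y] (F : X → Y) : (F '' {x | IsLocalMax F x}).Countable := by
  have h : F '' {x | IsLocalMax F x} ⊆
      ⋃ U ∈ TopologicalSpace.countableBasis X, {y | IsGreatest (F '' U) y} := by
    rintro _ ⟨x, hx, rfl⟩
    obtain ⟨U, hU, hxU, hUs⟩ :=
      (TopologicalSpace.isBasis_countableBasis X).mem_nhds_iff.1 (show {z | F z ≤ F x} ∈ 𝓝 x from hx)
    refine mem_biUnion hU ⟨mem_image_of_mem _ hxU, ?_⟩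
    rintro _ ⟨z, hz, rfl⟩
    exact hUs hz
  refine Countable.mono h ((TopologicalSpace.countable_countableBasis X).biUnion fun U _ => ?_)
  exact Subsingleton.countable fun y hy z hz => hy.unique hz

theorem countable_image_isLocalExtr {X Y : Type*} [TopologicalSpace X]
    [SecondCountableTopology X] [PartialOrder Y] (F : X → Y) :
    (F '' {x | IsLocalExtr F x}).Countable := by
  refine Countable.mono ?_
    ((countable_image_isLocalMax (Y := Yᵒᵈ) F).union (countable_image_isLocalMax F))
  rintro _ ⟨x, hx | hx, rfl⟩
  · exact Or.inl ⟨x, hx, rfl⟩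
  · exact Or.inr ⟨x, hx, rfl⟩

section Parity

variable {α β : Type*} [ConditionallyCompleteLinearOrder α] [TopologicalSpace α] [OrderTopology α]
  [DenselyOrdered α] [LinearOrder β] [TopologicalSpace β] [OrderClosedTopology β] {F : α → β}

theorem lt_iff_lt_of_forall_ne (hF : Continuous F) {y : β} {p q : α} (hpq : p ≤ q)
    (h : ∀ x ∈ Icc p q, F x ≠ y) : F p < y ↔ F q < y := by
  constructor <;> intro h1 <;> by_contra! h2
  · obtain ⟨x, hx, e⟩ := intermediate_value_Icc hpq hF.continuousOn ⟨h1.le, h2⟩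
    exact h x hx e
  · obtain ⟨x, hx, e⟩ := intermediate_value_Icc' hpq hF.continuousOn ⟨h1.le, h2⟩
    exact h x hx e

/-- A level of a continuous function that is not a local extremum is crossed an odd number of
times exactly when the endpoints of the interval lie on different sides of it. -/
theorem odd_ncard_level_iff (hF : Continuous F) {y : β}
    (hy : ∀ x, F x = y → ¬ IsLocalExtr F x) {a b : α} (hab : a ≤ b) (ha : F a ≠ y) (hb : F b ≠ y)
    (hfin : (Icc a b ∩ F ⁻¹' {y}).Finite) :
    Odd (Icc a b ∩ F ⁻¹' {y}).ncard ↔ ¬ (F a < y ↔ F b < y) := by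
  induction hn : (Icc a b ∩ F ⁻¹' {y}).ncard generalizing a with
  | zero =>
    rw [ncard_eq_zero hfin] at hn
    have := lt_iff_lt_of_forall_ne hF hab fun x hx e =>
      (hn ▸ (⟨hx, e⟩ : x ∈ Icc a b ∩ F ⁻¹' {y}) : x ∈ (∅ : Set α))
    simp [this]
  | succ n ih =>
    set S := Icc a b ∩ F ⁻¹' {y}
    have hne : S.Nonempty := nonempty_of_ncard_ne_zero (by omega)
    obtain ⟨c, hc, hcmin⟩ := S.exists_min_image id hfin hne
    have hac : a < c := lt_of_le_of_ne hc.1.1 (by rintro rfl; exact ha hc.2)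
    have hcb : c < b := lt_of_le_of_ne hc.1.2 (by rintro rfl; exact hb hc.2)
    obtain ⟨m, hm, hmmin⟩ := (insert b (S \ {c})).exists_min_image id
      (hfin.sdiff.insert b) (insert_nonempty _ _)
    have hcm : c < m := by
      rcases hm with rfl | hm
      · exact hcb
      · exact lt_of_le_of_ne (hcmin m hm.1) (Ne.symm hm.2)
    have hmb : m ≤ b := hmmin b (mem_insert _ _)
    obtain ⟨d, hcd, hdm⟩ := exists_between hcm
    have hright : ∀ x, c < x → x ≤ d → F x ≠ y := fun x hx hxd e =>
      absurd (hmmin x (Or.inr ⟨⟨⟨hac.le.trans hx.le, hxd.trans (hdm.le.trans hmb)⟩, e⟩, hx.ne'⟩))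
        (not_le.2 (hxd.trans_lt hdm))
    have hleft : ∀ x, a ≤ x → x < c → F x ≠ y := fun x hx hxc e =>
      absurd (hcmin x ⟨⟨hx, hxc.le.trans hcb.le⟩, e⟩) (not_le.2 hxc)
    have hS' : Icc d b ∩ F ⁻¹' {y} = S \ {c} := by
      ext x
      constructor
      · rintro ⟨hx, e⟩
        exact ⟨⟨⟨hac.le.trans (hcd.le.trans hx.1), hx.2⟩, e⟩, (hcd.trans_le hx.1).ne'⟩
      · rintro ⟨hx, hxc⟩
        exact ⟨⟨hdm.le.trans (hmmin x (Or.inr ⟨hx, hxc⟩)), hx.1.2⟩, hx.2⟩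
    have key := ih (hdm.le.trans hmb) (hright d hcd le_rfl) (hS' ▸ hfin.sdiff)
      (by rw [hS', ncard_sdiff_singleton_of_mem hc, hn]; rfl)
    have hcross : ¬ (F a < y ↔ F d < y) := by
      intro hiff
      have hsame : ∀ x ∈ Ioo a d, x ≠ c → (F x < y ↔ F a < y) := by
        intro x hx hxc
        rcases lt_or_gt_of_ne hxc with hlt | hgt
        · exact (lt_iff_lt_of_forall_ne hF hx.1.le fun z hz =>
            hleft z hz.1 (hz.2.trans_lt hlt)).symm
        · exact (lt_iff_lt_of_forall_ne hF hx.2.le fun z hz =>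
            hright z (hgt.trans_le hz.1) hz.2).trans hiff.symm
      have hcy : F c = y := hc.2
      refine hy c hcy ?_
      by_cases hlt : F a < y
      · refine Or.inr (Filter.mem_of_superset (Ioo_mem_nhds hac hcd) fun x hx => ?_)
        rcases eq_or_ne x c with rfl | hxc
        · exact le_rfl
        · exact hcy ▸ ((hsame x hx hxc).2 hlt).le
      · refine Or.inl (Filter.mem_of_superset (Ioo_mem_nhds hac hcd) fun x hx => ?_)
        rcases eq_or_ne x c with rfl | hxc
        · exact le_rfl
        · exact hcy ▸ not_lt.1 (mt (hsame x hx hxc).1 hlt)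
    rw [Nat.odd_add_one, key]
    tauto

end Parity

namespace GraphStructure

variable {G H : Type} [TopologicalSpace G] [TopologicalSpace H]

theorem edge_mem_V_iff (S : GraphStructure G) (e : S.E) (t : unitInterval) :
    S.edge e t ∈ S.V ↔ t = 0 ∨ t = 1 := by
  constructor
  · intro h
    by_contra! ht
    exact S.interior_not_vertex e t ht.1 ht.2 h
  · rintro (rfl | rfl)
    exacts [S.endpoint0 e, S.endpoint1 e]

theorem edge_eq_edge (S : GraphStructure G) {e₁ e₂ : S.E} {t₁ t₂ : unitInterval}
    (h : S.edge e₁ t₁ = S.edge e₂ t₂) (hV : S.edge e₁ t₁ ∉ S.V) : e₁ = e₂ := by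
  have hV' := hV
  rw [h] at hV'
  rw [edge_mem_V_iff] at hV hV'
  push Not at hV hV'
  by_contra hne
  exact S.interior_disjoint e₁ e₂ hne t₁ t₂ hV.1 hV.2 hV'.1 hV'.2 h

theorem isOpen_range_edge_diff [T2Space H] (S : GraphStructure H) (e : S.E) :
    IsOpen (range (S.edge e) \ S.V) := by
  have := S.Efin
  have heq : range (S.edge e) \ S.V = (S.V ∪ ⋃ e' ∈ {e' | e' ≠ e}, range (S.edge e'))ᶜ := by
    ext x
    simp only [mem_sdiff, mem_range, mem_compl_iff, mem_union, mem_iUnion, not_or, mem_ofPred_eq]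
    constructor
    · rintro ⟨⟨t, rfl⟩, hx⟩
      refine ⟨hx, ?_⟩
      rintro ⟨e', hne, t', ht'⟩
      exact hne (S.edge_eq_edge ht'.symm hx).symm
    · rintro ⟨hx, hx'⟩
      refine ⟨?_, hx⟩
      obtain hV | ⟨e', t, rfl⟩ := S.covers x
      · exact absurd hV hx
      · by_cases hne : e' = e
        · exact ⟨t, by rw [hne]⟩
        · exact absurd ⟨e', hne, t, rfl⟩ hx'
  rw [heq, isOpen_compl_iff]
  exact S.Vfin.isClosed.union
    ((toFinite _).isClosed_biUnion fun e' _ => (isCompact_range (S.edge_cont e')).isClosed)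

/-- A path whose interior avoids the vertices stays inside one closed edge. -/
theorem exists_edge_lift [T2Space H] (S : GraphStructure H) {γ : unitInterval → H}
    (hγ : Continuous γ) (hint : ∀ t, t ≠ 0 → t ≠ 1 → γ t ∉ S.V) :
    ∃ e : S.E, ∃ φ : unitInterval → unitInterval, Continuous φ ∧ ∀ t, γ t = S.edge e (φ t) := by
  have hmem : ∀ t ∈ Ioo (0 : unitInterval) 1, γ t ∉ S.V := fun t ht => hint t ht.1.ne' ht.2.ne
  obtain ⟨s, hs⟩ : (Ioo (0 : unitInterval) 1).Nonempty := nonempty_Ioo.2 zero_lt_one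
  obtain ⟨e, t₀, ht₀⟩ := (S.covers (γ s)).resolve_left (hmem s hs)
  have hcl : IsClosed (γ ⁻¹' range (S.edge e)) :=
    (isCompact_range (S.edge_cont e)).isClosed.preimage hγ
  have hsub : Ioo (0 : unitInterval) 1 ⊆ γ ⁻¹' range (S.edge e) := by
    have hpre := (isPreconnected_Ioo (a := (0 : unitInterval)) (b := 1)).subset_of_closure_inter_subset
      (u := γ ⁻¹' (range (S.edge e) \ S.V)) ((S.isOpen_range_edge_diff e).preimage hγ)
      ⟨s, hs, ⟨t₀, ht₀⟩, hmem s hs⟩ ?_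
    · exact hpre.trans fun t ht => ht.1
    · rintro t ⟨ht, htI⟩
      exact ⟨closure_minimal (fun x hx => hx.1) hcl ht, hmem t htI⟩
  have hall : ∀ t, γ t ∈ range (S.edge e) := by
    have := closure_minimal hsub hcl
    rw [closure_Ioo zero_ne_one] at this
    exact fun t => this ⟨t.2.1, t.2.2⟩
  choose φ hφ using hall
  have hemb := ((S.edge_cont e).isClosedEmbedding (S.edge_inj e)).isEmbedding
  refine ⟨e, φ, hemb.continuous_iff.2 ?_, fun t => (hφ t).symm⟩
  exact hγ.congr fun t => (hφ t).symm


/-- The point of `G` at the end of an edge; `true` labels the end with parameter `1`. -/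
def endpoint (S : GraphStructure G) (p : S.E × Bool) : G :=
  S.edge p.1 (if p.2 then 1 else 0)

open scoped Classical in
theorem order_eq_card_filter (S : GraphStructure G) [Fintype S.E] (v : G) :
    S.order v = (Finset.univ.filter fun p => S.endpoint p = v).card := by
  rw [order, Nat.card_eq_fintype_card, Fintype.card_subtype]
  rfl

/-- A vertex-preserving continuous map of graphs is, on every edge, a continuous map into an
edge. -/
theorem exists_edge_map [T2Space H] (SG : GraphStructure G) (SH : GraphStructure H) {f : G → H}
    (hf : Continuous f) (hvert : f ⁻¹' SH.V = SG.V) :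
    ∃ η : SG.E → SH.E, ∃ φ : SG.E → unitInterval → unitInterval, (∀ a, Continuous (φ a)) ∧
      ∀ a t, f (SG.edge a t) = SH.edge (η a) (φ a t) := by
  have h (a : SG.E) := SH.exists_edge_lift (hf.comp (SG.edge_cont a)) fun t h0 h1 hV =>
    SG.interior_not_vertex a t h0 h1 (hvert ▸ hV : SG.edge a t ∈ SG.V)
  choose η φ hφ h using h
  exact ⟨η, φ, hφ, h⟩

section EdgeMap

variable {SG : GraphStructure G} {SH : GraphStructure H} {f : G → H} {η : SG.E → SH.E}
  {φ : SG.E → unitInterval → unitInterval}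

theorem edge_map_eq_zero_or_one_iff (hvert : f ⁻¹' SH.V = SG.V)
    (h : ∀ a t, f (SG.edge a t) = SH.edge (η a) (φ a t)) (a : SG.E) (t : unitInterval) :
    φ a t = 0 ∨ φ a t = 1 ↔ t = 0 ∨ t = 1 := by
  rw [← SH.edge_mem_V_iff (η a), ← h, ← SG.edge_mem_V_iff a, ← hvert, mem_preimage]

open scoped Classical in
/-- The fibre over an interior point of an edge, counted edge by edge. -/
theorem card_fiber_eq_sum [Fintype SG.E] (hvert : f ⁻¹' SH.V = SG.V)
    (h : ∀ a t, f (SG.edge a t) = SH.edge (η a) (φ a t)) (e : SH.E) {t : unitInterval}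
    (ht0 : t ≠ 0) (ht1 : t ≠ 1) (hfin : (f ⁻¹' {SH.edge e t}).Finite) :
    (∀ a, η a = e → (φ a ⁻¹' {t}).Finite) ∧
      Nat.card (f ⁻¹' {SH.edge e t}) = ∑ a with η a = e, (φ a ⁻¹' {t}).ncard := by
  have hfin' : ∀ a, η a = e → (φ a ⁻¹' {t}).Finite := by
    rintro a rfl
    refine (hfin.preimage (SG.edge_inj a).injOn).subset fun s hs => ?_
    have hs : φ a s = t := hs
    simp [h, hs]
  refine ⟨hfin', ?_⟩
  have hV : SH.edge e t ∉ SH.V := SH.interior_not_vertex e t ht0 ht1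
  have hEV : ∀ a s, φ a s = t → SG.edge a s ∉ SG.V := by
    intro a s hs
    rw [SG.edge_mem_V_iff, ← edge_map_eq_zero_or_one_iff hvert h, hs]
    tauto
  have hset : f ⁻¹' {SH.edge e t} =
      ⋃ a ∈ Finset.univ.filter fun a => η a = e, SG.edge a '' (φ a ⁻¹' {t}) := by
    ext x
    simp only [mem_preimage, mem_singleton_iff, Finset.mem_filter, Finset.mem_univ, true_and,
      mem_iUnion, mem_image, exists_prop]
    constructor
    · intro hx
      have hxV : x ∉ SG.V := by rwa [← hvert, mem_preimage, hx]
      obtain ⟨a, s, rfl⟩ := (SG.covers x).resolve_left hxV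
      rw [h] at hx
      have ha : η a = e := (SH.edge_eq_edge hx.symm hV).symm
      subst ha
      exact ⟨a, rfl, s, SH.edge_inj _ hx, rfl⟩
    · rintro ⟨a, rfl, s, hs, rfl⟩
      rw [h, hs]
  rw [Nat.card_coe_set_eq, hset, ← Finset.set_biUnion_coe, (Finset.finite_toSet _).ncard_biUnion]
  · rw [finsum_mem_coe_finset]
    exact Finset.sum_congr rfl fun a _ => ncard_image_of_injective _ (SG.edge_inj a)
  · intro a ha
    exact (hfin' a (by simpa using ha)).image _
  · intro a _ b _ hab
    refine disjoint_left.2 ?_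
    rintro _ ⟨s, hs, rfl⟩ ⟨s', hs', hss⟩
    exact hab (SG.edge_eq_edge hss.symm (hEV a s hs))

open scoped Classical in
/-- Every end of an edge is covered by an odd number of ends of edges. -/
theorem odd_card_ends_over [Fintype SG.E] (hvert : f ⁻¹' SH.V = SG.V)
    (hφ : ∀ a, Continuous (φ a)) (h : ∀ a t, f (SG.edge a t) = SH.edge (η a) (φ a t))
    {k : ℕ} (hk : Odd k) (hfib : ∀ y, Nat.card (f ⁻¹' {y}) = k) (p : SH.E × Bool) :
    Odd (Finset.univ.filter fun q : SG.E × Bool =>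
      (η q.1, decide (φ q.1 (if q.2 then 1 else 0) = 1)) = p).card := by
  obtain ⟨e, b⟩ := p
  obtain ⟨t, ht0, ht1, ht⟩ : ∃ t : unitInterval, 0 < t ∧ t < 1 ∧
      ∀ a, t ∉ φ a '' {x | IsLocalExtr (φ a) x} := by
    have hc : (⋃ a, φ a '' {x | IsLocalExtr (φ a) x}).Countable :=
      countable_iUnion fun a => countable_image_isLocalExtr (φ a)
    obtain ⟨y, hy, hy'⟩ := ((hc.image Subtype.val).dense_compl ℝ).exists_mem_open isOpen_Ioo
      (nonempty_Ioo.2 (zero_lt_one' ℝ))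
    exact ⟨⟨y, hy'.1.le, hy'.2.le⟩, hy'.1, hy'.2, fun a ha =>
      hy ⟨_, mem_iUnion.2 ⟨a, ha⟩, rfl⟩⟩
  have hfin : (f ⁻¹' {SH.edge e t}).Finite :=
    Set.finite_coe_iff.1 (Nat.finite_of_card_ne_zero (by rw [hfib]; exact hk.pos.ne'))
  obtain ⟨hfin', hcard⟩ := card_fiber_eq_sum hvert h e ht0.ne' ht1.ne hfin
  rw [hfib] at hcard
  rw [hcard, Finset.odd_sum_iff_odd_card_odd] at hk
  have hends : (Finset.univ.filter fun q : SG.E × Bool =>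
      (η q.1, decide (φ q.1 (if q.2 then 1 else 0) = 1)) = (e, b)).card =
      ∑ a with η a = e, (Finset.univ.filter fun c : Bool =>
        decide (φ a (if c then 1 else 0) = 1) = b).card := by
    rw [← Finset.card_sigma]
    refine Finset.card_bij' (fun q _ => ⟨q.1, q.2⟩) (fun q _ => (q.1, q.2)) ?_ ?_ ?_ ?_ <;> simp
  rw [hends, Finset.odd_sum_iff_odd_card_odd]
  suffices H : ∀ a ∈ Finset.univ.filter fun a => η a = e,
      (Odd (Finset.univ.filter fun c : Bool =>
        decide (φ a (if c then 1 else 0) = 1) = b).card ↔ Odd (φ a ⁻¹' {t}).ncard) by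
    rwa [Finset.filter_congr H]
  intro a ha
  have hend (s : unitInterval) := (edge_map_eq_zero_or_one_iff hvert h a s).2
  have h0 := hend 0 (Or.inl rfl)
  have h1 := hend 1 (Or.inr rfl)
  have hlevel : Odd (φ a ⁻¹' {t}).ncard ↔ ¬ (φ a 0 < t ↔ φ a 1 < t) := by
    have huniv : Icc (0 : unitInterval) 1 ∩ φ a ⁻¹' {t} = φ a ⁻¹' {t} :=
      inter_eq_right.2 fun x _ => ⟨x.2.1, x.2.2⟩
    have hne : ∀ s, φ a s = 0 ∨ φ a s = 1 → φ a s ≠ t := by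
      rintro s (hs | hs) <;> rw [hs]
      exacts [ht0.ne, ht1.ne']
    have := odd_ncard_level_iff (hφ a) (fun x hx hx' => ht a ⟨x, hx', hx⟩) zero_le_one
      (hne 0 h0) (hne 1 h1) ((hfin' a (by simpa using ha)).inter_of_right _)
    rwa [huniv] at this
  rw [hlevel]
  rcases h0 with h0 | h0 <;> rcases h1 with h1 | h1 <;> cases b <;>
    simp [h0, h1, ht0, ht1.le, Finset.filter_insert, Finset.filter_singleton]

end EdgeMap

end GraphStructure

end GraphMaps

/-- If `k` is an odd positive integer and `f` is a continuous exactly `k`-to-1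
map between finite connected graphs `G` and `H`, with vertex sets chosen so
that the vertex set of `G` is exactly the preimage of the vertex set of `H`,
then each vertex of `H` of odd order has an odd number of odd-order vertices
of `G` in its preimage. -/
theorem odd_order_vertices_in_preimage (G H : Type) [MetricSpace G] [CompactSpace G]
    [ConnectedSpace G] [MetricSpace H] [CompactSpace H] [ConnectedSpace H]
    (SG : GraphStructure G) (SH : GraphStructure H)
    (k : ℕ) (hk : 0 < k) (hkodd : Odd k)
    (f : G → H) (hcont : Continuous f) (hsurj : Function.Surjective f)
    (hfib : ∀ y : H, Nat.card (f ⁻¹' {y}) = k)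
    (hvert : f ⁻¹' SH.V = SG.V) :
    ∀ v ∈ SH.V, Odd (SH.order v) →
      Odd ((SG.V ∩ f ⁻¹' {v} ∩ {u | Odd (SG.order u)}).ncard) := by
  classical
  intro v hv hodd
  obtain ⟨η, φ, hφ, h⟩ := SG.exists_edge_map SH hcont hvert
  let _ := SG.Efin
  let _ := SH.Efin
  have hfin : (f ⁻¹' {v}).Finite :=
    Set.finite_coe_iff.1 (Nat.finite_of_card_ne_zero (by rw [hfib]; exact hk.ne'))
  have hset : SG.V ∩ f ⁻¹' {v} ∩ {u | Odd (SG.order u)} =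
      (hfin.toFinset.filter fun u => Odd (SG.order u) : Finset G) := by
    ext u
    simp only [Set.mem_inter_iff, Set.mem_preimage, Set.mem_singleton_iff, Set.mem_ofPred_eq,
      Finset.coe_filter, Set.Finite.mem_toFinset, ← hvert]
    exact ⟨fun hu => ⟨hu.1.2, hu.2⟩, fun hu => ⟨⟨hu.1 ▸ hv, hu.1⟩, hu.2⟩⟩
  rw [hset, Set.ncard_coe_finset, ← Finset.odd_sum_iff_odd_card_odd]
  let T := Finset.univ.filter fun q => f (SG.endpoint q) = v
  have hsum : ∑ u ∈ hfin.toFinset, SG.order u = T.card := by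
    rw [Finset.card_eq_sum_card_fiberwise (f := SG.endpoint) (t := hfin.toFinset)
      (fun q hq => by simpa [T] using hq)]
    refine Finset.sum_congr rfl fun u hu => ?_
    rw [SG.order_eq_card_filter, Finset.filter_filter]
    congr 1
    refine Finset.filter_congr fun q _ => ⟨fun hq => ⟨?_, hq⟩, fun hq => hq.2⟩
    rw [hq]
    simpa using hu
  let g : SG.E × Bool → SH.E × Bool :=
    fun q => (η q.1, decide (φ q.1 (if q.2 then 1 else 0) = 1))
  have hg : ∀ q, SH.endpoint (g q) = f (SG.endpoint q) := by
    intro q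
    have hend : φ q.1 (if q.2 then 1 else 0) = 0 ∨ φ q.1 (if q.2 then 1 else 0) = 1 :=
      (GraphStructure.edge_map_eq_zero_or_one_iff hvert h _ _).2 (by cases q.2 <;> simp)
    rw [GraphStructure.endpoint, GraphStructure.endpoint, h]
    rcases hend with he | he <;> simp [g, he]
  have hT : T.card = ∑ p with SH.endpoint p = v, (Finset.univ.filter fun q => g q = p).card := by
    rw [Finset.card_eq_sum_card_fiberwise (f := g)
      (t := Finset.univ.filter fun p => SH.endpoint p = v)
      (fun q hq => by simpa [T, hg] using hq)]
    refine Finset.sum_congr rfl fun p hp => ?_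
    rw [Finset.filter_filter]
    congr 1
    refine Finset.filter_congr fun q _ => ⟨fun hq => hq.2, fun hq => ⟨?_, hq⟩⟩
    rw [← hg, hq]
    simpa using hp
  rw [hsum, hT, Finset.odd_sum_iff_odd_card_odd, Finset.filter_true_of_mem fun p _ =>
    GraphStructure.odd_card_ends_over hvert hφ h hkodd hfib p, ← SH.order_eq_card_filter]
  exact hodd
end

section
/- Let G and H be finite connected graphs with Euler numbers m and n respectively. Then there exists an exactly 2-to-1 function from G onto H with at most finitely many points of discontinuity if and only if m = 2n. -/
section TwoToOne

open Set Filter Topology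

theorem not_three_of_card_fiber {X : Type*} {h : X → ℝ}
    (hfib : ∀ y, ∃ p q, p ≠ q ∧ ∀ x, h x = y ↔ x = p ∨ x = q) {F : Filter ℝ}
    {A B C : Set X} (hAB : Disjoint A B) (hAC : Disjoint A C) (hBC : Disjoint B C)
    (hA : h '' A ∈ F) (hB : h '' B ∈ F) (hC : ∃ᶠ v in F, v ∈ h '' C) : False := by
  obtain ⟨v, ⟨c, hc, hcv⟩, ⟨a, ha, hav⟩, ⟨b, hb, hbv⟩⟩ := (hC.and_eventually (inter_mem hA hB)).exists
  obtain ⟨p, q, -, hpq⟩ := hfib v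
  have h1 := hAB.ne_of_mem ha hb
  have h2 := hAC.ne_of_mem ha hc
  have h3 := hBC.ne_of_mem hb hc
  rw [hpq] at hcv hav hbv
  grind

theorem image_mem_nhdsGT_or_nhdsLT {u : ℝ → ℝ} (hu : Continuous u) {x t : ℝ} (hne : u t ≠ u x)
    {T : Set ℝ} (hT : uIcc x t \ {x} ⊆ T) :
    u '' T ∈ 𝓝[>] (u x) ∨ u '' T ∈ 𝓝[<] (u x) := by
  have key : uIcc (u x) (u t) \ {u x} ⊆ u '' T := by
    rintro w ⟨hw, hwx⟩
    obtain ⟨s, hs, rfl⟩ := intermediate_value_uIcc hu.continuousOn hw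
    exact ⟨s, hT ⟨hs, fun h => hwx (by rw [mem_singleton_iff.1 h]; rfl)⟩, rfl⟩
  rcases hne.lt_or_gt with h | h
  · right
    refine mem_of_superset (Ioo_mem_nhdsLT h) fun w hw => key ⟨?_, hw.2.ne⟩
    rw [uIcc_of_ge h.le]; exact ⟨hw.1.le, hw.2.le⟩
  · left
    refine mem_of_superset (Ioo_mem_nhdsGT h) fun w hw => key ⟨?_, hw.1.ne'⟩
    rw [uIcc_of_le h.le]; exact ⟨hw.1.le, hw.2.le⟩

theorem tendsto_atTop_or_atBot_of_not_mapClusterPt {u : ℝ → ℝ} (hu : Continuous u)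
    (h : ∀ y, ¬ MapClusterPt y atTop u) : Tendsto u atTop atTop ∨ Tendsto u atTop atBot := by
  have large : ∀ N : ℝ, ∀ᶠ t in atTop, N < |u t| := by
    intro N
    by_contra hN
    obtain ⟨y, -, hy⟩ := (isCompact_Icc (a := -N) (b := N)).exists_mapClusterPt_of_frequently
      (f := u) (l := atTop) (by
        rw [Filter.not_eventually] at hN
        refine hN.mono fun t ht => ?_
        rw [not_lt, abs_le] at ht
        exact ht)
    exact h y hy
  obtain ⟨T, hT⟩ := eventually_atTop.1 (large 0)
  have hsgn : ∀ t ≥ T, 0 < u T * u t := by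
    intro t ht
    by_contra hneg
    have : (0 : ℝ) ∈ uIcc (u T) (u t) := by
      rw [mem_uIcc]
      rcases le_total 0 (u T) with h0 | h0 <;> rcases le_total 0 (u t) with h1 | h1
      · have := abs_pos.1 (hT T le_rfl); have := abs_pos.1 (hT t ht)
        exact absurd (mul_pos (lt_of_le_of_ne h0 (Ne.symm ‹u T ≠ 0›))
          (lt_of_le_of_ne h1 (Ne.symm ‹u t ≠ 0›))) hneg
      · exact Or.inr ⟨h1, h0⟩
      · exact Or.inl ⟨h0, h1⟩
      · have := abs_pos.1 (hT T le_rfl); have := abs_pos.1 (hT t ht)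
        exact absurd (mul_pos_of_neg_of_neg (lt_of_le_of_ne h0 ‹u T ≠ 0›)
          (lt_of_le_of_ne h1 ‹u t ≠ 0›)) hneg
    obtain ⟨s, hs, hs0⟩ := intermediate_value_uIcc hu.continuousOn this
    rw [uIcc_of_le ht] at hs
    have := hT s hs.1
    simp [hs0] at this
  rcases lt_trichotomy (u T) 0 with h0 | h0 | h0
  · right
    refine tendsto_atBot.2 fun N => ?_
    filter_upwards [large (-N), eventually_ge_atTop T] with t ht hTt
    rw [abs_of_neg (neg_of_mul_pos_right (hsgn t hTt) h0.le)] at ht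
    linarith
  · have := hT T le_rfl
    simp [h0] at this
  · left
    refine tendsto_atTop.2 fun N => ?_
    filter_upwards [large N, eventually_ge_atTop T] with t ht hTt
    rw [abs_of_pos (pos_of_mul_pos_right (hsgn t hTt) h0.le)] at ht
    exact ht.le

theorem image_Ioi_mem_atTop {u : ℝ → ℝ} (hu : Continuous u) (h : Tendsto u atTop atTop) (a : ℝ) :
    u '' Ioi a ∈ (atTop : Filter ℝ) := by
  refine mem_of_superset (Ici_mem_atTop (u (a + 1))) fun w hw => ?_
  obtain ⟨t, ht, hat⟩ := ((h.eventually_ge_atTop w).and (eventually_ge_atTop (a + 1))).exists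
  obtain ⟨s, hs, rfl⟩ := intermediate_value_Icc hat hu.continuousOn ⟨hw, ht⟩
  exact ⟨s, by rw [mem_Ioi]; linarith [hs.1], rfl⟩

theorem image_Ioi_mem_atBot {u : ℝ → ℝ} (hu : Continuous u) (h : Tendsto u atTop atBot) (a : ℝ) :
    u '' Ioi a ∈ (atBot : Filter ℝ) := by
  refine mem_of_superset (Iic_mem_atBot (u (a + 1))) fun w hw => ?_
  obtain ⟨t, ht, hat⟩ := ((h.eventually_le_atBot w).and (eventually_ge_atTop (a + 1))).exists
  obtain ⟨s, hs, rfl⟩ := intermediate_value_Icc' hat hu.continuousOn ⟨ht, hw⟩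
  exact ⟨s, by rw [mem_Ioi]; linarith [hs.1], rfl⟩

theorem exists_pos_forall_sigma_mk_ne {ι : Type*} {p q : Σ _ : ι, ℝ} (hpq : p ≠ q) :
    ∃ δ > 0, ∀ s t : ℝ, |s| < δ → |t| < δ →
      (⟨p.1, p.2 + s⟩ : Σ _ : ι, ℝ) ≠ ⟨q.1, q.2 + t⟩ := by
  obtain ⟨i, x⟩ := p
  obtain ⟨j, z⟩ := q
  by_cases hij : i = j
  · subst hij
    have hxz : x ≠ z := fun h => hpq (by rw [h])
    refine ⟨|x - z| / 2, by have := abs_pos.2 (sub_ne_zero.2 hxz); positivity, ?_⟩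
    intro s t hs ht h
    have h' : x + s = z + t := by simpa using h
    have : |x - z| ≤ |t| + |s| := by
      rw [show x - z = t - s by linarith]; exact abs_sub t s
    linarith
  · exact ⟨1, one_pos, fun s t _ _ h => hij (congrArg Sigma.fst h)⟩

/-- The two-sided germs of a fibre `{p, q}` of a two-to-one map on a disjoint union of lines:
each of the four sides is mapped onto a one-sided neighbourhood of the value. -/
theorem exists_four_sides {ι : Type*} {h : (Σ _ : ι, ℝ) → ℝ} (hc : Continuous h)
    (hfib : ∀ y, ∃ p q, p ≠ q ∧ ∀ x, h x = y ↔ x = p ∨ x = q) (y : ℝ) :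
    ∃ M : ℝ, (∀ x, h x = y → |x.2| ≤ M) ∧ ∃ S : Bool × Bool → Set (Σ _ : ι, ℝ),
      (∀ j k, j ≠ k → Disjoint (S j) (S k)) ∧ (∀ k, ∀ x ∈ S k, |x.2| ≤ M) ∧
      ∀ k, h '' S k ∈ 𝓝[>] y ∨ h '' S k ∈ 𝓝[<] y := by
  obtain ⟨p, q, hpq, hy⟩ := hfib y
  obtain ⟨δ, hδ, hne⟩ := exists_pos_forall_sigma_mk_ne hpq
  let c : Bool → Σ _ : ι, ℝ := fun a => if a then p else q
  let σ : Bool → ℝ := fun b => if b then 1 else -1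
  have hσ : ∀ b, |σ b| = 1 := by simp [σ]
  have hcy : ∀ x, h x = y ↔ ∃ a, x = c a := by
    intro x; rw [hy]; simp [c, or_comm]
  have hcne : ∀ a a', a ≠ a' → ∀ s t : ℝ, |s| < δ → |t| < δ →
      (⟨(c a).1, (c a).2 + s⟩ : Σ _ : ι, ℝ) ≠ ⟨(c a').1, (c a').2 + t⟩ := by
    intro a a' haa' s t hs ht
    cases a <;> cases a' <;> simp only [ne_eq, not_true_eq_false] at haa'
    · exact (hne t s ht hs).symm
    · exact hne s t hs ht
  have hcM : ∀ a, |(c a).2| ≤ |p.2| + |q.2| := by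
    intro a
    cases a
    · exact le_add_of_nonneg_left (abs_nonneg _)
    · exact le_add_of_nonneg_right (abs_nonneg _)
  let r : Bool × Bool → ℝ → Σ _ : ι, ℝ := fun k s => ⟨(c k.1).1, (c k.1).2 + σ k.2 * s⟩
  have habs : ∀ b s, 0 < s → |σ b * s| = s := fun b s hs => by
    rw [abs_mul, hσ, one_mul, abs_of_pos hs]
  refine ⟨|p.2| + |q.2| + δ, ?_, fun k => r k '' Ioo 0 δ, ?_, ?_, ?_⟩
  · intro x hx
    obtain ⟨a, rfl⟩ := (hcy x).1 hx
    linarith [hcM a]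
  · rintro ⟨a, b⟩ ⟨a', b'⟩ hk
    rw [Set.disjoint_left]
    rintro _ ⟨s, hs, rfl⟩ ⟨t, ht, hst⟩
    by_cases ha : a = a'
    · subst ha
      have hb : b ≠ b' := fun h => hk (by rw [h])
      have h1 : σ b' * t = σ b * s := by simpa [r] using hst
      have hs0 := hs.1
      have ht0 := ht.1
      cases b <;> cases b' <;> simp [σ] at hb h1 <;> linarith
    · exact hcne a' a (Ne.symm ha) _ _ (by rw [habs _ _ ht.1]; exact ht.2)
        (by rw [habs _ _ hs.1]; exact hs.2) hst
  · rintro ⟨a, b⟩ _ ⟨s, hs, rfl⟩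
    calc |(c a).2 + σ b * s| ≤ |(c a).2| + |σ b * s| := abs_add_le _ _
      _ ≤ _ := by rw [habs _ _ hs.1]; linarith [hcM a, hs.2]
  · rintro ⟨a, b⟩
    have hr : Continuous (r (a, b)) := continuous_sigmaMk.comp (by fun_prop)
    have hr0 : h (r (a, b) 0) = y := (hcy _).2 ⟨a, by simp [r]⟩
    have hδ2 : h (r (a, b) (δ / 2)) ≠ y := by
      rw [Ne, hcy]
      rintro ⟨a', ha'⟩
      have hlt : |σ b * (δ / 2)| < δ := by rw [habs _ _ (by positivity)]; linarith
      by_cases haa : a = a'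
      · subst haa
        have h0 : (c a).2 + σ b * (δ / 2) = (c a).2 := by
          simpa [r] using congrArg (fun x : Σ _ : ι, ℝ => x.2) ha'
        have h1 := habs b (δ / 2) (by positivity)
        rw [add_eq_left.1 h0] at h1
        simp at h1
        linarith
      · exact hcne a a' haa _ 0 hlt (by simpa using hδ) (by simpa [r] using ha')
    have := image_mem_nhdsGT_or_nhdsLT (hc.comp hr) (x := 0) (t := δ / 2) (T := Ioo 0 δ)
      (by simpa only [Function.comp, hr0] using hδ2) (by
        rintro s ⟨hs, hs0⟩
        rw [uIcc_of_le (by positivity)] at hs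
        exact ⟨lt_of_le_of_ne hs.1 (Ne.symm hs0), by linarith [hs.2]⟩)
    rwa [image_comp, Function.comp_apply, hr0] at this

theorem false_of_pigeonhole_bool_prod {A B : Bool × Bool → Prop} (h : ∀ k, A k ∨ B k)
    (hA : ∀ j k l, j ≠ k → j ≠ l → k ≠ l → A j → A k → A l → False)
    (hB : ∀ j k, j ≠ k → B j → B k → False) : False := by
  rcases h (false, false) with a | a <;> rcases h (false, true) with b | b <;>
    rcases h (true, false) with c | c <;> rcases h (true, true) with d | d <;>
  first
  | exact hB _ _ (by decide) a b
  | exact hB _ _ (by decide) a c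
  | exact hB _ _ (by decide) a d
  | exact hB _ _ (by decide) b c
  | exact hB _ _ (by decide) b d
  | exact hB _ _ (by decide) c d
  | exact hA _ _ _ (by decide) (by decide) (by decide) a b c
  | exact hA _ _ _ (by decide) (by decide) (by decide) a b d
  | exact hA _ _ _ (by decide) (by decide) (by decide) a c d
  | exact hA _ _ _ (by decide) (by decide) (by decide) b c d

theorem exists_forall_not_frequently_mem_image {ι : Type*} {h : (Σ _ : ι, ℝ) → ℝ}
    (hc : Continuous h) (hfib : ∀ y, ∃ p q, p ≠ q ∧ ∀ x, h x = y ↔ x = p ∨ x = q) (y : ℝ) :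
    ∃ M : ℝ, ∀ T : Set (Σ _ : ι, ℝ), (∀ x ∈ T, M < |x.2|) → ¬ ∃ᶠ v in 𝓝 y, v ∈ h '' T := by
  obtain ⟨M, hM, S, hd, hSM, hS⟩ := exists_four_sides hc hfib y
  refine ⟨M, fun T hT hfreq => ?_⟩
  have hdT : ∀ k, Disjoint (S k) T := fun k =>
    Set.disjoint_left.2 fun x hx hxT => (hT x hxT).not_ge (hSM k x hx)
  have three : ∀ (F : Filter ℝ) [F.NeBot], ∀ j k l, j ≠ k → j ≠ l → k ≠ l →
      h '' S j ∈ F → h '' S k ∈ F → h '' S l ∈ F → False :=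
    fun F _ j k l hjk hjl hkl h1 h2 h3 =>
      not_three_of_card_fiber hfib (hd j k hjk) (hd j l hjl) (hd k l hkl) h1 h2
        (Eventually.frequently h3)
  have two : ∀ (F : Filter ℝ), (∃ᶠ v in F, v ∈ h '' T) → ∀ j k, j ≠ k →
      h '' S j ∈ F → h '' S k ∈ F → False :=
    fun F hF j k hjk h1 h2 => not_three_of_card_fiber hfib (hd j k hjk) (hdT j) (hdT k) h1 h2 hF
  have hne : ∃ᶠ v in 𝓝[<] y ⊔ 𝓝[>] y, v ∈ h '' T := by
    rw [nhdsLT_sup_nhdsGT, frequently_nhdsWithin_iff]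
    refine hfreq.mono fun v hv => ⟨hv, ?_⟩
    obtain ⟨x, hx, rfl⟩ := hv
    exact fun hxy => (hT x hx).not_ge (hM x hxy)
  rw [frequently_sup] at hne
  rcases hne with hF | hF
  · exact false_of_pigeonhole_bool_prod hS (three _) (two _ hF)
  · exact false_of_pigeonhole_bool_prod (fun k => (hS k).symm) (three _) (two _ hF)

theorem tendsto_ray {ι : Type*} {h : (Σ _ : ι, ℝ) → ℝ} (hc : Continuous h)
    (hfib : ∀ y, ∃ p q, p ≠ q ∧ ∀ x, h x = y ↔ x = p ∨ x = q) {r : ℝ → Σ _ : ι, ℝ}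
    (hr : Continuous r) (hr2 : ∀ t, |(r t).2| = |t|) :
    Tendsto (h ∘ r) atTop atTop ∨ Tendsto (h ∘ r) atTop atBot := by
  refine tendsto_atTop_or_atBot_of_not_mapClusterPt (hc.comp hr) fun y hy => ?_
  obtain ⟨M, hM⟩ := exists_forall_not_frequently_mem_image hc hfib y
  refine hM (r '' Ioi |M|) ?_ ?_
  · rintro _ ⟨t, ht, rfl⟩
    rw [hr2]
    exact (le_abs_self M).trans_lt (lt_of_lt_of_le ht (le_abs_self t))
  · rw [frequently_iff]
    intro U hU
    obtain ⟨t, htU, ht⟩ := ((mapClusterPt_iff_frequently.1 hy U hU).and_eventually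
      (eventually_gt_atTop |M|)).exists
    exact ⟨_, htU, _, ⟨t, ht, rfl⟩, rfl⟩

theorem card_le_two_of_two_to_one {ι : Type*} [Fintype ι] {h : (Σ _ : ι, ℝ) → ℝ}
    (hc : Continuous h) (hfib : ∀ y, ∃ p q, p ≠ q ∧ ∀ x, h x = y ↔ x = p ∨ x = q) :
    Fintype.card ι ≤ 2 := by
  classical
  by_contra! hcard
  let r : ι × Bool → ℝ → Σ _ : ι, ℝ := fun e t => ⟨e.1, if e.2 then t else -t⟩
  have hr : ∀ e, Continuous (r e) := by
    rintro ⟨i, b⟩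
    cases b
    · exact continuous_sigmaMk.comp continuous_neg
    · exact continuous_sigmaMk.comp continuous_id
  have himg : ∀ e, ∃ b : Bool, h '' (r e '' Ioi 0) ∈ (if b then atTop else atBot : Filter ℝ) := by
    intro e
    rw [← image_comp]
    rcases tendsto_ray hc hfib (hr e) (by rcases e with ⟨i, _ | _⟩ <;> simp [r]) with ht | ht
    · exact ⟨true, image_Ioi_mem_atTop (hc.comp (hr e)) ht 0⟩
    · exact ⟨false, image_Ioi_mem_atBot (hc.comp (hr e)) ht 0⟩
  choose s hs using himg
  obtain ⟨b, hb⟩ := Fintype.exists_lt_card_fiber_of_mul_lt_card (n := 2) s (by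
    simp only [Fintype.card_prod, Fintype.card_bool]; omega)
  obtain ⟨e₁, h1, e₂, h2, e₃, h3, h12, h13, h23⟩ := Finset.two_lt_card.1 hb
  simp only [Finset.mem_filter, Finset.mem_univ, true_and] at h1 h2 h3
  have hdisj : ∀ e e', e ≠ e' → Disjoint (r e '' Ioi 0) (r e' '' Ioi 0) := by
    rintro ⟨i, b⟩ ⟨j, c⟩ hne
    rw [Set.disjoint_left]
    rintro _ ⟨t, ht, rfl⟩ ⟨t', ht', htt⟩
    rw [mem_Ioi] at ht ht'
    obtain ⟨hij, hv⟩ := Sigma.mk.inj_iff.1 htt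
    have hbc : b ≠ c := fun hbc => hne (Prod.ext hij.symm hbc)
    have hv := eq_of_heq hv
    cases b <;> cases c <;> simp at hbc hv <;> linarith
  have hF : (if b then atTop else atBot : Filter ℝ).NeBot := by
    cases b <;> simp only [Bool.false_eq_true, if_true, if_false] <;> infer_instance
  exact not_three_of_card_fiber hfib (hdisj _ _ h12) (hdisj _ _ h13) (hdisj _ _ h23)
    (h1 ▸ hs e₁) (h2 ▸ hs e₂) (Eventually.frequently (h3 ▸ hs e₃))

theorem not_two_to_one_of_tendsto {u : ℝ → ℝ} (hu : Continuous u)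
    (hfib : ∀ y, ∃ p q, p ≠ q ∧ ∀ x, u x = y ↔ x = p ∨ x = q)
    (htop : Tendsto u atTop atTop) (hbot : Tendsto u atBot atBot) : False := by
  obtain ⟨p, q, hpq, h0⟩ : ∃ p q, p < q ∧ ∀ x, u x = 0 ↔ x = p ∨ x = q := by
    obtain ⟨p, q, hpq, h⟩ := hfib 0
    rcases hpq.lt_or_gt with hlt | hlt
    · exact ⟨p, q, hlt, h⟩
    · exact ⟨q, p, hlt, fun x => (h x).trans or_comm⟩
  have hp : u p = 0 := (h0 p).2 (Or.inl rfl)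
  have hq : u q = 0 := (h0 q).2 (Or.inr rfl)
  obtain ⟨m, hpm, hmq⟩ := exists_between hpq
  have hm : u m ≠ 0 := fun h => by
    rcases (h0 m).1 h with h | h
    · exact hpm.ne' h
    · exact hmq.ne h
  have hd : ∀ {a b c d : ℝ}, b ≤ c → Disjoint (Ioo a b) (Ioo c d) := fun hbc =>
    Set.disjoint_left.2 fun x hx hx' => absurd hx'.1 (by linarith [hx.2])
  rcases hm.lt_or_gt with hm | hm
  · obtain ⟨T, hT, hTp⟩ := ((hbot.eventually_lt_atBot 0).and (eventually_lt_atBot p)).exists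
    have hA := intermediate_value_Ioo' hpm.le hu.continuousOn
    have hB := intermediate_value_Ioo hmq.le hu.continuousOn
    have hC := intermediate_value_Ioo hTp.le hu.continuousOn
    rw [hp] at hA hC
    rw [hq] at hB
    exact not_three_of_card_fiber hfib (F := 𝓝[<] (0 : ℝ)) (hd le_rfl) (hd le_rfl).symm
      (hd hpm.le).symm
      (mem_of_superset (Ioo_mem_nhdsLT hm) hA) (mem_of_superset (Ioo_mem_nhdsLT hm) hB)
      (Eventually.frequently (mem_of_superset (Ioo_mem_nhdsLT hT) hC))
  · obtain ⟨T, hT, hTq⟩ := ((htop.eventually_gt_atTop 0).and (eventually_gt_atTop q)).exists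
    have hA := intermediate_value_Ioo hpm.le hu.continuousOn
    have hB := intermediate_value_Ioo' hmq.le hu.continuousOn
    have hC := intermediate_value_Ioo hTq.le hu.continuousOn
    rw [hp] at hA
    rw [hq] at hB hC
    exact not_three_of_card_fiber hfib (F := 𝓝[>] (0 : ℝ)) (hd le_rfl) (hd hmq.le) (hd le_rfl)
      (mem_of_superset (Ioo_mem_nhdsGT hm) hA) (mem_of_superset (Ioo_mem_nhdsGT hm) hB)
      (Eventually.frequently (mem_of_superset (Ioo_mem_nhdsGT hT) hC))

theorem card_ne_one_of_two_to_one {ι : Type*} [Fintype ι] {h : (Σ _ : ι, ℝ) → ℝ}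
    (hc : Continuous h) (hfib : ∀ y, ∃ p q, p ≠ q ∧ ∀ x, h x = y ↔ x = p ∨ x = q) :
    Fintype.card ι ≠ 1 := by
  intro hcard
  obtain ⟨i, hi⟩ := Fintype.card_eq_one_iff.1 hcard
  have hr : Continuous fun t : ℝ => (⟨i, t⟩ : Σ _ : ι, ℝ) :=
    continuous_sigmaMk (σ := fun _ : ι => ℝ)
  have hsurj : ∀ x : Σ _ : ι, ℝ, (⟨i, x.2⟩ : Σ _ : ι, ℝ) = x := fun ⟨j, t⟩ => by rw [hi j]
  set u : ℝ → ℝ := fun t => h ⟨i, t⟩ with hu_def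
  have hu : Continuous u := hc.comp hr
  have hufib : ∀ y, ∃ p q, p ≠ q ∧ ∀ x, u x = y ↔ x = p ∨ x = q := by
    intro y
    obtain ⟨p, q, hpq, hy⟩ := hfib y
    refine ⟨p.2, q.2, fun h => hpq (by rw [← hsurj p, ← hsurj q, h]), fun x => ?_⟩
    have aux : ∀ p : Σ _ : ι, ℝ, (⟨i, x⟩ : Σ _ : ι, ℝ) = p ↔ x = p.2 := fun p =>
      ⟨fun h => by rw [← h], fun h => by rw [h, hsurj]⟩
    rw [← aux, ← aux]
    exact hy _
  have hright : Tendsto u atTop atTop ∨ Tendsto u atTop atBot :=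
    tendsto_ray hc hfib hr fun t => rfl
  have hleft : Tendsto u atBot atTop ∨ Tendsto u atBot atBot := by
    have aux := tendsto_ray hc hfib (hr.comp continuous_neg) fun t => abs_neg t
    refine aux.imp (fun h => ?_) (fun h => ?_) <;>
      simpa [Function.comp_def] using h.comp tendsto_neg_atBot_atTop
  rcases hright with ht | ht <;> rcases hleft with hb | hb
  · obtain ⟨x, hx⟩ := hu.exists_forall_le (by rw [cocompact_eq_atBot_atTop]; exact hb.sup ht)
    obtain ⟨p, q, -, hp⟩ := hufib (u x - 1)
    linarith [hx p, (hp p).2 (Or.inl rfl)]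
  · exact not_two_to_one_of_tendsto hu hufib ht hb
  · refine not_two_to_one_of_tendsto (u := fun t => -u t) hu.neg (fun y => ?_)
      (tendsto_neg_atBot_atTop.comp ht) (tendsto_neg_atTop_atBot.comp hb)
    simpa only [neg_eq_iff_eq_neg] using hufib (-y)
  · obtain ⟨x, hx⟩ := hu.exists_forall_ge (by rw [cocompact_eq_atBot_atTop]; exact hb.sup ht)
    obtain ⟨p, q, -, hp⟩ := hufib (u x + 1)
    linarith [hx p, (hp p).2 (Or.inl rfl)]

theorem card_eq_two_of_two_to_one {ι : Type*} [Fintype ι] {h : (Σ _ : ι, ℝ) → ℝ}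
    (hc : Continuous h) (hfib : ∀ y, ∃ p q, p ≠ q ∧ ∀ x, h x = y ↔ x = p ∨ x = q) :
    Fintype.card ι = 2 := by
  have h1 := card_le_two_of_two_to_one hc hfib
  have h2 := card_ne_one_of_two_to_one hc hfib
  have h3 : 0 < Fintype.card ι := Fintype.card_pos_iff.2 ⟨(hfib 0).choose.1⟩
  omega

/-- A continuous exactly two-to-one map between finite disjoint unions of lines has twice as many
lines in its source as in its target. -/
theorem card_eq_two_mul_card_of_two_to_one {ι κ : Type*} [Fintype ι] [Fintype κ]
    {g : (Σ _ : ι, ℝ) → Σ _ : κ, ℝ} (hg : Continuous g)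
    (hfib : ∀ y, ∃ p q, p ≠ q ∧ ∀ x, g x = y ↔ x = p ∨ x = q) :
    Fintype.card ι = 2 * Fintype.card κ := by
  classical
  have hlift : ∀ i, ∃ k, ∃ v : ℝ → ℝ, Continuous v ∧ ∀ t, g ⟨i, t⟩ = ⟨k, v t⟩ := by
    intro i
    obtain ⟨k, v, hv, hgv⟩ := (hg.comp (continuous_sigmaMk (i := i))).exists_lift_sigma
    exact ⟨k, v, hv, fun t => congrFun hgv t⟩
  choose a u hu hau using hlift
  have hcard : ∀ k, Fintype.card {i // a i = k} = 2 := by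
    intro k
    refine card_eq_two_of_two_to_one (h := fun x : Σ _ : {i // a i = k}, ℝ => u x.1 x.2)
      (continuous_sigma fun i => hu i) fun y => ?_
    obtain ⟨⟨i, s⟩, ⟨j, t⟩, hpq, hy⟩ := hfib ⟨k, y⟩
    have hi : a i = k := by
      have := (hy ⟨i, s⟩).2 (Or.inl rfl)
      rw [hau] at this
      exact congrArg Sigma.fst this
    have hj : a j = k := by
      have := (hy ⟨j, t⟩).2 (Or.inr rfl)
      rw [hau] at this
      exact congrArg Sigma.fst this
    refine ⟨⟨⟨i, hi⟩, s⟩, ⟨⟨j, hj⟩, t⟩, fun h => hpq ?_, ?_⟩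
    · simpa using h
    · rintro ⟨⟨l, hl⟩, x⟩
      have := hy ⟨l, x⟩
      rw [hau] at this
      simpa [hl] using this
  calc Fintype.card ι = Fintype.card (Σ k, {i // a i = k}) :=
        Fintype.card_congr (Equiv.sigmaFiberEquiv a).symm
    _ = 2 * Fintype.card κ := by simp [Fintype.card_sigma, hcard, mul_comm]

/-- `P` is a finite set of points of `X` whose complement is homeomorphic to a disjoint union of
`k` open arcs. -/
def HasArcComplement {X : Type*} [TopologicalSpace X] (P : Set X) (k : ℕ) : Prop :=
  P.Finite ∧ ∃ (ι : Type) (_ : Fintype ι) (φ : (Σ _ : ι, ℝ) → X),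
    Fintype.card ι = k ∧ IsOpenEmbedding φ ∧ range φ = Pᶜ

theorem isOpenEmbedding_unitInterval_sigmoid : IsOpenEmbedding unitInterval.sigmoid := by
  refine ⟨Topology.isEmbedding_sigmoid, ?_⟩
  rw [unitInterval.range_sigmoid]
  exact isOpen_Ioo

theorem GraphStructure.hasArcComplement {G : Type} [TopologicalSpace G] [T2Space G]
    (S : GraphStructure G) : HasArcComplement S.V (@Fintype.card S.E S.Efin) := by
  let := S.Efin
  have hσ : ∀ t, unitInterval.sigmoid t ≠ 0 ∧ unitInterval.sigmoid t ≠ 1 := fun t =>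
    ⟨(unitInterval.sigmoid_pos t).ne', (unitInterval.sigmoid_lt_one t).ne⟩
  let Φ : (Σ _ : S.E, unitInterval) → G := fun x => S.edge x.1 x.2
  have hΦ : Continuous Φ := continuous_sigma S.edge_cont
  let χ : (Σ _ : S.E, ℝ) → Σ _ : S.E, unitInterval := Sigma.map id fun _ => unitInterval.sigmoid
  have hχ : IsOpenMap χ :=
    isOpenMap_sigma_map.2 fun _ => isOpenEmbedding_unitInterval_sigmoid.isOpenMap
  have hχc : Continuous χ :=
    Continuous.sigma_map fun _ => isOpenEmbedding_unitInterval_sigmoid.continuous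
  have hinj : ∀ x z, Φ (χ x) = Φ z → χ x = z := by
    rintro ⟨e, t⟩ ⟨e', s⟩ h
    have hs : S.edge e' s ∉ S.V := by
      rw [show S.edge e' s = S.edge e (unitInterval.sigmoid t) from h.symm]
      exact S.interior_not_vertex e _ (hσ t).1 (hσ t).2
    have hs0 : s ≠ 0 := fun h0 => hs (h0 ▸ S.endpoint0 e')
    have hs1 : s ≠ 1 := fun h1 => hs (h1 ▸ S.endpoint1 e')
    by_cases hee : e = e'
    · subst hee
      exact congrArg (Sigma.mk e) (S.edge_inj e h)
    · exact absurd h (S.interior_disjoint e e' hee _ _ (hσ t).1 (hσ t).2 hs0 hs1)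
  have hV : ∀ x, Φ (χ x) ∉ S.V := fun ⟨e, t⟩ => S.interior_not_vertex e _ (hσ t).1 (hσ t).2
  have hcov : ∀ x, x ∈ S.V ∨ ∃ z, Φ z = x := fun x =>
    (S.covers x).imp_right fun ⟨e, t, h⟩ => ⟨⟨e, t⟩, h⟩
  refine ⟨S.Vfin, S.E, S.Efin, Φ ∘ χ, rfl, ?_, ?_⟩
  · refine IsOpenEmbedding.of_continuous_injective_isOpenMap (hΦ.comp hχc) ?_ ?_
    · intro x y h
      exact Function.injective_id.sigma_map
        (fun _ => isOpenEmbedding_unitInterval_sigmoid.injective) (hinj x _ h)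
    · intro U hU
      have hW := hχ U hU
      have hcl : IsClosed (S.V ∪ Φ '' (χ '' U)ᶜ) :=
        S.Vfin.isClosed.union (hΦ.isClosedMap _ hW.isClosed_compl)
      rw [← isClosed_compl_iff]
      convert hcl using 1
      ext x
      simp only [mem_compl_iff, mem_union, mem_image, Function.comp_apply, not_exists, not_and]
      constructor
      · intro hx
        refine (hcov x).imp_right ?_
        rintro ⟨z, rfl⟩
        exact ⟨z, fun w hw hwz => hx w hw (by rw [hwz]), rfl⟩
      · rintro (hx | ⟨z, hz, rfl⟩) w hw h
        · exact hV w (h ▸ hx)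
        · exact hz w hw (hinj w z h)
  · ext x
    constructor
    · rintro ⟨z, rfl⟩
      exact hV z
    · intro hx
      obtain ⟨⟨e, t⟩, rfl⟩ := (hcov x).resolve_left hx
      have ht0 : t ≠ 0 := fun h0 => hx (h0 ▸ S.endpoint0 e)
      have ht1 : t ≠ 1 := fun h1 => hx (h1 ▸ S.endpoint1 e)
      have ht : t ∈ range unitInterval.sigmoid := by
        rw [unitInterval.range_sigmoid]
        exact ⟨unitInterval.pos_iff_ne_zero.2 ht0, unitInterval.lt_one_iff_ne_one.2 ht1⟩
      obtain ⟨s, rfl⟩ := ht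
      exact ⟨⟨e, s⟩, rfl⟩

namespace HasArcComplement

variable {X : Type*} [TopologicalSpace X] {P : Set X} {k : ℕ}

theorem insert_point (h : HasArcComplement P k) {x : X} (hx : x ∉ P) :
    HasArcComplement (insert x P) (k + 1) := by
  classical
  obtain ⟨hP, ι, _, φ, hcard, hφ, hrange⟩ := h
  obtain ⟨⟨i₀, t₀⟩, rfl⟩ : x ∈ range φ := by rw [hrange]; exact hx
  let c : Option ι → ℝ → ℝ := fun o t =>
    o.elim (t₀ - Real.exp t) fun i => if i = i₀ then t₀ + Real.exp t else t
  let d : Option ι → ι := fun o => o.elim i₀ id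
  have hplus : IsOpenEmbedding fun t => t₀ + Real.exp t :=
    (Homeomorph.addLeft t₀).isOpenEmbedding.comp Real.isOpenEmbedding_exp
  have hminus : IsOpenEmbedding fun t => t₀ - Real.exp t :=
    (Homeomorph.subLeft t₀).isOpenEmbedding.comp Real.isOpenEmbedding_exp
  have hc : ∀ o, IsOpenEmbedding (c o) := by
    rintro (_ | i)
    · exact hminus
    · by_cases hi : i = i₀
      · simpa [c, hi] using hplus
      · have : c (some i) = id := by funext t; simp [c, hi]
        rw [this]
        exact IsOpenEmbedding.id
  let χ : (Σ _ : Option ι, ℝ) → Σ _ : ι, ℝ := Sigma.map d c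
  have hχ : IsOpenEmbedding χ := by
    refine IsOpenEmbedding.of_continuous_injective_isOpenMap
      (Continuous.sigma_map fun o => (hc o).continuous) ?_
      (isOpenMap_sigma_map.2 fun o => (hc o).isOpenMap)
    rintro ⟨o, s⟩ ⟨o', t⟩ hst
    obtain ⟨hd, hv⟩ := Sigma.mk.inj_iff.1 hst
    have hv : c o s = c o' t := eq_of_heq hv
    have ho : o = o' := by
      have h1 := Real.exp_pos s
      have h2 := Real.exp_pos t
      rcases o with _ | i <;> rcases o' with _ | j
      · rfl
      · have hd : i₀ = j := hd
        simp [c, ← hd] at hv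
        linarith
      · have hd : i = i₀ := hd
        simp [c, hd] at hv
        linarith
      · exact congrArg some hd
    subst ho
    rw [(hc o).injective hv]
  have hχr : range χ = {⟨i₀, t₀⟩}ᶜ := by
    ext ⟨i, t⟩
    constructor
    · rintro ⟨⟨o, s⟩, hs⟩ hit
      have hs := Sigma.mk.inj_iff.1 (hs.trans hit)
      have hv : c o s = t₀ := eq_of_heq hs.2
      have h1 := Real.exp_pos s
      rcases o with _ | j
      · simp [c] at hv
      · have hd : j = i₀ := hs.1
        simp [c, hd] at hv
    · intro hit
      by_cases hi : i = i₀
      · subst hi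
        have hne : t ≠ t₀ := fun h => hit (by rw [h]; rfl)
        rcases hne.lt_or_gt with hlt | hlt
        · refine ⟨⟨none, Real.log (t₀ - t)⟩, Sigma.ext rfl (heq_of_eq ?_)⟩
          change c none (Real.log (t₀ - t)) = t
          simp [c, Real.exp_log (sub_pos.2 hlt)]
        · refine ⟨⟨some i, Real.log (t - t₀)⟩, Sigma.ext rfl (heq_of_eq ?_)⟩
          change c (some i) (Real.log (t - t₀)) = t
          simp [c, Real.exp_log (sub_pos.2 hlt)]
      · refine ⟨⟨some i, t⟩, Sigma.ext rfl (heq_of_eq ?_)⟩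
        change c (some i) t = t
        simp [c, hi]
  refine ⟨hP.insert _, Option ι, inferInstance, φ ∘ χ, by rw [Fintype.card_option, hcard],
    hφ.comp hχ, ?_⟩
  rw [range_comp, hχr, image_compl_eq_range_sdiff_image hφ.injective, hrange, image_singleton]
  ext z
  simp [not_or, and_comm]

theorem union_finite (h : HasArcComplement P k) {Q : Set X} (hQ : Q.Finite) :
    ∃ l : ℕ, HasArcComplement (P ∪ Q) l ∧
      (l : ℤ) - ((P ∪ Q).ncard : ℤ) = (k : ℤ) - (P.ncard : ℤ) := by
  induction Q, hQ using Set.Finite.induction_on with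
  | empty => exact ⟨k, by simpa using h, by simp⟩
  | @insert a Q _ _ ih =>
    obtain ⟨l, hl, hcount⟩ := ih
    rw [union_insert]
    by_cases ha : a ∈ P ∪ Q
    · rw [insert_eq_of_mem ha]
      exact ⟨l, hl, hcount⟩
    · refine ⟨l + 1, hl.insert_point ha, ?_⟩
      rw [ncard_insert_of_notMem ha hl.1]
      push_cast
      linarith

theorem exists_of_le (h : HasArcComplement P k) (hk : 0 < k) {N : ℕ} (hN : k ≤ N) :
    ∃ Q : Set X, HasArcComplement Q N ∧
      (N : ℤ) - (Q.ncard : ℤ) = (k : ℤ) - (P.ncard : ℤ) := by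
  induction N, hN using Nat.le_induction with
  | base => exact ⟨P, h, rfl⟩
  | succ N hN ih =>
    obtain ⟨Q, hQ, hcount⟩ := ih
    obtain ⟨x, hx⟩ : ∃ x, x ∉ Q := by
      obtain ⟨-, ι, _, φ, hcard, -, hrange⟩ := hQ
      obtain ⟨i⟩ := Fintype.card_pos_iff.1 (hcard ▸ hk.trans_le hN)
      exact ⟨φ ⟨i, 0⟩, hrange.subset ⟨_, rfl⟩⟩
    refine ⟨insert x Q, hQ.insert_point hx, ?_⟩
    rw [ncard_insert_of_notMem hx hQ.1]
    push_cast
    linarith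

end HasArcComplement

theorem HasArcComplement.sub_eq_two_mul_sub {X Y : Type*} [TopologicalSpace X] [TopologicalSpace Y]
    {P : Set X} {Q : Set Y} {k l : ℕ} (hP : HasArcComplement P k) (hQ : HasArcComplement Q l)
    {f : X → Y} (hfib : ∀ y, ∃ p q, p ≠ q ∧ ∀ x, f x = y ↔ x = p ∨ x = q)
    (hf : {x | ¬ ContinuousAt f x}.Finite) :
    (k : ℤ) - (P.ncard : ℤ) = 2 * ((l : ℤ) - (Q.ncard : ℤ)) := by
  classical
  choose p q hpq hpre using hfib
  set R : Set Y := Q ∪ f '' (P ∪ {x | ¬ ContinuousAt f x}) with hR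
  have hRfin : R.Finite := hQ.1.union ((hP.1.union hf).image f)
  have hpreR : f ⁻¹' R = p '' R ∪ q '' R := by
    ext x
    constructor
    · intro hx
      exact ((hpre (f x) x).1 rfl).imp (fun h => ⟨f x, hx, h.symm⟩) (fun h => ⟨f x, hx, h.symm⟩)
    · rintro (⟨y, hy, rfl⟩ | ⟨y, hy, rfl⟩)
      · rwa [mem_preimage, (hpre y _).2 (Or.inl rfl)]
      · rwa [mem_preimage, (hpre y _).2 (Or.inr rfl)]
  have hfp : ∀ y, f (p y) = y := fun y => (hpre y _).2 (Or.inl rfl)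
  have hfq : ∀ y, f (q y) = y := fun y => (hpre y _).2 (Or.inr rfl)
  have hcard : (f ⁻¹' R).ncard = 2 * R.ncard := by
    rw [hpreR, ncard_union_eq ?_ (hRfin.image p) (hRfin.image q),
      ncard_image_of_injective _ (Function.LeftInverse.injective hfp),
      ncard_image_of_injective _ (Function.LeftInverse.injective hfq), two_mul]
    rw [Set.disjoint_left]
    rintro _ ⟨y, -, rfl⟩ ⟨z, -, hz⟩
    have hzy : z = y := by rw [← hfq z, hz, hfp]
    exact hpq y (by rw [← hz, hzy])
  have hpreRfin : (f ⁻¹' R).Finite := hpreR ▸ (hRfin.image p).union (hRfin.image q)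
  obtain ⟨k', hk', hkk⟩ := hP.union_finite hpreRfin
  obtain ⟨l', hl', hll⟩ := hQ.union_finite hRfin
  have hPR : P ⊆ f ⁻¹' R := fun x hx => Or.inr ⟨x, Or.inl hx, rfl⟩
  rw [union_eq_right.2 hPR] at hk' hkk
  rw [union_eq_right.2 subset_union_left] at hl' hll
  obtain ⟨-, ι, _, φ, hι, hφ, hφr⟩ := hk'
  obtain ⟨-, κ, _, ψ, hκ, hψ, hψr⟩ := hl'
  have hφR : ∀ z, f (φ z) ∉ R := fun z => hφr.subset ⟨z, rfl⟩
  have hlift : ∀ z, ∃ w, ψ w = f (φ z) := fun z => hψr.superset (hφR z)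
  choose g hg using hlift
  have hgc : Continuous g := by
    rw [hψ.isInducing.continuous_iff, show ψ ∘ g = f ∘ φ from funext hg,
      continuous_iff_continuousAt]
    intro z
    refine ContinuousAt.comp ?_ hφ.continuous.continuousAt
    by_contra hz
    exact hφR z (Or.inr ⟨_, Or.inr hz, rfl⟩)
  have hgfib : ∀ y, ∃ p q, p ≠ q ∧ ∀ x, g x = y ↔ x = p ∨ x = q := by
    intro w
    have hw : ψ w ∉ R := hψr.subset ⟨w, rfl⟩
    obtain ⟨a, ha⟩ : p (ψ w) ∈ range φ := by
      rw [hφr]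
      exact fun h => hw (hfp (ψ w) ▸ h)
    obtain ⟨b, hb⟩ : q (ψ w) ∈ range φ := by
      rw [hφr]
      exact fun h => hw (hfq (ψ w) ▸ h)
    refine ⟨a, b, fun hab => hpq (ψ w) (by rw [← ha, ← hb, hab]), fun x => ?_⟩
    rw [← hψ.injective.eq_iff, hg, hpre, ← ha, ← hb, hφ.injective.eq_iff, hφ.injective.eq_iff]
  have := card_eq_two_mul_card_of_two_to_one hgc hgfib
  rw [hι, hκ] at this
  rw [hcard] at hkk
  push_cast [this] at hkk
  linarith

theorem HasArcComplement.exists_two_to_one {X Y : Type*} [TopologicalSpace X] [TopologicalSpace Y]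
    {P : Set X} {Q : Set Y} {k : ℕ} (hP : HasArcComplement P (2 * k)) (hQ : HasArcComplement Q k)
    (hPQ : P.ncard = 2 * Q.ncard) :
    ∃ f : X → Y, (∀ y, Nat.card (f ⁻¹' {y}) = 2) ∧ {x | ¬ ContinuousAt f x}.Finite := by
  classical
  obtain ⟨hPfin, ι, _, φ, hι, hφ, hφr⟩ := hP
  obtain ⟨hQfin, κ, _, ψ, hκ, hψ, hψr⟩ := hQ
  have := hPfin.to_subtype
  have := hQfin.to_subtype
  let eι : ι ≃ κ × Bool := Fintype.equivOfCardEq (by simp [hι, hκ, mul_comm])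
  obtain ⟨eP⟩ : Nonempty (P ≃ Q × Bool) := Finite.card_eq.1 (by
    rw [Nat.card_prod, Nat.card_coe_set_eq, Nat.card_coe_set_eq, hPQ,
      Nat.card_eq_fintype_card (α := Bool), Fintype.card_bool, mul_comm])
  let eX : P ⊕ (Σ _ : ι, ℝ) ≃ X := (Equiv.sumCongr (Equiv.refl _)
    ((Equiv.ofInjective φ hφ.injective).trans (Equiv.setCongr hφr))).trans (Equiv.Set.sumCompl P)
  let eY : Q ⊕ (Σ _ : κ, ℝ) ≃ Y := (Equiv.sumCongr (Equiv.refl _)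
    ((Equiv.ofInjective ψ hψ.injective).trans (Equiv.setCongr hψr))).trans (Equiv.Set.sumCompl Q)
  let c : P ⊕ (Σ _ : ι, ℝ) ≃ (Q ⊕ (Σ _ : κ, ℝ)) × Bool :=
    { toFun := Sum.elim (fun x => (Sum.inl (eP x).1, (eP x).2))
        (fun z => (Sum.inr ⟨(eι z.1).1, z.2⟩, (eι z.1).2))
      invFun := fun w => w.1.elim (fun y => Sum.inl (eP.symm (y, w.2)))
        (fun z => Sum.inr ⟨eι.symm (z.1, w.2), z.2⟩)
      left_inv := by rintro (x | ⟨i, t⟩) <;> simp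
      right_inv := by rintro ⟨(x | ⟨i, t⟩), b⟩ <;> simp }
  let e : X ≃ Y × Bool := (eX.symm.trans c).trans (Equiv.prodCongr eY (Equiv.refl Bool))
  have heφ : ∀ z, (e (φ z)).1 = ψ ⟨(eι z.1).1, z.2⟩ := by
    intro z
    have : eX.symm (φ z) = Sum.inr z := eX.symm_apply_eq.2 rfl
    change eY (c (eX.symm (φ z))).1 = _
    rw [this]
    rfl
  refine ⟨fun x => (e x).1, fun y => ?_, hPfin.subset ?_⟩
  · rw [← Fintype.card_bool, ← Nat.card_eq_fintype_card]
    refine Nat.card_congr ⟨fun x => (e x).2, fun b => ⟨e.symm (y, b), by simp⟩, ?_, ?_⟩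
    · rintro ⟨x, rfl⟩
      simp
    · intro b
      simp
  · intro x hx
    by_contra hxP
    obtain ⟨z, rfl⟩ : x ∈ range φ := by rw [hφr]; exact hxP
    refine hx (hφ.continuousAt_iff.1 ?_)
    rw [show (fun x => (e x).1) ∘ φ = fun z => ψ ⟨(eι z.1).1, z.2⟩ from funext heφ]
    refine (hψ.continuous.comp (continuous_sigma fun i => ?_)).continuousAt
    exact continuous_sigmaMk (σ := fun _ : κ => ℝ) (i := (eι i).1)

/-- The simple graph on the vertices in which distinct vertices joined by an edge are adjacent. -/
def GraphStructure.vertexGraph {G : Type} [TopologicalSpace G] (S : GraphStructure G) :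
    SimpleGraph S.V where
  Adj u v := u ≠ v ∧ ∃ e, s((⟨S.edge e 0, S.endpoint0 e⟩ : S.V), ⟨S.edge e 1, S.endpoint1 e⟩) =
    s(u, v)
  symm := ⟨fun _ _ h => ⟨h.1.symm, h.2.imp fun _ he => he.trans Sym2.eq_swap⟩⟩
  loopless := ⟨fun _ h => h.1 rfl⟩

theorem GraphStructure.vertexGraph_connected {G : Type} [TopologicalSpace G] [T2Space G]
    [ConnectedSpace G] (S : GraphStructure G) : S.vertexGraph.Connected := by
  let := S.Efin
  let src : S.E → S.V := fun e => ⟨S.edge e 0, S.endpoint0 e⟩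
  let tgt : S.E → S.V := fun e => ⟨S.edge e 1, S.endpoint1 e⟩
  have hreach : ∀ e, S.vertexGraph.Reachable (src e) (tgt e) := by
    intro e
    by_cases h : src e = tgt e
    · rw [h]
    · exact SimpleGraph.Adj.reachable ⟨h, e, rfl⟩
  have hne : Nonempty S.V := by
    obtain ⟨x⟩ := (inferInstance : Nonempty G)
    rcases S.covers x with hx | ⟨e, -⟩
    · exact ⟨⟨x, hx⟩⟩
    · exact ⟨src e⟩
  refine @SimpleGraph.Connected.mk _ _ (fun u v => ?_) hne
  by_contra huv
  let A : Set S.V := {w | S.vertexGraph.Reachable u w}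
  have hA : ∀ e, src e ∈ A ↔ tgt e ∈ A := fun e =>
    ⟨fun h => h.trans (hreach e), fun h => h.trans (hreach e).symm⟩
  let Z : Set S.V → Set G := fun B => Subtype.val '' B ∪ ⋃ e ∈ {e | src e ∈ B}, range (S.edge e)
  have hZ : ∀ B, IsClosed (Z B) := by
    intro B
    refine ((S.Vfin.subset (by rintro _ ⟨w, -, rfl⟩; exact w.2)).isClosed).union ?_
    exact (Set.toFinite _).isClosed_biUnion fun e _ => (isCompact_range (S.edge_cont e)).isClosed
  have hVZ : ∀ B : Set S.V, (∀ e, src e ∈ B ↔ tgt e ∈ B) → ∀ w : S.V, (w : G) ∈ Z B → w ∈ B := by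
    rintro B hB w (⟨w', hw', h⟩ | h)
    · rwa [← Subtype.ext h]
    · simp only [mem_iUnion] at h
      obtain ⟨e, he, t, ht⟩ := h
      by_cases ht0 : t = 0
      · subst ht0
        rwa [show w = src e from Subtype.ext ht.symm]
      by_cases ht1 : t = 1
      · subst ht1
        rw [show w = tgt e from Subtype.ext ht.symm]
        exact (hB e).1 he
      · exact absurd (ht ▸ w.2) (S.interior_not_vertex e t ht0 ht1)
  have hAc : ∀ e, src e ∈ Aᶜ ↔ tgt e ∈ Aᶜ := fun e => not_congr (hA e)
  have hdisj : Z Aᶜ = (Z A)ᶜ := by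
    ext x
    constructor
    · intro hx hx'
      by_cases hxV : x ∈ S.V
      · exact hVZ _ hAc ⟨x, hxV⟩ hx (hVZ _ hA ⟨x, hxV⟩ hx')
      · have aux : ∀ B, x ∈ Z B → ∃ e t, src e ∈ B ∧ S.edge e t = x := by
          rintro B (⟨w, -, rfl⟩ | h)
          · exact absurd w.2 hxV
          · simp only [mem_iUnion] at h
            obtain ⟨e, he, t, ht⟩ := h
            exact ⟨e, t, he, ht⟩
        obtain ⟨e, t, he, het⟩ := aux _ hx
        obtain ⟨e', t', he', het'⟩ := aux _ hx'
        have hend : ∀ e t, S.edge e t = x → t ≠ 0 ∧ t ≠ 1 := fun e t h =>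
          ⟨fun h0 => hxV (by rw [← h, h0]; exact S.endpoint0 e),
            fun h1 => hxV (by rw [← h, h1]; exact S.endpoint1 e)⟩
        exact S.interior_disjoint e e' (fun h => he (h ▸ he')) t t' (hend _ _ het).1
          (hend _ _ het).2 (hend _ _ het').1 (hend _ _ het').2 (het.trans het'.symm)
    · intro hx
      rcases S.covers x with hxV | ⟨e, t, het⟩
      · exact Or.inl ⟨⟨x, hxV⟩, fun h => hx (Or.inl ⟨_, h, rfl⟩), rfl⟩
      · refine Or.inr (mem_biUnion (x := e) (fun h => hx (Or.inr ?_)) ⟨t, het⟩)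
        exact mem_biUnion (x := e) h ⟨t, het⟩
  have hclopen : IsClopen (Z A) := ⟨hZ A, by rw [← isClosed_compl_iff, ← hdisj]; exact hZ _⟩
  have huniv := hclopen.eq_univ ⟨u, Or.inl ⟨u, SimpleGraph.Reachable.refl u, rfl⟩⟩
  exact huv (hVZ A hA v (huniv ▸ mem_univ _))

theorem GraphStructure.ncard_vertices_pos {G : Type} [TopologicalSpace G] [Nonempty G]
    (S : GraphStructure G) : 0 < S.V.ncard := by
  rw [ncard_pos S.Vfin]
  obtain ⟨x⟩ := (inferInstance : Nonempty G)
  rcases S.covers x with hx | ⟨e, -⟩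
  · exact ⟨x, hx⟩
  · exact ⟨_, S.endpoint0 e⟩

theorem GraphStructure.neg_one_le_eulerNumber {G : Type} [TopologicalSpace G] [T2Space G]
    [ConnectedSpace G] (S : GraphStructure G) : -1 ≤ S.eulerNumber := by
  classical
  let := S.Efin
  have := S.Vfin.to_subtype
  have h1 := S.vertexGraph_connected.card_vert_le_card_edgeSet_add_one
  have h2 : Nat.card S.vertexGraph.edgeSet ≤ Nat.card S.E := by
    have hsub : S.vertexGraph.edgeSet ⊆ range fun e : S.E =>
        s((⟨S.edge e 0, S.endpoint0 e⟩ : S.V), ⟨S.edge e 1, S.endpoint1 e⟩) := by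
      intro z
      induction z with
      | h u v => exact fun h => h.2
    calc Nat.card S.vertexGraph.edgeSet ≤ Nat.card (range fun e : S.E =>
        s((⟨S.edge e 0, S.endpoint0 e⟩ : S.V), ⟨S.edge e 1, S.endpoint1 e⟩)) :=
          Nat.card_mono (Set.toFinite _) hsub
      _ ≤ Nat.card S.E := Finite.card_range_le _
  rw [Nat.card_coe_set_eq] at h1
  rw [Nat.card_eq_fintype_card (α := S.E)] at h2
  unfold GraphStructure.eulerNumber
  omega

end TwoToOne

/-- For finite connected graphs `G`, `H` with Euler numbers `m`, `n`, there is
an exactly 2-to-1 function from `G` onto `H` with only finitely many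
discontinuities if and only if `m = 2n`. -/
theorem finitely_discontinuous_two_to_one_iff (G H : Type) [MetricSpace G]
    [CompactSpace G] [ConnectedSpace G] [MetricSpace H] [CompactSpace H]
    [ConnectedSpace H] (SG : GraphStructure G) (SH : GraphStructure H) :
    (∃ f : G → H, Function.Surjective f ∧ (∀ y : H, Nat.card (f ⁻¹' {y}) = 2) ∧
        {x : G | ¬ ContinuousAt f x}.Finite) ↔
      SG.eulerNumber = 2 * SH.eulerNumber := by
  constructor
  · rintro ⟨f, -, hf2, hf⟩
    refine SG.hasArcComplement.sub_eq_two_mul_sub SH.hasArcComplement (fun y => ?_) hf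
    obtain ⟨p, q, hpq, hy⟩ := Set.ncard_eq_two.1 ((Nat.card_coe_set_eq _).symm.trans (hf2 y))
    exact ⟨p, q, hpq, fun x => by simpa using Set.ext_iff.1 hy x⟩
  · intro h
    have hG1 := SG.neg_one_le_eulerNumber
    have hGV := SG.ncard_vertices_pos
    have hHV := SH.ncard_vertices_pos
    have hGarc := SG.hasArcComplement
    have hHarc := SH.hasArcComplement
    unfold GraphStructure.eulerNumber at h hG1
    generalize @Fintype.card SG.E SG.Efin = k at *
    generalize @Fintype.card SH.E SH.Efin = l at *
    obtain ⟨P, hP, hPcard⟩ := hGarc.exists_of_le (N := 2 * max k l) (by omega) (by omega)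
    obtain ⟨Q, hQ, hQcard⟩ := hHarc.exists_of_le (N := max k l) (by omega) (by omega)
    obtain ⟨f, hf2, hf⟩ := hP.exists_two_to_one hQ (by push_cast at hPcard hQcard; omega)
    refine ⟨f, fun y => ?_, hf2, hf⟩
    obtain ⟨⟨x, hx⟩⟩ := (Nat.card_pos_iff.1 (by rw [hf2 y]; exact two_pos)).1
    exact ⟨x, hx⟩
end

section
/- There exists an exactly 2-to-1 function from the closed unit disk onto a metric space that has exactly one point of discontinuity. -/
namespace TwoToOne

open Real Set Filter Topology

noncomputable section

/-- For `d > 0` the map `s ↦ winding d s` runs through `[0, 2)` as `s` runs through `[0, ∞)`, while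
`winding 0 s` runs only through `[0, 1)`. -/
def winding (d s : ℝ) : ℝ := s / (1 + s) + d * s / (1 + d * s)

lemma div_one_add_eq {t : ℝ} (ht : 0 ≤ t) : t / (1 + t) = 1 - 1 / (1 + t) := by
  field_simp; ring

lemma winding_nonneg {d s : ℝ} (hd : 0 ≤ d) (hs : 0 ≤ s) : 0 ≤ winding d s := by
  unfold winding; positivity

lemma winding_lt_two {d s : ℝ} (hd : 0 ≤ d) (hs : 0 ≤ s) : winding d s < 2 := by
  have hds : 0 ≤ d * s := by positivity
  rw [winding, div_one_add_eq hs, div_one_add_eq hds]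
  have h₁ : 0 < 1 / (1 + s) := by positivity
  have h₂ : 0 < 1 / (1 + d * s) := by positivity
  linarith

lemma winding_strictMonoOn {d : ℝ} (hd : 0 ≤ d) : StrictMonoOn (winding d) (Ici 0) := by
  intro s hs t ht hst
  have hs : 0 ≤ s := hs
  have ht : 0 ≤ t := ht
  have hds : 0 ≤ d * s := by positivity
  have hdt : 0 ≤ d * t := by positivity
  rw [winding, winding, div_one_add_eq hs, div_one_add_eq hds, div_one_add_eq ht,
    div_one_add_eq hdt]
  have h₁ : 1 / (1 + t) < 1 / (1 + s) := one_div_lt_one_div_of_lt (by positivity) (by linarith)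
  have h₂ : 1 / (1 + d * t) ≤ 1 / (1 + d * s) :=
    one_div_le_one_div_of_le (by positivity) (by nlinarith)
  linarith

lemma continuousOn_winding {d : ℝ} (hd : 0 ≤ d) : ContinuousOn (winding d) (Ici 0) := by
  unfold winding
  refine ContinuousOn.add (ContinuousOn.div (by fun_prop) (by fun_prop) ?_)
    (ContinuousOn.div (by fun_prop) (by fun_prop) ?_)
  · intro s hs
    have hs : 0 ≤ s := hs
    positivity
  · intro s hs
    have hs : 0 ≤ s := hs
    positivity

lemma exists_winding_eq {d c : ℝ} (hd : 0 < d) (hc₀ : 0 ≤ c) (hc : c < 2) :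
    ∃ s, 0 ≤ s ∧ winding d s = c := by
  have hc' : 0 < 2 - c := by linarith
  set S := 2 / (2 - c) + 2 / (d * (2 - c)) with hS
  have hS₀ : 0 ≤ S := by positivity
  have hdS : 0 ≤ d * S := by positivity
  have h₁ : 1 / (1 + S) ≤ (2 - c) / 2 := by
    have : 2 / (2 - c) ≤ 1 + S := by
      have : 0 ≤ 2 / (d * (2 - c)) := by positivity
      linarith
    calc 1 / (1 + S) ≤ 1 / (2 / (2 - c)) := one_div_le_one_div_of_le (by positivity) this
      _ = (2 - c) / 2 := one_div_div _ _
  have h₂ : 1 / (1 + d * S) ≤ (2 - c) / 2 := by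
    have : 2 / (2 - c) ≤ 1 + d * S := by
      have h : d * S = d * (2 / (2 - c)) + 2 / (2 - c) := by rw [hS]; field_simp
      have : 0 ≤ d * (2 / (2 - c)) := by positivity
      linarith
    calc 1 / (1 + d * S) ≤ 1 / (2 / (2 - c)) := one_div_le_one_div_of_le (by positivity) this
      _ = (2 - c) / 2 := one_div_div _ _
  have hcS : c ≤ winding d S := by
    rw [winding, div_one_add_eq hS₀, div_one_add_eq hdS]; linarith
  have h₀ : winding d 0 = 0 := by simp [winding]
  obtain ⟨s, hs, h⟩ := intermediate_value_Icc hS₀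
    ((continuousOn_winding hd.le).mono Icc_subset_Ici_self) ⟨h₀.symm ▸ hc₀, hcS⟩
  exact ⟨s, hs.1, h⟩

/-- The width of the loops over `x`; it vanishes exactly at the integers. -/
def width (x : ℝ) : ℝ := sin (π * x) ^ 2

lemma width_nonneg (x : ℝ) : 0 ≤ width x := sq_nonneg _

lemma width_eq_zero_iff {x : ℝ} : width x = 0 ↔ ∃ n : ℤ, x = n := by
  rw [width, sq_eq_zero_iff, sin_eq_zero_iff]
  refine exists_congr fun n ↦ ?_
  rw [mul_comm π, mul_left_inj' pi_ne_zero, eq_comm]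

def angle (q : ℝ × ℝ) : ℝ := 2 * π * winding (width q.1) q.2

/-- Vanishes exactly where the loops, degenerated to segments, have an endpoint. -/
def defect (q : ℝ × ℝ) : ℝ := width q.1 + sin (angle q) ^ 2

def level (q : ℝ × ℝ) : ℝ := q.1 + (1 - cos (angle q)) / 2

/-- The point `(x, cos A, width x * sin A)` runs twice around an ellipse over each noninteger `x`.
Over an integer `x` it runs once forth and back along a segment, whose endpoints are attained only
once; `level` glues the end of each such segment to the beginning of the next one. -/
def loopMap (q : ℝ × ℝ) : ℝ × ℝ × ℝ × ℝ × ℝ :=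
  (level q, defect q, defect q * q.1, defect q * cos (angle q),
    defect q * (width q.1 * sin (angle q)))

/-- A copy of the closed disk with a boundary point removed. -/
def domain : Set (ℝ × ℝ) := {q | 0 < q.1 ∧ 0 ≤ q.2}

lemma loopMap_eq_iff {r q : ℝ × ℝ} : loopMap r = loopMap q ↔
    (defect r = 0 ∧ defect q = 0 ∧ level r = level q) ∨
    (r.1 = q.1 ∧ cos (angle r) = cos (angle q) ∧
      width r.1 * sin (angle r) = width q.1 * sin (angle q)) := by
  constructor
  · intro h
    simp only [loopMap, Prod.mk.injEq] at h
    obtain ⟨h₁, h₂, h₃, h₄, h₅⟩ := h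
    by_cases h₀ : defect q = 0
    · exact Or.inl ⟨h₂.trans h₀, h₀, h₁⟩
    · rw [h₂] at h₃ h₄ h₅
      exact Or.inr ⟨mul_left_cancel₀ h₀ h₃, mul_left_cancel₀ h₀ h₄, mul_left_cancel₀ h₀ h₅⟩
  · rintro (⟨h₁, h₂, h₃⟩ | ⟨h₁, h₂, h₃⟩)
    · simp [loopMap, h₁, h₂, h₃]
    · have h₄ : level r = level q := by rw [level, level, h₁, h₂]
      have h₅ : defect r = defect q := by
        rw [defect, defect, sin_sq, sin_sq, h₁, h₂]
      simp only [loopMap, h₄, h₅, h₂, h₃]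
      rw [h₁]

lemma angle_of_width_eq_zero {q : ℝ × ℝ} (h : width q.1 = 0) :
    angle q = 2 * π * (q.2 / (1 + q.2)) := by
  simp [angle, winding, h]

/-- The endpoints of a degenerate loop have only the parameters `0` and `1`. -/
lemma defect_eq_zero_iff {q : ℝ × ℝ} (hq : q ∈ domain) :
    defect q = 0 ↔ width q.1 = 0 ∧ (q.2 = 0 ∨ q.2 = 1) := by
  have hs : 0 ≤ q.2 := hq.2
  rw [defect, add_eq_zero_iff_of_nonneg (width_nonneg _) (sq_nonneg _), sq_eq_zero_iff]
  refine and_congr_right fun h ↦ ?_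
  rw [angle_of_width_eq_zero h, sin_eq_zero_iff]
  constructor
  · rintro ⟨n, hn⟩
    have h₁ : (n : ℝ) = 2 * (q.2 / (1 + q.2)) := by
      apply mul_right_cancel₀ pi_ne_zero; rw [hn]; ring
    have h₂ : (n : ℝ) * (1 + q.2) = 2 * q.2 := by
      rw [h₁]; field_simp
    have h₃ : (0 : ℝ) ≤ n := by rw [h₁]; positivity
    have h₄ : (n : ℝ) < 2 := by
      by_contra! h
      nlinarith
    have h₃' : 0 ≤ n := by exact_mod_cast h₃
    have h₄' : n < 2 := by exact_mod_cast h₄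
    interval_cases n
    · left; push_cast at h₂; linarith
    · right; push_cast at h₂; linarith
  · rintro (h | h)
    · exact ⟨0, by simp [h]⟩
    · exact ⟨1, by rw [h]; push_cast; ring⟩

lemma level_zero {x : ℝ} (h : width x = 0) : level (x, 0) = x := by
  simp [level, angle_of_width_eq_zero (q := (x, 0)) h]

lemma level_one {x : ℝ} (h : width x = 0) : level (x, 1) = x + 1 := by
  rw [level, angle_of_width_eq_zero (q := (x, 1)) h,
    show 2 * π * ((1 : ℝ) / (1 + 1)) = π by ring]
  simp only [cos_pi]; ring

/-- Over an integer, `s ↦ s⁻¹` is the flip of the segment. -/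
lemma cos_angle_eq_iff {x s t : ℝ} (hx : width x = 0) (hs : 0 ≤ s) (ht : 0 ≤ t) :
    cos (angle (x, s)) = cos (angle (x, t)) ↔ s = t ∨ s * t = 1 := by
  rw [angle_of_width_eq_zero (q := (x, s)) hx, angle_of_width_eq_zero (q := (x, t)) hx]
  simp only
  constructor
  · intro h
    obtain ⟨k, hk⟩ := cos_eq_cos_iff.1 h
    have hs₀ : 0 ≤ s / (1 + s) := by positivity
    have ht₀ : 0 ≤ t / (1 + t) := by positivity
    have hs₁ : s / (1 + s) < 1 := by rw [div_lt_one (by positivity)]; linarith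
    have ht₁ : t / (1 + t) < 1 := by rw [div_lt_one (by positivity)]; linarith
    have hπ : 2 * π ≠ 0 := by positivity
    rcases hk with hk | hk
    · have hk' : t / (1 + t) = k + s / (1 + s) := by
        apply mul_left_cancel₀ hπ; rw [hk]; ring
      have h₁ : -1 < k := by exact_mod_cast (by linarith : (-1 : ℝ) < k)
      have h₂ : k < 1 := by exact_mod_cast (by linarith : (k : ℝ) < 1)
      obtain rfl : k = 0 := by omega
      left
      rw [Int.cast_zero, zero_add, div_eq_div_iff (by positivity) (by positivity)] at hk'
      linarith
    · have hk' : t / (1 + t) = k - s / (1 + s) := by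
        apply mul_left_cancel₀ hπ; rw [hk]; ring
      have h₁ : -1 < k := by exact_mod_cast (by linarith : (-1 : ℝ) < k)
      have h₂ : k < 2 := by exact_mod_cast (by linarith : (k : ℝ) < 2)
      obtain rfl | rfl : k = 0 ∨ k = 1 := by omega
      · left
        push_cast at hk'
        have hs₂ : s / (1 + s) = 0 := by linarith
        have ht₂ : t / (1 + t) = 0 := by linarith
        rw [div_eq_zero_iff] at hs₂ ht₂
        rcases hs₂ with h | h <;> rcases ht₂ with h' | h' <;> linarith
      · right
        push_cast at hk'
        field_simp at hk'
        linarith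
  · rintro (rfl | h)
    · rfl
    · have h₁ : t / (1 + t) = 1 - s / (1 + s) := by
        field_simp; linarith
      rw [h₁, show 2 * π * (1 - s / (1 + s)) = 2 * π - 2 * π * (s / (1 + s)) by ring,
        cos_two_pi_sub]

/-- Over a noninteger, two parameters yield the same point iff they differ by a full turn. -/
lemma loopMap_eq_iff_of_width_ne_zero {r q : ℝ × ℝ} (hr : r ∈ domain) (hq : q ∈ domain)
    (h : width q.1 ≠ 0) : loopMap r = loopMap q ↔
      r.1 = q.1 ∧ ∃ k : ℤ, winding (width q.1) r.2 = winding (width q.1) q.2 + k := by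
  rw [loopMap_eq_iff, defect_eq_zero_iff hr, defect_eq_zero_iff hq]
  simp only [h, false_and, and_false, false_or]
  refine and_congr_right fun h₁ ↦ ?_
  rw [h₁, mul_right_inj' h]
  constructor
  · rintro ⟨hc, hs⟩
    have : (angle r : Real.Angle) = angle q := Real.Angle.cos_sin_inj hc hs
    obtain ⟨k, hk⟩ := Real.Angle.angle_eq_iff_two_pi_dvd_sub.1 this
    refine ⟨k, ?_⟩
    simp only [angle, h₁] at hk
    apply mul_left_cancel₀ (by positivity : 2 * π ≠ 0)
    linarith
  · rintro ⟨k, hk⟩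
    have : angle r = angle q + k * (2 * π) := by
      simp only [angle, h₁, hk]; ring
    rw [this]
    exact ⟨cos_add_int_mul_two_pi _ _, sin_add_int_mul_two_pi _ _⟩

lemma exists_partner_of_width_ne_zero {q : ℝ × ℝ} (hq : q ∈ domain) (h : width q.1 ≠ 0) :
    ∃ q' ∈ domain, q' ≠ q ∧ ∀ r ∈ domain, loopMap r = loopMap q ↔ r = q ∨ r = q' := by
  obtain ⟨x, s⟩ := q
  have hd : 0 < width x := (width_nonneg x).lt_of_ne' h
  have hs : 0 ≤ s := hq.2
  have h₀ := winding_nonneg hd.le hs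
  have h₂ := winding_lt_two hd.le hs
  have hinj := (winding_strictMonoOn hd.le).injOn
  obtain ⟨t, ht, j, hj, htj⟩ : ∃ t, 0 ≤ t ∧ ∃ j : ℤ, (j = 1 ∧ winding (width x) s < 1 ∨
      j = -1 ∧ 1 ≤ winding (width x) s) ∧ winding (width x) t = winding (width x) s + j := by
    rcases lt_or_ge (winding (width x) s) 1 with h₁ | h₁
    · obtain ⟨t, ht, e⟩ := exists_winding_eq (c := winding (width x) s + 1) hd (by linarith)
        (by linarith)
      exact ⟨t, ht, 1, Or.inl ⟨rfl, h₁⟩, by simpa using e⟩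
    · obtain ⟨t, ht, e⟩ := exists_winding_eq (c := winding (width x) s - 1) hd (by linarith)
        (by linarith)
      exact ⟨t, ht, -1, Or.inr ⟨rfl, h₁⟩, by push_cast; linarith⟩
  refine ⟨(x, t), ⟨hq.1, ht⟩, ?_, ?_⟩
  · rintro h
    obtain rfl : t = s := congrArg Prod.snd h
    have : (j : ℝ) = 0 := by linarith
    have : j = 0 := by exact_mod_cast this
    omega
  · rintro ⟨y, r⟩ hr
    have hr₀ : 0 ≤ r := hr.2
    rw [loopMap_eq_iff_of_width_ne_zero hr hq h]
    simp only [Prod.mk.injEq]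
    rw [← and_or_left]
    refine and_congr_right fun _ ↦ ?_
    constructor
    · rintro ⟨k, hk⟩
      have h₀' := winding_nonneg hd.le hr₀
      have h₂' := winding_lt_two hd.le hr₀
      obtain rfl | rfl : k = 0 ∨ k = j := by
        rcases hj with ⟨rfl, h₁⟩ | ⟨rfl, h₁⟩
        · have h₃ : -1 < k := by exact_mod_cast (by linarith : (-1 : ℝ) < k)
          have h₄ : k < 2 := by exact_mod_cast (by linarith : (k : ℝ) < 2)
          omega
        · have h₃ : -2 < k := by exact_mod_cast (by linarith : (-2 : ℝ) < k)
          have h₄ : k < 1 := by exact_mod_cast (by linarith : (k : ℝ) < 1)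
          omega
      · exact Or.inl (hinj hr₀ hs (by simpa using hk))
      · exact Or.inr (hinj hr₀ ht (hk.trans htj.symm))
    · rintro (rfl | rfl)
      · exact ⟨0, by simp⟩
      · exact ⟨j, htj⟩

lemma exists_partner_of_defect_ne_zero {q : ℝ × ℝ} (hq : q ∈ domain) (h : width q.1 = 0)
    (h' : defect q ≠ 0) :
    ∃ q' ∈ domain, q' ≠ q ∧ ∀ r ∈ domain, loopMap r = loopMap q ↔ r = q ∨ r = q' := by
  obtain ⟨x, s⟩ := q
  have hs : 0 ≤ s := hq.2
  have hx : width x = 0 := h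
  have h₀ : s ≠ 0 ∧ s ≠ 1 := by
    rw [Ne, defect_eq_zero_iff hq] at h'
    tauto
  refine ⟨(x, s⁻¹), ⟨hq.1, inv_nonneg.2 hs⟩, ?_, ?_⟩
  · intro e
    have e : s⁻¹ = s := congrArg Prod.snd e
    have e' : s * s = 1 := by nth_rw 1 [← e]; exact inv_mul_cancel₀ h₀.1
    have : (s - 1) * (s + 1) = 0 := by linarith
    rcases mul_eq_zero.1 this with h | h
    · exact h₀.2 (by linarith)
    · linarith
  · rintro ⟨y, r⟩ hr
    rw [loopMap_eq_iff]
    simp only [h', false_and, and_false, false_or, Prod.mk.injEq]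
    rw [← and_or_left]
    refine and_congr_right fun e ↦ ?_
    subst e
    rw [cos_angle_eq_iff hx hr.2 hs, ← mul_eq_one_iff_eq_inv₀ h₀.1]
    simp [hx]

/-- At the endpoints of the segments, only `level` matters. -/
lemma loopMap_eq_iff_of_defect_eq_zero {r q : ℝ × ℝ} (h : defect q = 0) :
    loopMap r = loopMap q ↔ defect r = 0 ∧ level r = level q := by
  constructor
  · intro e
    simp only [loopMap, Prod.mk.injEq] at e
    exact ⟨e.2.1.trans h, e.1⟩
  · rintro ⟨h₁, h₂⟩
    exact loopMap_eq_iff.2 (Or.inl ⟨h₁, h, h₂⟩)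

lemma width_intCast (n : ℤ) : width n = 0 := width_eq_zero_iff.2 ⟨n, rfl⟩

lemma width_add_one {x : ℝ} (h : width x = 0) : width (x + 1) = 0 := by
  obtain ⟨n, rfl⟩ := width_eq_zero_iff.1 h
  exact_mod_cast width_intCast (n + 1)

lemma width_sub_one {x : ℝ} (h : width x = 0) : width (x - 1) = 0 := by
  obtain ⟨n, rfl⟩ := width_eq_zero_iff.1 h
  exact_mod_cast width_intCast (n - 1)

lemma defect_eq_zero_and_level_eq_iff {r : ℝ × ℝ} {y : ℝ} (hr : r ∈ domain) (hy : width y = 0) :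
    defect r = 0 ∧ level r = y ↔ r = (y, 0) ∨ r = (y - 1, 1) := by
  obtain ⟨x, s⟩ := r
  rw [defect_eq_zero_iff hr]
  simp only [Prod.mk.injEq]
  constructor
  · rintro ⟨⟨hx, rfl | rfl⟩, hl⟩
    · rw [level_zero hx] at hl; exact Or.inl ⟨hl, rfl⟩
    · rw [level_one hx] at hl; exact Or.inr ⟨by linarith, rfl⟩
  · rintro (⟨rfl, rfl⟩ | ⟨rfl, rfl⟩)
    · exact ⟨⟨hy, Or.inl rfl⟩, level_zero hy⟩
    · exact ⟨⟨width_sub_one hy, Or.inr rfl⟩, by rw [level_one (width_sub_one hy)]; ring⟩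

lemma one_zero_mem_domain : ((1, 0) : ℝ × ℝ) ∈ domain := ⟨one_pos, le_rfl⟩

lemma width_one : width 1 = 0 := by exact_mod_cast width_intCast 1

lemma defect_one_zero : defect (1, 0) = 0 :=
  (defect_eq_zero_iff one_zero_mem_domain).2 ⟨width_one, Or.inl rfl⟩

lemma loopMap_eq_loopMap_one_zero_iff {r : ℝ × ℝ} (hr : r ∈ domain) :
    loopMap r = loopMap (1, 0) ↔ r = (1, 0) := by
  rw [loopMap_eq_iff_of_defect_eq_zero defect_one_zero, level_zero width_one,
    defect_eq_zero_and_level_eq_iff hr width_one, or_iff_left]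
  rintro rfl
  simp [domain] at hr

theorem exists_partner {q : ℝ × ℝ} (hq : q ∈ domain) (h : q ≠ (1, 0)) :
    ∃ q' ∈ domain, q' ≠ q ∧ ∀ r ∈ domain, loopMap r = loopMap q ↔ r = q ∨ r = q' := by
  by_cases hw : width q.1 = 0
  swap
  · exact exists_partner_of_width_ne_zero hq hw
  by_cases hd : defect q = 0
  swap
  · exact exists_partner_of_defect_ne_zero hq hw hd
  obtain ⟨x, s⟩ := q
  have hx : 0 < x := hq.1
  obtain ⟨-, rfl | rfl⟩ := (defect_eq_zero_iff hq).1 hd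
  · obtain ⟨n, rfl⟩ := width_eq_zero_iff.1 hw
    have hn : 1 < n := by
      have h₁ : 0 < n := by exact_mod_cast hx
      have h₂ : n ≠ 1 := by rintro rfl; simp at h
      omega
    have hn' : (1 : ℝ) < n := by exact_mod_cast hn
    refine ⟨(n - 1, 1), ⟨by simpa using hn', zero_le_one⟩, by simp, fun r hr ↦ ?_⟩
    rw [loopMap_eq_iff_of_defect_eq_zero hd, level_zero hw, defect_eq_zero_and_level_eq_iff hr hw]
  · refine ⟨(x + 1, 0), ⟨by positivity, le_rfl⟩, by simp, fun r hr ↦ ?_⟩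
    rw [loopMap_eq_iff_of_defect_eq_zero hd, level_one hw,
      defect_eq_zero_and_level_eq_iff hr (width_add_one hw), add_sub_cancel_right, or_comm]

lemma continuousAt_loopMap {q : ℝ × ℝ} (hq : q ∈ domain) : ContinuousAt loopMap q := by
  have hs : 0 ≤ q.2 := hq.2
  have hd := width_nonneg q.1
  have hwidth : ContinuousAt (fun q : ℝ × ℝ ↦ width q.1) q := by unfold width; fun_prop
  have hangle : ContinuousAt angle q := by
    unfold angle winding
    refine continuousAt_const.mul (.add (.div (by fun_prop) (by fun_prop) (by positivity))
      (.div (by fun_prop) (by fun_prop) (by positivity)))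
  have hdefect : ContinuousAt defect q := by unfold defect; fun_prop
  have hlevel : ContinuousAt level q := by unfold level; fun_prop
  unfold loopMap
  fun_prop

/-- The closed unit disk. -/
abbrev Disk : Type := Metric.closedBall (0 : EuclideanSpace ℝ (Fin 2)) 1

lemma mem_disk_iff {z : EuclideanSpace ℝ (Fin 2)} :
    z ∈ Metric.closedBall (0 : EuclideanSpace ℝ (Fin 2)) 1 ↔ z 0 ^ 2 + z 1 ^ 2 ≤ 1 := by
  rw [mem_closedBall_zero_iff, ← sq_le_one_iff₀ (norm_nonneg _), EuclideanSpace.real_norm_sq_eq,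
    Fin.sum_univ_two]

lemma disk_ext {z w : Disk} (h₀ : z.1 0 = w.1 0) (h₁ : z.1 1 = w.1 1) : z = w := by
  ext i
  fin_cases i
  · exact h₀
  · exact h₁

/-- The boundary point `1`. -/
def pole : Disk := ⟨!₂[1, 0], mem_disk_iff.2 (by simp)⟩

def sqDistPole (z : Disk) : ℝ := (1 - z.1 0) ^ 2 + z.1 1 ^ 2

lemma sqDistPole_pos {z : Disk} (hz : z ≠ pole) : 0 < sqDistPole z := by
  refine lt_of_le_of_ne (by unfold sqDistPole; positivity) fun h ↦ hz ?_
  obtain ⟨h₁, h₂⟩ := (add_eq_zero_iff_of_nonneg (sq_nonneg _) (sq_nonneg _)).1 h.symm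
  rw [sq_eq_zero_iff] at h₁ h₂
  exact disk_ext (by simp [pole]; linarith) (by simp [pole, h₂])

/-- The Cayley transform `(1 + z) / (1 - z)` with the exponential applied to the imaginary part. -/
def cayley (z : Disk) : ℝ × ℝ :=
  (exp (2 * z.1 1 / sqDistPole z), (1 - (z.1 0 ^ 2 + z.1 1 ^ 2)) / sqDistPole z)

def cayleyInvDenom (q : ℝ × ℝ) : ℝ := (1 + q.2) ^ 2 + log q.1 ^ 2

/-- The vector underlying the inverse of `cayley`. -/
def cayleyInvVec (q : ℝ × ℝ) : EuclideanSpace ℝ (Fin 2) :=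
  !₂[1 - 2 * (1 + q.2) / cayleyInvDenom q, 2 * log q.1 / cayleyInvDenom q]

lemma cayleyInvDenom_pos {q : ℝ × ℝ} (hq : q ∈ domain) : 0 < cayleyInvDenom q := by
  have : 0 ≤ q.2 := hq.2
  unfold cayleyInvDenom
  positivity

lemma cayleyInvVec_mem {q : ℝ × ℝ} (hq : q ∈ domain) :
    cayleyInvVec q ∈ Metric.closedBall (0 : EuclideanSpace ℝ (Fin 2)) 1 := by
  have hs : 0 ≤ q.2 := hq.2
  have hM := cayleyInvDenom_pos hq
  rw [mem_disk_iff]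
  have : cayleyInvVec q 0 ^ 2 + cayleyInvVec q 1 ^ 2 = 1 - 4 * q.2 / cayleyInvDenom q := by
    simp only [cayleyInvVec]
    simp
    field_simp
    unfold cayleyInvDenom
    ring
  rw [this]
  have : 0 ≤ 4 * q.2 / cayleyInvDenom q := by positivity
  linarith

def cayleyInv (q : ℝ × ℝ) (hq : q ∈ domain) : Disk := ⟨cayleyInvVec q, cayleyInvVec_mem hq⟩

lemma sqDistPole_cayleyInv {q : ℝ × ℝ} (hq : q ∈ domain) :
    sqDistPole (cayleyInv q hq) = 4 / cayleyInvDenom q := by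
  have hM := cayleyInvDenom_pos hq
  simp only [sqDistPole, cayleyInv, cayleyInvVec]
  simp
  field_simp
  unfold cayleyInvDenom
  ring

lemma cayleyInv_ne_pole {q : ℝ × ℝ} (hq : q ∈ domain) : cayleyInv q hq ≠ pole := by
  intro h
  have h₁ := sqDistPole_cayleyInv hq
  have hM := cayleyInvDenom_pos hq
  rw [h] at h₁
  have h₂ : sqDistPole pole = 0 := by simp [sqDistPole, pole]
  have : 0 < 4 / cayleyInvDenom q := by positivity
  linarith

lemma cayley_cayleyInv {q : ℝ × ℝ} (hq : q ∈ domain) : cayley (cayleyInv q hq) = q := by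
  have hM := cayleyInvDenom_pos hq
  rw [cayley, sqDistPole_cayleyInv hq]
  ext
  · simp only [cayleyInv, cayleyInvVec]
    rw [← exp_log hq.1]
    simp
    field_simp
    ring
  · simp only [cayleyInv, cayleyInvVec]
    simp
    field_simp
    unfold cayleyInvDenom
    ring

lemma cayley_mem {z : Disk} (hz : z ≠ pole) : cayley z ∈ domain :=
  ⟨exp_pos _, div_nonneg (sub_nonneg.2 (mem_disk_iff.1 z.2)) (sqDistPole_pos hz).le⟩

lemma cayleyInv_cayley {z : Disk} (hz : z ≠ pole) : cayleyInv (cayley z) (cayley_mem hz) = z := by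
  have hN := sqDistPole_pos hz
  have hM : cayleyInvDenom (cayley z) = 4 / sqDistPole z := by
    simp only [cayleyInvDenom, cayley, log_exp]
    field_simp
    unfold sqDistPole
    ring
  apply disk_ext
  · simp only [cayleyInv, cayleyInvVec, hM]
    simp [cayley]
    field_simp
    unfold sqDistPole
    ring
  · simp only [cayleyInv, cayleyInvVec, hM]
    simp [cayley]
    field_simp
    ring

lemma cayley_injOn : InjOn cayley {pole}ᶜ := by
  intro z hz w hw h
  rw [← cayleyInv_cayley hz, ← cayleyInv_cayley hw]
  simp only [h]

lemma continuousAt_cayley {z : Disk} (hz : z ≠ pole) : ContinuousAt cayley z := by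
  have hN := (sqDistPole_pos hz).ne'
  have h₀ : Continuous fun z : Disk ↦ z.1 0 := by fun_prop
  have h₁ : Continuous fun z : Disk ↦ z.1 1 := by fun_prop
  have hc : Continuous sqDistPole := by unfold sqDistPole; fun_prop
  have := hc.continuousAt (x := z)
  have := h₀.continuousAt (x := z)
  have := h₁.continuousAt (x := z)
  unfold cayley
  exact .prodMk (.rexp (.div (by fun_prop) (by fun_prop) hN)) (.div (by fun_prop) (by fun_prop) hN)

open Classical in
/-- The pole is given the value that `loopMap` attains only once. -/
def diskMap (z : Disk) : ℝ × ℝ × ℝ × ℝ × ℝ :=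
  loopMap (if z = pole then (1, 0) else cayley z)

lemma diskMap_pole : diskMap pole = loopMap (1, 0) := by simp [diskMap]

lemma diskMap_of_ne {z : Disk} (hz : z ≠ pole) : diskMap z = loopMap (cayley z) := by
  simp [diskMap, hz]

theorem exists_diskMap_eq_iff (z : Disk) :
    ∃ a b, a ≠ b ∧ ∀ w, diskMap w = diskMap z ↔ w = a ∨ w = b := by
  by_cases h : diskMap z = loopMap (1, 0)
  · refine ⟨pole, cayleyInv _ one_zero_mem_domain, (cayleyInv_ne_pole _).symm, fun w ↦ ?_⟩
    by_cases hw : w = pole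
    · simp [hw, h, diskMap_pole]
    · rw [h, diskMap_of_ne hw, loopMap_eq_loopMap_one_zero_iff (cayley_mem hw), or_iff_right hw]
      constructor
      · intro e
        rw [← cayleyInv_cayley hw]
        simp only [e]
      · rintro rfl
        exact cayley_cayleyInv _
  · have hz : z ≠ pole := by
      rintro rfl
      exact h diskMap_pole
    rw [diskMap_of_ne hz] at h ⊢
    obtain ⟨q, hq, hne, hiff⟩ := exists_partner (cayley_mem hz) fun e ↦ h (by rw [e])
    refine ⟨z, cayleyInv q hq, ?_, fun w ↦ ?_⟩
    · intro e
      rw [e, cayley_cayleyInv hq] at hne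
      exact hne rfl
    · by_cases hw : w = pole
      · subst hw
        rw [diskMap_pole]
        exact iff_of_false (fun e ↦ h e.symm)
          (not_or_intro hz.symm (cayleyInv_ne_pole hq).symm)
      · rw [diskMap_of_ne hw, hiff _ (cayley_mem hw), cayley_injOn.eq_iff hw hz]
        refine or_congr_right ?_
        nth_rw 1 [← cayley_cayleyInv hq]
        exact cayley_injOn.eq_iff hw (cayleyInv_ne_pole hq)

lemma continuousAt_diskMap {z : Disk} (hz : z ≠ pole) : ContinuousAt diskMap z := by
  have h : ContinuousAt (fun z ↦ loopMap (cayley z)) z :=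
    ContinuousAt.comp (g := loopMap) (continuousAt_loopMap (cayley_mem hz)) (continuousAt_cayley hz)
  refine h.congr ?_
  filter_upwards [isOpen_ne.mem_nhds hz] with w hw
  exact (diskMap_of_ne hw).symm

lemma exp_natCast_mem_domain (n : ℕ) : ((exp n, 0) : ℝ × ℝ) ∈ domain := ⟨exp_pos _, le_rfl⟩

lemma tendsto_cayleyInv_exp :
    Tendsto (fun n : ℕ ↦ cayleyInv (exp n, 0) (exp_natCast_mem_domain n)) atTop (𝓝 pole) := by
  have hc : Tendsto (fun n : ℕ ↦ (n : ℝ)⁻¹) atTop (𝓝 0) := tendsto_inv_atTop_nhds_zero_nat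
  have hn : ∀ᶠ n : ℕ in atTop, (n : ℝ) ≠ 0 :=
    (eventually_ne_atTop 0).mono fun n hn ↦ Nat.cast_ne_zero.2 hn
  have hlim (f : ℝ → ℝ) (hf : Continuous f) :
      Tendsto (fun n : ℕ ↦ f ((n : ℝ)⁻¹)) atTop (𝓝 (f 0)) := (hf.tendsto 0).comp hc
  rw [tendsto_subtype_rng]
  refine ((PiLp.continuous_toLp 2 _).tendsto _).comp (tendsto_pi_nhds.2 fun i ↦ ?_)
  have hden (x : ℝ) : x ^ 2 + 1 ≠ 0 := by positivity
  fin_cases i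
  · have := hlim (fun x ↦ 1 - 2 * x ^ 2 / (x ^ 2 + 1)) (by fun_prop (disch := exact hden _))
    refine (this.congr' ?_).trans_eq (by simp)
    filter_upwards [hn] with n hn
    simp [cayleyInvDenom]
    field_simp
  · have := hlim (fun x ↦ 2 * x / (x ^ 2 + 1)) (by fun_prop (disch := exact hden _))
    refine (this.congr' ?_).trans_eq (by simp)
    filter_upwards [hn] with n hn
    simp [cayleyInvDenom]
    field_simp

lemma diskMap_cayleyInv_exp_fst (n : ℕ) :
    (diskMap (cayleyInv (exp n, 0) (exp_natCast_mem_domain n))).1 = exp n := by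
  rw [diskMap_of_ne (cayleyInv_ne_pole _), cayley_cayleyInv]
  simp [loopMap, level, angle, winding]

lemma not_continuousAt_diskMap : ¬ ContinuousAt diskMap pole := by
  intro h
  have h₁ := (continuous_fst.tendsto _).comp (h.tendsto.comp tendsto_cayleyInv_exp)
  have h₂ : Tendsto (fun n : ℕ ↦ exp (n : ℝ)) atTop (𝓝 (diskMap pole).1) :=
    h₁.congr diskMap_cayleyInv_exp_fst
  exact not_tendsto_nhds_of_tendsto_atTop
    (tendsto_exp_atTop.comp tendsto_natCast_atTop_atTop) _ h₂

end

end TwoToOne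

/-- (K. Kuperberg) There is an exactly 2-to-1 function from the closed unit
disk onto a metric space with exactly one point of discontinuity. -/
theorem kuperberg_two_to_one_on_disk :
    ∃ (Y : Type) (_ : MetricSpace Y)
      (f : (Metric.closedBall (0 : EuclideanSpace ℝ (Fin 2)) 1) → Y),
      Function.Surjective f ∧ (∀ y : Y, Nat.card (f ⁻¹' {y}) = 2) ∧
      {x : (Metric.closedBall (0 : EuclideanSpace ℝ (Fin 2)) 1) |
        ¬ ContinuousAt f x}.ncard = 1 := by
  refine ⟨Set.range TwoToOne.diskMap, inferInstance, Set.rangeFactorization TwoToOne.diskMap,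
    Set.rangeFactorization_surjective, ?_, ?_⟩
  · rintro ⟨_, z, rfl⟩
    obtain ⟨a, b, hab, h⟩ := TwoToOne.exists_diskMap_eq_iff z
    rw [Nat.card_coe_set_eq]
    refine Eq.trans (congrArg Set.ncard (Set.ext fun w ↦ ?_)) (Set.ncard_pair hab)
    exact Subtype.ext_iff.trans (h w)
  · rw [Set.ncard_eq_one]
    refine ⟨TwoToOne.pole, Set.ext fun z ↦ ?_⟩
    rw [Set.mem_ofPred_eq, Set.mem_singleton_iff, Topology.IsInducing.subtypeVal.continuousAt_iff]
    refine ⟨fun h ↦ ?_, ?_⟩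
    · by_contra hz
      exact h (TwoToOne.continuousAt_diskMap hz)
    · rintro rfl
      exact TwoToOne.not_continuousAt_diskMap
end
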